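/- (Bannai–Ito conjecture, proved by Bang, Dubickas, Koolen, and Moulton.) For every integer k ≥ 3 there exist, up to isomorphism, only finitely many distance-regular graphs of valency k; equivalently, there is a constant N(k) such that every distance-regular graph with valency k has at most N(k) vertices. -/

import Mathlib

open Matrix Filter

/-- A (bundled) distance-regular graph: a finite connected simple graph of diameter `d`
with intersection numbers `a i`, `b i`, `c i` for `0 ≤ i ≤ d`; `b 0` is the valency `k`. -/
structure DRG where
  X : Type
  fin : Fintype X
  G : SimpleGraph X
  d : ℕ
  a : ℕ → ℕ
  b : ℕ → ℕ
  c : ℕ → ℕ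
  conn : G.Connected
  dist_le : ∀ x y : X, G.dist x y ≤ d
  dist_eq : ∃ x y : X, G.dist x y = d
  bd : b d = 0
  c0 : c 0 = 0
  count_c : ∀ i ≤ d, ∀ x y : X, G.dist x y = i →
      {z : X | G.Adj y z ∧ G.dist x z = i - 1}.ncard = c i
  count_a : ∀ i ≤ d, ∀ x y : X, G.dist x y = i →
      {z : X | G.Adj y z ∧ G.dist x z = i}.ncard = a i
  count_b : ∀ i ≤ d, ∀ x y : X, G.dist x y = i →
      {z : X | G.Adj y z ∧ G.dist x z = i + 1}.ncard = b i

attribute [instance] DRG.fin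

noncomputable instance (Γ : DRG) : DecidableEq Γ.X := Classical.decEq _

noncomputable instance (Γ : DRG) : DecidableRel Γ.G.Adj := fun _ _ => Classical.dec _

namespace DRG

variable (Γ : DRG)

/-- The `i`-th distance matrix (over `ℂ`). -/
noncomputable def Amat (i : ℕ) : Matrix Γ.X Γ.X ℂ :=
  Matrix.of fun x y => if Γ.G.dist x y = i then 1 else 0

/-- The adjacency algebra `A(Γ) = span_ℂ {A_0, …, A_d}`. -/
noncomputable def adjAlg : Submodule ℂ (Matrix Γ.X Γ.X ℂ) :=
  Submodule.span ℂ {M | ∃ i ≤ Γ.d, M = Γ.Amat i}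

/-- The matrix `K_t = (t^{∂(x,y)})_{x,y}` (over `ℝ`). -/
noncomputable def Kmat (t : ℝ) : Matrix Γ.X Γ.X ℝ :=
  Matrix.of fun x y => t ^ Γ.G.dist x y

/-- `t ∈ π(Γ)`, i.e. `K_t` is positive semidefinite. -/
def piMem (t : ℝ) : Prop := (Γ.Kmat t).PosSemidef

/-- The Gibbs functional `φ_t(B) = ∑_x t^{∂(x,o)} B_{x,o}` with base vertex `o`. -/
noncomputable def gibbs (t : ℝ) (o : Γ.X) (B : Matrix Γ.X Γ.X ℂ) : ℂ :=
  ∑ x : Γ.X, (t : ℂ) ^ Γ.G.dist x o * B x o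

end DRG

section Principle
open Polynomial

theorem one_le_prod_sub_of_splits_int {q : ℤ[X]} (hq : q.Monic)
    {R : Finset ℝ} (hR : q.map (Int.castRingHom ℝ) = ∏ x ∈ R, (X - C x)) :
    1 ≤ ∏ x ∈ R, ∏ y ∈ R.erase x, |x - y| := by
  classical
  have hsp : (q.map (Int.castRingHom ℝ)).Splits := by
    rw [hR]; exact Splits.prod (fun x _ => Splits.X_sub_C x)
  have hroots : (q.map (Int.castRingHom ℝ)).roots = R.val := by
    rw [hR]; simpa using roots_prod_X_sub_C R
  have hnd : (q.map (Int.castRingHom ℝ)).natDegree = q.natDegree := hq.natDegree_map _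
  have h1 := resultant_eq_prod_eval (q.map (Int.castRingHom ℝ))
    (derivative q |>.map (Int.castRingHom ℝ)) (derivative q).natDegree natDegree_map_le hsp
  rw [hnd, resultant_map_map, (hq.map _).leadingCoeff, one_pow, one_mul, hroots] at h1
  have h2 : (R.val.map (fun x => eval x ((derivative q).map (Int.castRingHom ℝ)))).prod
      = ∏ x ∈ R, ∏ y ∈ R.erase x, (x - y) := by
    change ∏ x ∈ R, _ = _
    refine Finset.prod_congr rfl fun x hx => ?_
    rw [← derivative_map, hR]
    have := Lagrange.eval_nodal_derivative_eval_node_eq (s := R) (v := fun x : ℝ => x) hx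
    simpa [Lagrange.nodal, eval_prod] using this
  rw [h2] at h1
  have h3 : ∏ x ∈ R, ∏ y ∈ R.erase x, |x - y| = |∏ x ∈ R, ∏ y ∈ R.erase x, (x - y)| := by
    simp [Finset.abs_prod]
  have h4 : ∏ x ∈ R, ∏ y ∈ R.erase x, (x - y) ≠ 0 := by
    refine Finset.prod_ne_zero_iff.2 fun x _ => Finset.prod_ne_zero_iff.2 fun y hy => ?_
    exact sub_ne_zero.2 (Finset.ne_of_mem_erase hy).symm
  rw [h3, ← h1]
  rw [← h1] at h4
  have h5 : (Int.castRingHom ℝ) (q.resultant (derivative q) q.natDegree (derivative q).natDegree) =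
    ((q.resultant (derivative q) q.natDegree (derivative q).natDegree : ℤ) : ℝ) := rfl
  rw [h5] at h4 ⊢
  rw [← Int.cast_abs]
  have : q.resultant (derivative q) q.natDegree (derivative q).natDegree ≠ 0 := by exact_mod_cast h4
  exact_mod_cast Int.one_le_abs this

/-- All complex roots of the minimal polynomial of `θ` over `ℤ` are elements of `S`. -/
def ConjIn (S : Finset ℝ) (θ : ℝ) : Prop :=
  IsIntegral ℤ θ ∧ ∀ z : ℂ, aeval z (minpoly ℤ θ) = 0 → ∃ θ' ∈ S, (θ' : ℂ) = z

theorem ConjIn.map_minpoly_eq {S : Finset ℝ} {θ : ℝ} (h : ConjIn S θ) :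
    (minpoly ℤ θ).map (Int.castRingHom ℝ) =
      ∏ x ∈ S with aeval x (minpoly ℤ θ) = 0, (X - C x) := by
  classical
  set q := minpoly ℤ θ with hqdef
  have hm : q.Monic := minpoly.monic h.1
  have hmR : (q.map (Int.castRingHom ℝ)).Monic := hm.map _
  have hcomp : (q.map (Int.castRingHom ℝ)).map Complex.ofRealHom = q.map (Int.castRingHom ℂ) := by
    rw [Polynomial.map_map]; congr 1
  have hev : ∀ x : ℝ, eval x (q.map (Int.castRingHom ℝ)) = aeval x q := fun x => by
    rw [eval_map, aeval_def]; rfl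
  have hroot : ∀ z ∈ ((q.map (Int.castRingHom ℝ)).map Complex.ofRealHom).roots,
      ∃ θ' ∈ S, (θ' : ℂ) = z := by
    intro z hz
    apply h.2
    rw [hcomp] at hz
    have := (mem_roots'.1 hz).2
    rw [IsRoot, eval_map] at this
    rw [aeval_def]; exact this
  have hsp : (q.map (Int.castRingHom ℝ)).Splits := by
    refine Splits.of_splits_map_of_injective (i := Complex.ofRealHom)
      Complex.ofRealHom.injective (IsAlgClosed.splits _) ?_
    intro z hz
    obtain ⟨t, _, ht⟩ := hroot z hz
    exact ⟨t, ht⟩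
  have hsep : (q.map (Int.castRingHom ℝ)).Separable := by
    have h1 : (minpoly ℚ θ).Separable := (minpoly.irreducible h.1.tower_top).separable
    have h2 : minpoly ℚ θ = q.map (algebraMap ℤ ℚ) :=
      minpoly.isIntegrallyClosed_eq_field_fractions' ℚ h.1
    have h3 := h1.map (f := algebraMap ℚ ℝ)
    rw [h2, Polynomial.map_map] at h3
    rwa [RingHom.ext_int (Int.castRingHom ℝ) ((algebraMap ℚ ℝ).comp (algebraMap ℤ ℚ))]
  have hnd := nodup_roots hsep
  have heq : (q.map (Int.castRingHom ℝ)).roots.toFinset = S.filter (fun x => aeval x q = 0) := by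
    ext x
    rw [Multiset.mem_toFinset, mem_roots hmR.ne_zero, IsRoot, hev, Finset.mem_filter]
    refine ⟨fun hx => ⟨?_, hx⟩, fun hx => hx.2⟩
    have : aeval (x : ℂ) q = 0 := by
      have := congrArg Complex.ofReal hx
      rw [← hev] at this
      rw [aeval_def, ← eval_map]
      have h3 := eval_map_apply (f := Complex.ofRealHom) (p := q.map (Int.castRingHom ℝ)) x
      rw [hcomp] at h3
      change eval (Complex.ofRealHom x) (q.map (Int.castRingHom ℂ)) = 0
      rw [h3]; simpa using this
    obtain ⟨t, ht, h'⟩ := h.2 _ this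
    have : t = x := by exact_mod_cast h'
    exact this ▸ ht
  have h2 := prod_multiset_X_sub_C_of_monic_of_roots_card_eq hmR hsp.natDegree_eq_card_roots.symm
  rw [← heq, Finset.prod, Multiset.toFinset_val, hnd.dedup]
  exact h2.symm

theorem prod_sub_le {R T : Finset ℝ} (hT : T ⊆ R) {L l : ℝ} (hL : 1 ≤ L) (hl : 0 ≤ l)
    (hR : ∀ x ∈ R, ∀ y ∈ R, |x - y| ≤ L) (hTl : ∀ x ∈ T, ∀ y ∈ T, |x - y| ≤ l) :
    ∏ x ∈ R, ∏ y ∈ R.erase x, |x - y| ≤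
      l ^ (T.card * (T.card - 1)) * L ^ (R.card * R.card) := by
  classical
  have hL0 : (0:ℝ) ≤ L := by linarith
  have gen : ∀ x ∈ R, ∀ U ⊆ R, ∏ y ∈ U, |x - y| ≤ L ^ U.card := by
    intro x hx U hU
    rw [← Finset.prod_const]
    exact Finset.prod_le_prod (fun _ _ => abs_nonneg _) (fun y hy => hR x hx y (hU hy))
  have hrow : ∀ x ∈ R, ∏ y ∈ R.erase x, |x - y| ≤
      (if x ∈ T then l ^ (T.card - 1) else 1) * L ^ R.card := by
    intro x hx
    split_ifs with hxT
    · have hsub : T.erase x ⊆ R.erase x := Finset.erase_subset_erase _ hT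
      rw [← Finset.prod_sdiff hsub, mul_comm]
      refine mul_le_mul ?_ ?_ (Finset.prod_nonneg fun _ _ => abs_nonneg _) (by positivity)
      · rw [← Finset.card_erase_of_mem hxT, ← Finset.prod_const]
        exact Finset.prod_le_prod (fun _ _ => abs_nonneg _)
          (fun y hy => hTl x hxT y (Finset.mem_of_mem_erase hy))
      · refine (gen x hx _ (Finset.sdiff_subset.trans (Finset.erase_subset _ _))).trans ?_
        exact pow_le_pow_right₀ hL (Finset.card_le_card
          (Finset.sdiff_subset.trans (Finset.erase_subset _ _)))
    · rw [one_mul]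
      refine (gen x hx _ (Finset.erase_subset _ _)).trans ?_
      exact pow_le_pow_right₀ hL (Finset.card_le_card (Finset.erase_subset _ _))
  refine (Finset.prod_le_prod (fun x _ => Finset.prod_nonneg fun _ _ => abs_nonneg _)
    hrow).trans (le_of_eq ?_)
  rw [Finset.prod_mul_distrib, Finset.prod_const, ← pow_mul, ← Finset.prod_filter,
    Finset.prod_const, Finset.filter_mem_eq_inter, Finset.inter_eq_right.2 hT, ← pow_mul]
  ring

theorem minpoly_int_eq_of_aeval_eq_zero {θ x : ℝ} (hθ : IsIntegral ℤ θ) (hx : IsIntegral ℤ x)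
    (h : aeval x (minpoly ℤ θ) = 0) : minpoly ℤ x = minpoly ℤ θ := by
  have h1 : minpoly ℤ x ∣ minpoly ℤ θ := minpoly.isIntegrallyClosed_dvd hx h
  have h2 := (minpoly.prime_of_isIntegrallyClosed hθ).irreducible
  have h3 := (minpoly.prime_of_isIntegrallyClosed hx).irreducible
  exact eq_of_monic_of_associated (minpoly.monic hx) (minpoly.monic hθ)
    (h3.associated_of_dvd h2 h1)

theorem finite_conjIn_of_natDegree_le (B : ℝ) (D : ℕ) :
    {θ : ℝ | (∃ S : Finset ℝ, ConjIn S θ ∧ ∀ x ∈ S, |x| ≤ B) ∧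
      (minpoly ℤ θ).natDegree ≤ D}.Finite := by
  classical
  let C := Nat.ceil (max B 1 ^ D * D.choose (D / 2))
  have := bUnion_roots_finite (Int.castRingHom ℝ) D (Set.finite_Icc (-C : ℤ) C)
  refine this.subset fun θ hx => ?_
  obtain ⟨⟨S, hS, hB⟩, hD⟩ := hx
  simp_rw [Set.mem_iUnion]
  have hm := minpoly.monic hS.1
  have hsp : ((minpoly ℤ θ).map (Int.castRingHom ℝ)).Splits := by
    rw [hS.map_minpoly_eq]; exact Splits.prod (fun x _ => Splits.X_sub_C x)
  refine ⟨minpoly ℤ θ, ⟨hD, fun i => ?_⟩, ?_⟩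
  · have hmap : (minpoly ℤ θ).map (Int.castRingHom ℝ) =
        ((minpoly ℤ θ).map (Int.castRingHom ℚ)).map (algebraMap ℚ ℝ) := by
      rw [Polynomial.map_map]; congr 1
    have h := coeff_bdd_of_roots_le (B := B) (d := D) (algebraMap ℚ ℝ)
      (p := (minpoly ℤ θ).map (Int.castRingHom ℚ)) (hm.map _) (hmap ▸ hsp)
      (natDegree_map_le.trans hD) (by
        rw [← hmap, hS.map_minpoly_eq]
        intro z hz
        have : z ∈ S := by
          have h2 := roots_prod_X_sub_C (S.filter fun x => aeval x (minpoly ℤ θ) = 0)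
          rw [h2] at hz
          exact (Finset.mem_filter.1 hz).1
        exact hB z this) i
    rw [← hmap, coeff_map] at h
    have h2 : |((minpoly ℤ θ).coeff i : ℝ)| ≤ C := h.trans (Nat.le_ceil _)
    rw [Set.mem_Icc, ← abs_le]
    exact_mod_cast h2
  · rw [Finset.mem_coe, Multiset.mem_toFinset, mem_roots (hm.map _).ne_zero, IsRoot, eval_map]
    have := minpoly.aeval ℤ θ
    rw [aeval_def] at this
    exact this

theorem conj_concentration (B : ℝ) (hB : 1 ≤ B) (ρ : ℝ) (hρ : 0 < ρ) :
    ∃ l > 0, ∃ M : ℕ, ∀ S : Finset ℝ, (∀ θ ∈ S, ConjIn S θ ∧ |θ| ≤ B) → ∀ T ⊆ S,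
      (∀ θ ∈ T, ∀ θ' ∈ T, minpoly ℤ θ = minpoly ℤ θ' → |θ - θ'| ≤ l) →
      (T.card : ℝ) ≤ ρ * S.card + M := by
  classical
  set D := ⌈2 / ρ⌉₊ with hD
  set N := ⌈4 / ρ ^ 2⌉₊ + 1 with hN
  set L := 2 * B with hL
  have hL1 : 1 < L := by linarith
  have hfin := finite_conjIn_of_natDegree_le B D
  refine ⟨(L ^ N)⁻¹, by positivity, hfin.toFinset.card, fun S hS T hTS hT => ?_⟩
  have hcard := Finset.card_filter_add_card_filter_not (s := T)
    (fun θ => (minpoly ℤ θ).natDegree ≤ D)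
  set T1 := T.filter (fun θ => (minpoly ℤ θ).natDegree ≤ D)
  set T2 := T.filter (fun θ => ¬ (minpoly ℤ θ).natDegree ≤ D) with hT2
  have h1 : T1.card ≤ hfin.toFinset.card := by
    refine Finset.card_le_card fun θ hθ => ?_
    have := Finset.mem_filter.1 hθ
    simp only [Set.Finite.mem_toFinset, Set.mem_ofPred_eq]
    exact ⟨⟨S, (hS θ (hTS this.1)).1, fun x hx => (hS x hx).2⟩, this.2⟩
  have h2 : (T2.card : ℝ) ≤ ρ * S.card := by
    set Q := T2.image (minpoly ℤ) with hQ
    have e1 : T2.card = ∑ q ∈ Q, (T2.filter (fun x => minpoly ℤ x = q)).card :=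
      Finset.card_eq_sum_card_fiberwise (fun x hx => Finset.mem_image_of_mem _ hx)
    have e2 : ∑ q ∈ Q, (S.filter (fun x => minpoly ℤ x = q)).card ≤ S.card := by
      rw [← Finset.card_biUnion]
      · refine Finset.card_le_card fun x hx => ?_
        obtain ⟨q, _, h⟩ := Finset.mem_biUnion.1 hx
        exact (Finset.mem_filter.1 h).1
      · intro q _ q' _ hqq
        refine Finset.disjoint_left.2 fun x hx hx' => hqq ?_
        rw [← (Finset.mem_filter.1 hx).2, (Finset.mem_filter.1 hx').2]
    have e3 : ∀ q ∈ Q, ((T2.filter (fun x => minpoly ℤ x = q)).card : ℝ) ≤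
        ρ * (S.filter (fun x => minpoly ℤ x = q)).card := by
      intro q hq
      obtain ⟨θ, hθ, rfl⟩ := Finset.mem_image.1 hq
      obtain ⟨hθT, hdeg⟩ := Finset.mem_filter.1 hθ
      have hθS := hTS hθT
      have hfib : S.filter (fun x => minpoly ℤ x = minpoly ℤ θ) =
          S.filter (fun x => aeval x (minpoly ℤ θ) = 0) := by
        refine Finset.filter_congr fun x hx => ⟨fun h => ?_, fun h => ?_⟩
        · rw [← h]; exact minpoly.aeval _ _
        · exact minpoly_int_eq_of_aeval_eq_zero (hS θ hθS).1.1 (hS x hx).1.1 h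
      have hmap := (hS θ hθS).1.map_minpoly_eq
      rw [← hfib] at hmap
      have hge := one_le_prod_sub_of_splits_int (minpoly.monic (hS θ hθS).1.1) hmap
      set R := S.filter (fun x => minpoly ℤ x = minpoly ℤ θ)
      set U := T2.filter (fun x => minpoly ℤ x = minpoly ℤ θ)
      have hRdeg : R.card = (minpoly ℤ θ).natDegree := by
        rw [← (minpoly.monic (hS θ hθS).1.1).natDegree_map (Int.castRingHom ℝ), hmap,
          natDegree_finsetProd_X_sub_C_eq_card]
      have hUT : ∀ x ∈ U, x ∈ T ∧ minpoly ℤ x = minpoly ℤ θ := fun x hx =>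
        ⟨(Finset.mem_filter.1 (Finset.mem_filter.1 hx).1).1, (Finset.mem_filter.1 hx).2⟩
      have hle := prod_sub_le (R := R) (T := U) (L := L) (l := (L ^ N)⁻¹)
        (fun x hx => Finset.mem_filter.2 ⟨hTS (hUT x hx).1, (hUT x hx).2⟩) hL1.le
        (by positivity)
        (fun x hx y hy => by
          have h1 := (hS x (Finset.mem_filter.1 hx).1).2
          have h2 := (hS y (Finset.mem_filter.1 hy).1).2
          calc |x - y| ≤ |x| + |y| := abs_sub _ _
            _ ≤ L := by linarith)
        (fun x hx y hy => hT x (hUT x hx).1 y (hUT y hy).1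
          ((hUT x hx).2.trans (hUT y hy).2.symm))
      have hfinal := hge.trans hle
      by_contra! hcon
      set p := R.card
      set u := U.card
      have hpD : (2 / ρ) < p := by
        refine (Nat.le_ceil _).trans_lt ?_
        rw [hRdeg]; exact_mod_cast not_le.1 hdeg
      have hexp : N * (u * (u - 1)) ≤ p * p := by
        rw [inv_pow, ← pow_mul, inv_mul_eq_div, one_le_div (by positivity)] at hfinal
        exact (pow_le_pow_iff_right₀ hL1).1 hfinal
      have hp2 : 2 < ρ * p := by rw [div_lt_iff₀ hρ] at hpD; linarith
      have hu2 : (2:ℝ) < u := hp2.trans hcon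
      have hu : 1 ≤ u := by
        have : (2:ℕ) < u := by exact_mod_cast hu2
        omega
      have hexp' : (N : ℝ) * (u * (u - 1)) ≤ p * p := by
        have : ((N * (u * (u - 1)) : ℕ) : ℝ) ≤ ((p * p : ℕ) : ℝ) := by exact_mod_cast hexp
        push_cast [Nat.cast_sub hu] at this
        exact this
      have hNr : 4 / ρ ^ 2 < N := by
        rw [hN]; push_cast; linarith [Nat.le_ceil (4 / ρ ^ 2)]
      rw [div_lt_iff₀ (by positivity)] at hNr
      have hpp : (0:ℝ) < p := by
        by_contra! h
        nlinarith
      have k1 : (ρ * p) * (ρ * p) / 2 ≤ (u : ℝ) * (u - 1) := by nlinarith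
      have k2 : (N : ℝ) * ((ρ * p) * (ρ * p) / 2) ≤ p * p :=
        (mul_le_mul_of_nonneg_left k1 (by positivity)).trans hexp'
      nlinarith [mul_pos hpp hpp]
    calc (T2.card : ℝ) = ∑ q ∈ Q, ((T2.filter (fun x => minpoly ℤ x = q)).card : ℝ) := by
          rw [e1]; push_cast; rfl
      _ ≤ ∑ q ∈ Q, ρ * (S.filter (fun x => minpoly ℤ x = q)).card := Finset.sum_le_sum e3
      _ = ρ * (∑ q ∈ Q, (S.filter (fun x => minpoly ℤ x = q)).card : ℕ) := by
          rw [← Finset.mul_sum]; push_cast; rfl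
      _ ≤ ρ * S.card := by gcongr
  have : (T.card : ℝ) = T1.card + T2.card := by exact_mod_cast hcard.symm
  have h1' : (T1.card : ℝ) ≤ hfin.toFinset.card := by exact_mod_cast h1
  linarith

end Principle

section Tridiagonal

section Symmetric

variable {n : Type*} [Fintype n] [DecidableEq n] {A : Matrix n n ℝ}

theorem sum_sq_eigenvector_dotProduct (hA : A.IsHermitian) (x : n → ℝ) :
    ∑ j, ((hA.eigenvectorBasis j).ofLp ⬝ᵥ x) ^ 2 = ∑ i, x i ^ 2 := by
  have h := hA.eigenvectorBasis.sum_sq_norm_inner_right (WithLp.toLp 2 x)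
  rw [EuclideanSpace.real_norm_sq_eq] at h
  rw [← h]
  refine Finset.sum_congr rfl fun j _ => ?_
  rw [EuclideanSpace.inner_eq_star_dotProduct, Real.norm_eq_abs, sq_abs, star_trivial,
    dotProduct_comm]

theorem eigenvector_dotProduct_mulVec (hA : A.IsHermitian) (j : n) (x : n → ℝ) :
    (hA.eigenvectorBasis j).ofLp ⬝ᵥ (A *ᵥ x) =
      hA.eigenvalues j * ((hA.eigenvectorBasis j).ofLp ⬝ᵥ x) := by
  have hT : Aᵀ = A := by simpa [Matrix.IsHermitian, conjTranspose_eq_transpose_of_trivial] using hA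
  rw [dotProduct_mulVec, ← mulVec_transpose, hT, hA.mulVec_eigenvectorBasis, smul_dotProduct,
    smul_eq_mul]

theorem le_card_eigenvalues_near (hA : A.IsHermitian) {θ ε : ℝ} (hε : 0 ≤ ε) {ι : Type*}
    [Fintype ι] (W : (ι → ℝ) →ₗ[ℝ] (n → ℝ)) (hinj : ∀ y, W y = 0 → y = 0)
    (h : ∀ y, ∑ i, ((A *ᵥ W y) i - θ * W y i) ^ 2 ≤ ε ^ 2 * ∑ i, W y i ^ 2) :
    Fintype.card ι ≤ (Finset.univ.filter fun j => |hA.eigenvalues j - θ| ≤ ε).card := by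
  classical
  by_contra! hlt
  set I := Finset.univ.filter fun j => |hA.eigenvalues j - θ| ≤ ε
  let e : n → n → ℝ := fun j => (hA.eigenvectorBasis j).ofLp
  let F : (ι → ℝ) →ₗ[ℝ] (I → ℝ) :=
    LinearMap.pi fun j => (dotProductBilin ℝ ℝ (e j)).comp W
  have hker := LinearMap.ker_ne_bot_of_finrank_lt (f := F) (by simpa using hlt)
  obtain ⟨y, hy, hy0⟩ := (Submodule.ne_bot_iff _).1 hker
  have hyI : ∀ j ∈ I, e j ⬝ᵥ W y = 0 := fun j hj => by
    have := congrFun (LinearMap.mem_ker.1 hy) ⟨j, hj⟩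
    simpa [F] using this
  have hW : W y ≠ 0 := fun h0 => hy0 (hinj y h0)
  have h1 := h y
  rw [← sum_sq_eigenvector_dotProduct hA (W y)] at h1
  have h2 : ∑ i, ((A *ᵥ W y) i - θ * W y i) ^ 2 =
      ∑ j, ((hA.eigenvalues j - θ) * (e j ⬝ᵥ W y)) ^ 2 := by
    have := sum_sq_eigenvector_dotProduct hA (A *ᵥ W y - θ • W y)
    simp only [Pi.sub_apply, Pi.smul_apply, smul_eq_mul] at this
    rw [← this]
    refine Finset.sum_congr rfl fun j _ => ?_
    rw [dotProduct_sub, eigenvector_dotProduct_mulVec, dotProduct_smul, smul_eq_mul]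
    ring
  rw [h2, Finset.mul_sum] at h1
  obtain ⟨j, hj⟩ : ∃ j, e j ⬝ᵥ W y ≠ 0 := by
    by_contra! hall
    apply hW
    have := sum_sq_eigenvector_dotProduct hA (W y)
    rw [Finset.sum_eq_zero (fun j _ => by rw [hall j]; simp)] at this
    funext i
    have h3 := (Finset.sum_eq_zero_iff_of_nonneg (fun i _ => sq_nonneg (W y i))).1 this.symm i
      (Finset.mem_univ _)
    exact pow_eq_zero_iff (two_ne_zero) |>.1 h3
  have key : ∀ j, e j ⬝ᵥ W y ≠ 0 → ε ^ 2 < (hA.eigenvalues j - θ) ^ 2 := fun j hj => by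
    have : ¬ |hA.eigenvalues j - θ| ≤ ε := fun hle =>
      hj (hyI j (Finset.mem_filter.2 ⟨Finset.mem_univ _, hle⟩))
    rw [← sq_abs (hA.eigenvalues j - θ)]
    exact pow_lt_pow_left₀ (not_le.1 this) hε two_ne_zero
  refine absurd h1 (not_le.2 (Finset.sum_lt_sum (fun i _ => ?_) ⟨j, Finset.mem_univ _, ?_⟩))
  · rw [mul_pow]
    by_cases h0 : e i ⬝ᵥ W y = 0
    · change ε ^ 2 * (e i ⬝ᵥ W y) ^ 2 ≤ _
      simp [h0]
    · exact mul_le_mul_of_nonneg_right (key i h0).le (sq_nonneg _)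
  · rw [mul_pow]
    exact mul_lt_mul_of_pos_right (key j hj) (by positivity)

end Symmetric

/-- The solution of the three-term recurrence with diagonal `α` and couplings `γ`,
where `γ i` couples the positions `i - 1` and `i`. -/
noncomputable def triSeq (α γ : ℕ → ℝ) (θ : ℝ) : ℕ → ℝ
  | 0 => 1
  | 1 => (θ - α 0) / γ 1
  | (i + 2) => ((θ - α (i + 1)) * triSeq α γ θ (i + 1) - γ (i + 1) * triSeq α γ θ i) / γ (i + 2)

/-- The eigenvalue equation of a tridiagonal matrix of size `d + 1`. -/
def TriEig (α γ : ℕ → ℝ) (d : ℕ) (θ : ℝ) (w : ℕ → ℝ) : Prop :=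
  ∀ i ≤ d, γ (i + 1) * w (i + 1) = (θ - α i) * w i - γ i * w (i - 1)

/-- The set of eigenvalues of the tridiagonal matrix, as the zeros of the boundary condition. -/
def triSpec (α γ : ℕ → ℝ) (d : ℕ) : Set ℝ :=
  {θ | (θ - α d) * triSeq α γ θ d = γ d * triSeq α γ θ (d - 1)}

/-- The couplings `γ` of a tridiagonal matrix of size `d + 1`. -/
structure Coupling (γ : ℕ → ℝ) (d : ℕ) : Prop where
  zero : γ 0 = 0
  last : γ (d + 1) = 0
  pos : ∀ i, 1 ≤ i → i ≤ d → 0 < γ i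

variable {α γ : ℕ → ℝ} {d : ℕ}

theorem triSeq_rec (hγ : Coupling γ d) (θ : ℝ) {i : ℕ} (hi : i < d) :
    γ (i + 1) * triSeq α γ θ (i + 1) =
      (θ - α i) * triSeq α γ θ i - γ i * triSeq α γ θ (i - 1) := by
  have := (hγ.pos (i + 1) (by omega) (by omega)).ne'
  cases i with
  | zero => simp [triSeq, hγ.zero]; field_simp
  | succ i => simp only [triSeq, Nat.add_sub_cancel]; field_simp

theorem triEig_triSeq (hγ : Coupling γ d) {θ : ℝ} (h : θ ∈ triSpec α γ d) :
    TriEig α γ d θ (triSeq α γ θ) := by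
  intro i hi
  rcases hi.lt_or_eq with hi | rfl
  · exact triSeq_rec hγ θ hi
  · rw [hγ.last, zero_mul]
    have : (θ - α i) * triSeq α γ θ i = γ i * triSeq α γ θ (i - 1) := h
    linarith

theorem TriEig.eq_mul_triSeq (hγ : Coupling γ d) {θ : ℝ} {w : ℕ → ℝ} (hw : TriEig α γ d θ w) :
    ∀ i ≤ d, w i = w 0 * triSeq α γ θ i := by
  intro i
  induction i using Nat.strong_induction_on with
  | _ i ih =>
    intro hi
    cases i with
    | zero => simp [triSeq]
    | succ i =>
      have h1 := hw i (by omega)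
      have h2 := triSeq_rec (α := α) hγ θ (i := i) (by omega)
      rw [ih i (by omega) (by omega), ih (i - 1) (by omega) (by omega)] at h1
      have h3 := hγ.pos (i + 1) (by omega) hi
      refine mul_left_cancel₀ h3.ne' ?_
      linear_combination h1 - w 0 * h2

theorem TriEig.mem_triSpec (hγ : Coupling γ d) {θ : ℝ} {w : ℕ → ℝ} (hw : TriEig α γ d θ w)
    (h0 : w 0 ≠ 0) : θ ∈ triSpec α γ d := by
  have h1 := hw d le_rfl
  rw [hγ.last, zero_mul, hw.eq_mul_triSeq hγ d le_rfl,
    hw.eq_mul_triSeq hγ (d - 1) (by omega)] at h1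
  refine mul_left_cancel₀ h0 ?_
  linarith

/-- The symmetric tridiagonal matrix. -/
def triMat (α γ : ℕ → ℝ) (d : ℕ) : Matrix (Fin (d + 1)) (Fin (d + 1)) ℝ :=
  Matrix.of fun i j => (if (j : ℕ) = i then α i else 0) +
    (if (j : ℕ) + 1 = i then γ i else 0) + (if (j : ℕ) = i + 1 then γ j else 0)

theorem triMat_isHermitian : (triMat α γ d).IsHermitian := by
  ext i j
  simp only [triMat, conjTranspose_apply, of_apply, star_trivial]
  have e1 : (if (i : ℕ) = j then α j else 0) = if (j : ℕ) = i then α i else 0 := by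
    by_cases h : (i : ℕ) = j
    · rw [if_pos h, if_pos h.symm, h]
    · rw [if_neg h, if_neg (Ne.symm h)]
  have e2 : (if (i : ℕ) + 1 = j then γ j else 0) = if (j : ℕ) = i + 1 then γ j else 0 := by
    simp only [eq_comm]
  have e3 : (if (i : ℕ) = j + 1 then γ i else 0) = if (j : ℕ) + 1 = i then γ i else 0 := by
    simp only [eq_comm]
  rw [e1, e2, e3]; ring

theorem triMat_mulVec (hγ : Coupling γ d) (w : ℕ → ℝ) (i : Fin (d + 1)) :
    (triMat α γ d *ᵥ fun j => w j) i =
      α i * w i + γ i * w ((i : ℕ) - 1) + γ (i + 1) * w (i + 1) := by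
  have hi := i.2
  simp only [triMat, mulVec, dotProduct, of_apply, add_mul, Finset.sum_add_distrib, ite_mul,
    zero_mul]
  congr 1
  · congr 1
    · rw [Fin.sum_univ_eq_sum_range (fun j => if j = (i : ℕ) then α i * w j else 0)]
      rw [Finset.sum_ite_eq', if_pos (Finset.mem_range.2 hi)]
    · rw [Fin.sum_univ_eq_sum_range (fun j => if j + 1 = (i : ℕ) then γ i * w j else 0)]
      rcases Nat.eq_zero_or_pos (i : ℕ) with h | h
      · rw [h, hγ.zero]; simp
      · have : ∀ j, (j + 1 = (i : ℕ)) = (j = (i : ℕ) - 1) := fun j => by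
          apply propext; omega
        simp only [this]
        rw [Finset.sum_ite_eq', if_pos (Finset.mem_range.2 (by omega))]
  · rw [Fin.sum_univ_eq_sum_range (fun j => if j = (i : ℕ) + 1 then γ j * w j else 0)]
    rw [Finset.sum_ite_eq']
    split_ifs with h
    · rfl
    · have : (i : ℕ) = d := by rw [Finset.mem_range] at h; omega
      rw [this, hγ.last, zero_mul]

/-- Extension by zero of a vector to a sequence. -/
def extendZero (x : Fin (d + 1) → ℝ) (i : ℕ) : ℝ := if h : i < d + 1 then x ⟨i, h⟩ else 0

theorem extendZero_coe (x : Fin (d + 1) → ℝ) (i : Fin (d + 1)) : extendZero x i = x i := by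
  rw [extendZero, dif_pos i.2]

theorem triEig_of_mulVec (hγ : Coupling γ d) {θ : ℝ} {x : Fin (d + 1) → ℝ}
    (h : triMat α γ d *ᵥ x = θ • x) : TriEig α γ d θ (extendZero x) := by
  intro i hi
  have h1 := triMat_mulVec (α := α) hγ (extendZero x) ⟨i, by omega⟩
  have h2 : (fun j : Fin (d + 1) => extendZero x j) = x := funext (extendZero_coe x)
  rw [h2, h] at h1
  have h3 := extendZero_coe x ⟨i, by omega⟩
  simp only [Pi.smul_apply, smul_eq_mul] at h1 h3
  rw [← h3] at h1
  linarith

theorem eigenvalues_mem_triSpec (hγ : Coupling γ d) (j : Fin (d + 1)) :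
    (triMat_isHermitian (α := α) (γ := γ) (d := d)).eigenvalues j ∈ triSpec α γ d ∧
      extendZero ((triMat_isHermitian (α := α) (γ := γ) (d := d)).eigenvectorBasis j).ofLp 0 ≠ 0 := by
  set hA := triMat_isHermitian (α := α) (γ := γ) (d := d)
  have h1 := triEig_of_mulVec hγ (hA.mulVec_eigenvectorBasis j)
  have h0 : extendZero (hA.eigenvectorBasis j).ofLp 0 ≠ 0 := by
    intro h0
    have h2 : (hA.eigenvectorBasis j) = 0 := by
      ext i
      rw [← extendZero_coe (hA.eigenvectorBasis j).ofLp i, h1.eq_mul_triSeq hγ i (by omega), h0]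
      simp
    exact hA.eigenvectorBasis.orthonormal.ne_zero j h2
  exact ⟨h1.mem_triSpec hγ h0, h0⟩

theorem eigenvalues_triMat_injective (hγ : Coupling γ d) :
    Function.Injective (triMat_isHermitian (α := α) (γ := γ) (d := d)).eigenvalues := by
  intro i j hij
  by_contra hne
  set hA := triMat_isHermitian (α := α) (γ := γ) (d := d)
  have hi := triEig_of_mulVec hγ (hA.mulVec_eigenvectorBasis i)
  have hj := triEig_of_mulVec hγ (hA.mulVec_eigenvectorBasis j)
  have hi0 := (eigenvalues_mem_triSpec (α := α) hγ i).2
  have hj0 := (eigenvalues_mem_triSpec (α := α) hγ j).2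
  rw [← hij] at hj
  set ci := extendZero (hA.eigenvectorBasis i).ofLp 0
  set cj := extendZero (hA.eigenvectorBasis j).ofLp 0
  have h1 : (cj / ci) • (hA.eigenvectorBasis i) = hA.eigenvectorBasis j := by
    ext l
    rw [← extendZero_coe (hA.eigenvectorBasis j).ofLp l, hj.eq_mul_triSeq hγ l (by omega)]
    rw [PiLp.smul_apply, ← extendZero_coe (hA.eigenvectorBasis i).ofLp l,
      hi.eq_mul_triSeq hγ l (by omega), smul_eq_mul]
    change cj / ci * (ci * _) = cj * _
    field_simp
  have h2 : inner ℝ (hA.eigenvectorBasis i) (hA.eigenvectorBasis j) = 0 :=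
    hA.eigenvectorBasis.orthonormal.2 hne
  rw [← h1, inner_smul_right, real_inner_self_eq_norm_sq,
    hA.eigenvectorBasis.orthonormal.1 i] at h2
  have : cj / ci ≠ 0 := div_ne_zero hj0 hi0
  simp [this] at h2

theorem triSpec_subset_range (hγ : Coupling γ d) {θ : ℝ} (h : θ ∈ triSpec α γ d) :
    ∃ j, (triMat_isHermitian (α := α) (γ := γ) (d := d)).eigenvalues j = θ := by
  set hA := triMat_isHermitian (α := α) (γ := γ) (d := d)
  set x : Fin (d + 1) → ℝ := fun j => triSeq α γ θ j with hx
  have h1 : triMat α γ d *ᵥ x = θ • x := by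
    funext i
    rw [hx, triMat_mulVec hγ]
    have := triEig_triSeq hγ h i (by omega)
    simp only [Pi.smul_apply, smul_eq_mul]
    linarith
  by_contra! hne
  have h2 : ∀ j, (hA.eigenvectorBasis j).ofLp ⬝ᵥ x = 0 := by
    intro j
    have := eigenvector_dotProduct_mulVec hA j x
    rw [h1, dotProduct_smul, smul_eq_mul] at this
    have h3 : (hA.eigenvalues j - θ) * ((hA.eigenvectorBasis j).ofLp ⬝ᵥ x) = 0 := by linarith
    exact (mul_eq_zero.1 h3).resolve_left (sub_ne_zero.2 (hne j))
  have h3 := sum_sq_eigenvector_dotProduct hA x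
  rw [Finset.sum_eq_zero (fun j _ => by rw [h2 j]; simp)] at h3
  have h4 := (Finset.sum_eq_zero_iff_of_nonneg (fun i _ => sq_nonneg (x i))).1 h3.symm 0
      (Finset.mem_univ _)
  simp [hx, triSeq] at h4

/-- The eigenvalues of the tridiagonal matrix, as a finite set. -/
noncomputable def triSpecF (α γ : ℕ → ℝ) (d : ℕ) : Finset ℝ :=
  Finset.univ.image (triMat_isHermitian (α := α) (γ := γ) (d := d)).eigenvalues

theorem mem_triSpecF (hγ : Coupling γ d) {θ : ℝ} : θ ∈ triSpecF α γ d ↔ θ ∈ triSpec α γ d := by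
  refine ⟨fun h => ?_, fun h => ?_⟩
  · obtain ⟨j, _, rfl⟩ := Finset.mem_image.1 h
    exact (eigenvalues_mem_triSpec hγ j).1
  · obtain ⟨j, rfl⟩ := triSpec_subset_range hγ h
    exact Finset.mem_image_of_mem _ (Finset.mem_univ _)

theorem card_triSpecF (hγ : Coupling γ d) : (triSpecF α γ d).card = d + 1 := by
  rw [triSpecF, Finset.card_image_of_injective _ (eigenvalues_triMat_injective hγ)]
  simp

/-- The residual `(J - θ) w` of a sequence. -/
def triRes (α γ : ℕ → ℝ) (θ : ℝ) (w : ℕ → ℝ) (i : ℕ) : ℝ :=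
  (α i - θ) * w i + γ i * w (i - 1) + γ (i + 1) * w (i + 1)

theorem le_card_triSpecF_near (hγ : Coupling γ d) {θ ε : ℝ} (hε : 0 ≤ ε) {ι : Type*} [Fintype ι]
    (W : ι → ℕ → ℝ)
    (hinj : ∀ y : ι → ℝ, (∀ i ≤ d, ∑ s, y s * W s i = 0) → y = 0)
    (h : ∀ y : ι → ℝ,
      ∑ i ∈ Finset.range (d + 1), triRes α γ θ (fun i => ∑ s, y s * W s i) i ^ 2 ≤
        ε ^ 2 * ∑ i ∈ Finset.range (d + 1), (∑ s, y s * W s i) ^ 2) :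
    Fintype.card ι ≤ ((triSpecF α γ d).filter fun t => |t - θ| ≤ ε).card := by
  classical
  let Wl : (ι → ℝ) →ₗ[ℝ] (Fin (d + 1) → ℝ) :=
    { toFun := fun y i => ∑ s, y s * W s i
      map_add' := fun x y => by funext i; simp [add_mul, Finset.sum_add_distrib]
      map_smul' := fun c x => by funext i; simp [Finset.mul_sum, mul_assoc] }
  have h1 := le_card_eigenvalues_near (triMat_isHermitian (α := α) (γ := γ) (d := d))
    (θ := θ) hε Wl (fun y hy => hinj y fun i hi => congrFun hy ⟨i, by omega⟩) (fun y => by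
      have e1 : ∀ i : Fin (d + 1), (triMat α γ d *ᵥ Wl y) i - θ * Wl y i =
          triRes α γ θ (fun i => ∑ s, y s * W s i) i := fun i => by
        have := triMat_mulVec (α := α) hγ (fun i => ∑ s, y s * W s i) i
        change (triMat α γ d *ᵥ fun j : Fin (d + 1) => ∑ s, y s * W s j) i -
          θ * ∑ s, y s * W s i = _
        rw [this, triRes]; ring
      simp only [e1]
      rw [Fin.sum_univ_eq_sum_range
        (fun i => triRes α γ θ (fun i => ∑ s, y s * W s i) i ^ 2)]
      refine (h y).trans (le_of_eq ?_)
      rw [← Fin.sum_univ_eq_sum_range (fun i => (∑ s, y s * W s i) ^ 2)]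
      rfl)
  refine h1.trans (le_of_eq ?_)
  rw [triSpecF, Finset.filter_image, Finset.card_image_of_injective _
    (eigenvalues_triMat_injective hγ)]

end Tridiagonal

section TridiagonalCounting

variable {α γ : ℕ → ℝ} {d : ℕ}

theorem triRes_sum {ι : Type*} [Fintype ι] (θ : ℝ) (W : ι → ℕ → ℝ) (y : ι → ℝ) (i : ℕ) :
    triRes α γ θ (fun i => ∑ s, y s * W s i) i = ∑ s, y s * triRes α γ θ (W s) i := by
  simp only [triRes, Finset.mul_sum, ← Finset.sum_add_distrib]
  exact Finset.sum_congr rfl fun s _ => by ring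

theorem sq_sum_of_disjoint {ι : Type*} [Fintype ι] (f : ι → ℝ)
    (h : ∀ s s', s ≠ s' → f s * f s' = 0) : (∑ s, f s) ^ 2 = ∑ s, f s ^ 2 := by
  classical
  rw [sq, Finset.sum_mul_sum]
  refine Finset.sum_congr rfl fun s _ => ?_
  rw [Finset.sum_eq_single s (fun s' _ hs => h s s' hs.symm) (by simp), sq]

theorem le_card_triSpecF_near_of_disjoint (hγ : Coupling γ d) {θ ε : ℝ} (hε : 0 ≤ ε)
    {ι : Type*} [Fintype ι] (W : ι → ℕ → ℝ)
    (hW : ∀ s s', s ≠ s' → ∀ i ≤ d, W s i * W s' i = 0)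
    (hR : ∀ s s', s ≠ s' → ∀ i ≤ d, triRes α γ θ (W s) i * triRes α γ θ (W s') i = 0)
    (hpos : ∀ s, 0 < ∑ i ∈ Finset.range (d + 1), W s i ^ 2)
    (hres : ∀ s, ∑ i ∈ Finset.range (d + 1), triRes α γ θ (W s) i ^ 2 ≤
      ε ^ 2 * ∑ i ∈ Finset.range (d + 1), W s i ^ 2) :
    Fintype.card ι ≤ ((triSpecF α γ d).filter fun t => |t - θ| ≤ ε).card := by
  have e1 : ∀ y : ι → ℝ, ∑ i ∈ Finset.range (d + 1), (∑ s, y s * W s i) ^ 2 =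
      ∑ s, y s ^ 2 * ∑ i ∈ Finset.range (d + 1), W s i ^ 2 := fun y => by
    simp only [Finset.mul_sum]
    rw [Finset.sum_comm]
    refine Finset.sum_congr rfl fun i hi => ?_
    rw [sq_sum_of_disjoint]
    · simp only [mul_pow]
    · intro s s' hs
      linear_combination y s * y s' * hW s s' hs i (by rw [Finset.mem_range] at hi; omega)
  have e2 : ∀ y : ι → ℝ, ∑ i ∈ Finset.range (d + 1),
      triRes α γ θ (fun i => ∑ s, y s * W s i) i ^ 2 =
      ∑ s, y s ^ 2 * ∑ i ∈ Finset.range (d + 1), triRes α γ θ (W s) i ^ 2 := fun y => by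
    simp only [Finset.mul_sum]
    rw [Finset.sum_comm]
    refine Finset.sum_congr rfl fun i hi => ?_
    rw [triRes_sum, sq_sum_of_disjoint]
    · simp only [mul_pow]
    · intro s s' hs
      linear_combination y s * y s' * hR s s' hs i (by rw [Finset.mem_range] at hi; omega)
  refine le_card_triSpecF_near hγ hε W (fun y hy => ?_) (fun y => ?_)
  · have := e1 y
    rw [Finset.sum_eq_zero (fun i hi => by
      rw [hy i (by rw [Finset.mem_range] at hi; omega)]; simp)] at this
    have h2 := (Finset.sum_eq_zero_iff_of_nonneg
      (fun s _ => mul_nonneg (sq_nonneg (y s)) (hpos s).le)).1 this.symm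
    funext s
    have h3 := (mul_eq_zero.1 (h2 s (Finset.mem_univ _))).resolve_right (hpos s).ne'
    simpa using h3
  · rw [e1, e2, Finset.mul_sum]
    refine Finset.sum_le_sum fun s _ => ?_
    have := mul_le_mul_of_nonneg_left (hres s) (sq_nonneg (y s))
    linarith

theorem card_le_card_triSpecF_band (hγ : Coupling γ d) {a β : ℝ} (hβ : 0 ≤ β) (G : Finset ℕ)
    (hG : ∀ i ∈ G, 1 ≤ i ∧ i < d ∧ α i = a ∧ γ i = β ∧ γ (i + 1) = β) :
    G.card ≤ ((triSpecF α γ d).filter fun t => |t - a| ≤ 2 * β).card := by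
  classical
  have hsum : ∀ (y : G → ℝ) (i : ℕ), ∑ s : G, y s * (if i = s then 1 else 0) =
      if h : i ∈ G then y ⟨i, h⟩ else 0 := by
    intro y i
    split_ifs with h
    · rw [Finset.sum_eq_single ⟨i, h⟩]
      · simp
      · intro s _ hs
        rw [if_neg, mul_zero]
        rintro rfl; exact hs rfl
      · simp
    · refine Finset.sum_eq_zero fun s _ => ?_
      rw [if_neg, mul_zero]
      rintro rfl; exact h s.2
  have := le_card_triSpecF_near (α := α) hγ (θ := a) (ε := 2 * β) (by positivity) (ι := G)
    (fun s i => if i = s then 1 else 0) (fun y hy => ?_) (fun y => ?_)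
  · simpa using this
  · funext s
    have h1 := hy s (hG s s.2).2.1.le
    rw [hsum, dif_pos s.2] at h1
    exact h1
  · simp only [hsum]
    set w : ℕ → ℝ := fun i => if h : i ∈ G then y ⟨i, h⟩ else 0 with hw
    have hw0 : ∀ i, i ∉ G → w i = 0 := fun i hi => dif_neg hi
    have hz : w 0 = 0 := hw0 0 fun h => by have := (hG 0 h).1; omega
    have hd1 : w (d + 1) = 0 := hw0 _ fun h => by have := (hG _ h).2.1; omega
    have hres : ∀ i, triRes α γ a w i = β * (w (i - 1) + w (i + 1)) := by
      intro i
      have k1 : (α i - a) * w i = 0 := by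
        by_cases h : i ∈ G
        · rw [(hG i h).2.2.1]; ring
        · rw [hw0 i h]; ring
      have k2 : γ i * w (i - 1) = β * w (i - 1) := by
        by_cases h : i - 1 ∈ G
        · have h1 := hG _ h
          rcases Nat.eq_zero_or_pos i with rfl | hi
          · simp [hz]
          · rw [Nat.sub_add_cancel hi] at h1
            rw [h1.2.2.2.2]
        · rw [hw0 _ h]; ring
      have k3 : γ (i + 1) * w (i + 1) = β * w (i + 1) := by
        by_cases h : i + 1 ∈ G
        · rw [(hG _ h).2.2.2.1]
        · rw [hw0 _ h]; ring
      rw [triRes, k1, k2, k3]; ring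
    have s1 : ∑ i ∈ Finset.range (d + 1), w (i - 1) ^ 2 ≤ ∑ i ∈ Finset.range (d + 1), w i ^ 2 := by
      rw [Finset.sum_range_succ', Finset.sum_range_succ (fun i => w i ^ 2)]
      simp only [Nat.add_sub_cancel, Nat.zero_sub, hz]
      have := sq_nonneg (w d)
      linarith
    have s2 : ∑ i ∈ Finset.range (d + 1), w (i + 1) ^ 2 ≤ ∑ i ∈ Finset.range (d + 1), w i ^ 2 := by
      rw [Finset.sum_range_succ, Finset.sum_range_succ' (fun i => w i ^ 2)]
      simp only [hd1, hz]
      linarith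
    calc ∑ i ∈ Finset.range (d + 1), triRes α γ a w i ^ 2
        ≤ ∑ i ∈ Finset.range (d + 1), (2 * β ^ 2 * w (i - 1) ^ 2 + 2 * β ^ 2 * w (i + 1) ^ 2) := by
          refine Finset.sum_le_sum fun i _ => ?_
          rw [hres]
          nlinarith [sq_nonneg (β * (w (i - 1) - w (i + 1)))]
      _ = 2 * β ^ 2 * ∑ i ∈ Finset.range (d + 1), w (i - 1) ^ 2 +
          2 * β ^ 2 * ∑ i ∈ Finset.range (d + 1), w (i + 1) ^ 2 := by
          rw [Finset.sum_add_distrib, Finset.mul_sum, Finset.mul_sum]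
      _ ≤ 2 * β ^ 2 * ∑ i ∈ Finset.range (d + 1), w i ^ 2 +
          2 * β ^ 2 * ∑ i ∈ Finset.range (d + 1), w i ^ 2 := by gcongr
      _ = _ := by ring

theorem sin_sq_add_sin_sq_ge (x φ : ℝ) :
    1 - |Real.cos φ| ≤ Real.sin x ^ 2 + Real.sin (x + φ) ^ 2 := by
  have h1 : Real.sin x ^ 2 = (1 - Real.cos (2 * x)) / 2 := by rw [Real.cos_two_mul']; nlinarith [Real.sin_sq_add_cos_sq x]
  have h2 : Real.sin (x + φ) ^ 2 = (1 - Real.cos (2 * (x + φ))) / 2 := by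
    rw [Real.cos_two_mul']; nlinarith [Real.sin_sq_add_cos_sq (x + φ)]
  have h3 : Real.cos (2 * x) + Real.cos (2 * (x + φ)) =
      2 * Real.cos (2 * x + φ) * Real.cos φ := by
    rw [Real.cos_add_cos, ← Real.cos_neg φ]; congr 2 <;> ring_nf
  have h4 : |Real.cos (2 * x + φ) * Real.cos φ| ≤ |Real.cos φ| := by
    rw [abs_mul]
    exact mul_le_of_le_one_left (abs_nonneg _) (Real.abs_cos_le_one _)
  have := (abs_le.1 h4).2
  rw [h1, h2]; linarith

theorem sum_sin_sq_ge (φ : ℝ) (m : ℕ) :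
    m * (1 - |Real.cos φ|) ≤ ∑ t ∈ Finset.range (2 * m), Real.sin ((t + 1) * φ) ^ 2 := by
  induction m with
  | zero => simp
  | succ m ih =>
    rw [show 2 * (m + 1) = 2 * m + 1 + 1 by ring, Finset.sum_range_succ, Finset.sum_range_succ]
    have := sin_sq_add_sin_sq_ge ((((2 * m : ℕ) : ℝ) + 1) * φ) φ
    push_cast at this ih ⊢
    have e : (2 * (m : ℝ) + 1) * φ + φ = (2 * m + 1 + 1) * φ := by ring
    rw [e] at this
    linarith

/-- A block of a sine wave supported on `[p, p + n)`. -/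
noncomputable def sineBlock (φ : ℝ) (p n : ℕ) (i : ℕ) : ℝ :=
  if p ≤ i ∧ i < p + n then Real.sin (((i - p : ℕ) + 1 : ℝ) * φ) else 0

theorem sineBlock_sum (φ : ℝ) {p n : ℕ} (h : p + n ≤ d + 1) :
    ∑ i ∈ Finset.range (d + 1), sineBlock φ p n i ^ 2 =
      ∑ t ∈ Finset.range n, Real.sin ((t + 1) * φ) ^ 2 := by
  have : ∑ i ∈ Finset.Ico p (p + n), sineBlock φ p n i ^ 2 =
      ∑ i ∈ Finset.range (d + 1), sineBlock φ p n i ^ 2 := by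
    refine Finset.sum_subset (fun i hi => ?_) (fun i _ hi => ?_)
    · rw [Finset.mem_Ico] at hi; rw [Finset.mem_range]; omega
    · rw [Finset.mem_Ico] at hi; rw [sineBlock, if_neg hi]; simp
  rw [← this, Finset.sum_Ico_eq_sum_range, Nat.add_sub_cancel_left]
  refine Finset.sum_congr rfl fun t ht => ?_
  rw [Finset.mem_range] at ht
  rw [sineBlock, if_pos (by omega), Nat.add_sub_cancel_left]

theorem triRes_sineBlock {a β φ : ℝ} {l L p n : ℕ} (hα : ∀ i, l ≤ i → i < l + L → α i = a)
    (hγr : ∀ i, l < i → i < l + L → γ i = β) (hp : l + 1 ≤ p) (hn : 1 ≤ n) (hpn : p + n < l + L)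
    (i : ℕ) : (triRes α γ (a + 2 * β * Real.cos φ) (sineBlock φ p n) i) ^ 2 ≤
      if i = p - 1 ∨ i = p + n - 1 ∨ i = p + n then β ^ 2 else 0 := by
  have hsq : ∀ x, (β * Real.sin x) ^ 2 ≤ β ^ 2 := fun x => by
    rw [mul_pow]
    exact mul_le_of_le_one_right (sq_nonneg _) (Real.sin_sq_le_one x)
  have out : ∀ i, ¬ (p ≤ i ∧ i < p + n) → sineBlock φ p n i = 0 := fun i hi => if_neg hi
  have inn : ∀ t, t < n → sineBlock φ p n (p + t) = Real.sin ((t + 1) * φ) := fun t ht => by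
    rw [sineBlock, if_pos (by omega), Nat.add_sub_cancel_left]
  by_cases h1 : i < p
  · rw [triRes, out i (by omega), out (i - 1) (by omega)]
    by_cases h2 : i = p - 1
    · rw [if_pos (by tauto), show i + 1 = p + 0 by omega, inn 0 (by omega),
        hγr (p + 0) (by omega) (by omega)]
      refine le_trans (le_of_eq ?_) (hsq ((((0 : ℕ) : ℝ) + 1) * φ))
      ring
    · rw [out (i + 1) (by omega), if_neg (by omega)]; simp
  by_cases h2 : p + n ≤ i
  · rw [triRes, out i (by omega), out (i + 1) (by omega)]
    by_cases h3 : i = p + n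
    · rw [if_pos (by tauto), show i - 1 = p + (n - 1) by omega, inn (n - 1) (by omega),
        hγr i (by omega) (by omega)]
      refine le_trans (le_of_eq ?_) (hsq ((((n - 1 : ℕ) : ℝ) + 1) * φ))
      ring
    · rw [out (i - 1) (by omega), if_neg (by omega)]; simp
  obtain ⟨t, rfl⟩ : ∃ t, i = p + t := ⟨i - p, by omega⟩
  have ht : t < n := by omega
  have e1 : sineBlock φ p n (p + t - 1) = Real.sin (t * φ) := by
    rcases Nat.eq_zero_or_pos t with rfl | h
    · rw [out _ (by omega)]; simp
    · rw [show p + t - 1 = p + (t - 1) by omega, inn (t - 1) (by omega)]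
      push_cast [Nat.cast_sub h]; ring_nf
  have e2 : Real.sin (t * φ) + Real.sin ((t + 2) * φ) =
      2 * Real.cos φ * Real.sin ((t + 1) * φ) := by
    rw [show (t : ℝ) * φ = (t + 1) * φ - φ by ring,
      show ((t : ℝ) + 2) * φ = (t + 1) * φ + φ by ring, Real.sin_sub, Real.sin_add]; ring
  rw [triRes, inn t ht, e1, hα _ (by omega) (by omega), hγr _ (by omega) (by omega),
    hγr _ (by omega) (by omega)]
  by_cases h3 : t + 1 < n
  · rw [add_assoc p t 1, inn (t + 1) h3]
    have : (a - (a + 2 * β * Real.cos φ)) * Real.sin ((t + 1) * φ) + β * Real.sin (t * φ) +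
        β * Real.sin (((t + 1 : ℕ) + 1 : ℝ) * φ) = 0 := by
      push_cast
      rw [show (t : ℝ) + 1 + 1 = t + 2 by ring]
      linear_combination β * e2
    rw [this]
    split_ifs
    · simpa using sq_nonneg β
    · simp
  · rw [out (p + t + 1) (by omega), if_pos (by omega)]
    refine le_trans (le_of_eq ?_) (hsq ((t + 2) * φ))
    have : (a - (a + 2 * β * Real.cos φ)) * Real.sin ((t + 1) * φ) + β * Real.sin (t * φ) +
        β * 0 = -(β * Real.sin ((t + 2) * φ)) := by linear_combination β * e2
    rw [this, neg_sq]

theorem le_card_triSpecF_near_of_run (hγ : Coupling γ d) {a β φ ε : ℝ} (hε : 0 ≤ ε) {l L : ℕ}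
    (hlL : l + L ≤ d + 1) (hα : ∀ i, l ≤ i → i < l + L → α i = a)
    (hγr : ∀ i, l < i → i < l + L → γ i = β) {m R : ℕ} (hm : 1 ≤ m)
    (hcos : |Real.cos φ| < 1)
    (hmε : 3 * β ^ 2 ≤ ε ^ 2 * (m * (1 - |Real.cos φ|))) (hR : R * (2 * m + 2) ≤ L) :
    R ≤ ((triSpecF α γ d).filter fun t => |t - (a + 2 * β * Real.cos φ)| ≤ ε).card := by
  classical
  let p : Fin R → ℕ := fun s => l + 1 + s * (2 * m + 2)
  have hp : ∀ s, p s + 2 * m < l + L := fun s => by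
    have : (s + 1 : ℕ) * (2 * m + 2) ≤ R * (2 * m + 2) := Nat.mul_le_mul_right _ s.2
    simp only [p]; rw [add_mul] at this; omega
  have hsep : ∀ s s', s ≠ s' → p s + (2 * m + 2) ≤ p s' ∨ p s' + (2 * m + 2) ≤ p s := by
    intro s s' hs
    simp only [p]
    rcases lt_or_gt_of_ne (fun h => hs (Fin.ext h) : (s : ℕ) ≠ s') with h | h
    · left
      have : (s + 1 : ℕ) * (2 * m + 2) ≤ s' * (2 * m + 2) := Nat.mul_le_mul_right _ h
      rw [add_mul] at this; omega
    · right
      have : (s' + 1 : ℕ) * (2 * m + 2) ≤ s * (2 * m + 2) := Nat.mul_le_mul_right _ h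
      rw [add_mul] at this; omega
  have hres : ∀ s i, (triRes α γ (a + 2 * β * Real.cos φ) (sineBlock φ (p s) (2 * m)) i) ^ 2 ≤
      if i = p s - 1 ∨ i = p s + 2 * m - 1 ∨ i = p s + 2 * m then β ^ 2 else 0 := fun s i =>
    triRes_sineBlock hα hγr (by simp only [p]; omega) (by omega) (hp s) i
  have hres0 : ∀ s i, ¬ (p s - 1 ≤ i ∧ i ≤ p s + 2 * m) →
      triRes α γ (a + 2 * β * Real.cos φ) (sineBlock φ (p s) (2 * m)) i = 0 := fun s i hi => by
    have := hres s i
    rw [if_neg (by omega)] at this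
    exact pow_eq_zero_iff two_ne_zero |>.1 (le_antisymm this (sq_nonneg _))
  have hp1 : ∀ s, 1 ≤ p s := fun s => by simp only [p]; omega
  have hc : 0 < 1 - |Real.cos φ| := by linarith
  have hm' : (0 : ℝ) < m := by exact_mod_cast hm
  have := le_card_triSpecF_near_of_disjoint (α := α) hγ (θ := a + 2 * β * Real.cos φ) hε
    (fun s : Fin R => sineBlock φ (p s) (2 * m)) ?_ ?_ ?_ ?_
  · simpa using this
  · intro s s' hs i _
    have h1 := hsep s s' hs
    by_cases h2 : p s ≤ i ∧ i < p s + 2 * m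
    · rw [sineBlock, sineBlock, if_neg (by omega : ¬ (p s' ≤ i ∧ i < p s' + 2 * m)), mul_zero]
    · rw [sineBlock, if_neg h2, zero_mul]
  · intro s s' hs i _
    have h1 := hsep s s' hs
    have h3 := hp1 s
    have h4 := hp1 s'
    by_cases h2 : p s - 1 ≤ i ∧ i ≤ p s + 2 * m
    · rw [hres0 s' i (by omega), mul_zero]
    · rw [hres0 s i h2, zero_mul]
  · intro s
    rw [sineBlock_sum φ (by have := hp s; omega)]
    exact lt_of_lt_of_le (mul_pos hm' hc) (sum_sin_sq_ge φ m)
  · intro s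
    rw [sineBlock_sum φ (by have := hp s; omega)]
    calc _ ≤ ∑ i ∈ Finset.range (d + 1),
          (if i ∈ ({p s - 1, p s + 2 * m - 1, p s + 2 * m} : Finset ℕ) then β ^ 2 else 0) := by
          refine Finset.sum_le_sum fun i _ => (hres s i).trans (le_of_eq ?_)
          simp
      _ ≤ 3 * β ^ 2 := by
          rw [← Finset.sum_filter, Finset.sum_const, nsmul_eq_mul]
          gcongr
          have h1 : (Finset.filter (fun i => i ∈ ({p s - 1, p s + 2 * m - 1, p s + 2 * m} : Finset ℕ))
              (Finset.range (d + 1))).card ≤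
              ({p s - 1, p s + 2 * m - 1, p s + 2 * m} : Finset ℕ).card :=
            Finset.card_le_card fun i hi => (Finset.mem_filter.1 hi).2
          exact_mod_cast h1.trans Finset.card_le_three
      _ ≤ _ := hmε.trans (by gcongr; exact sum_sin_sq_ge φ m)

end TridiagonalCounting

section Growth

/-- The recurrence forces positivity and a lower bound for the growth. -/
theorem initial_lower_bound {k θ σ : ℝ} {b c γ v : ℕ → ℝ} {p : ℕ}
    (hb : ∀ i ≤ p, b p ≤ b i) (hbp : 0 < b p) (hc0 : ∀ i ≤ p, 0 ≤ c i) (hc : ∀ i ≤ p, c i ≤ c p)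
    (hγ0 : γ 0 = 0) (hγ : ∀ i, i < p → γ (i + 1) ^ 2 = b i * c (i + 1))
    (hγpos : ∀ i, i < p → 0 < γ (i + 1))
    (hrec : ∀ i ≤ p, γ (i + 1) * v (i + 1) = (θ - (k - b i - c i)) * v i - γ i * v (i - 1))
    (hv0 : 0 < v 0) (hσ : 0 < σ) (hσ1 : σ ≤ 1)
    (hf : b p * σ ^ 2 - (θ - (k - b p - c p)) * σ + c p ≤ 0) :
    ∀ i ≤ p, 0 < v i ∧ σ * b i * v i ≤ γ (i + 1) * v (i + 1) := by
  have hfi : ∀ i ≤ p, b i * σ ^ 2 - (θ - (k - b i - c i)) * σ + c i ≤ 0 := fun i hi => by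
    have h1 := hb i hi
    have h2 := hc i hi
    have h3 : 0 ≤ (1 - σ) * ((b i - b p) * σ + (c p - c i)) :=
      mul_nonneg (by linarith) (add_nonneg (mul_nonneg (by linarith) hσ.le) (by linarith))
    nlinarith
  intro i
  induction i with
  | zero =>
    intro hi
    refine ⟨hv0, ?_⟩
    rw [hrec 0 hi, hγ0]
    have h1 := hfi 0 hi
    have h2 := hc0 0 hi
    have h3 : σ * b 0 ≤ θ - (k - b 0 - c 0) := by
      refine le_of_mul_le_mul_right ?_ hσ
      nlinarith
    nlinarith
  | succ i ih =>
    intro hi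
    obtain ⟨h1, h2⟩ := ih (by omega)
    have hg := hγpos i (by omega)
    have hbi : 0 < b i := hbp.trans_le (hb i (by omega))
    have hpos : 0 < v (i + 1) := by
      have : 0 < γ (i + 1) * v (i + 1) := lt_of_lt_of_le (by positivity) h2
      exact (mul_pos_iff_of_pos_left hg).1 this
    refine ⟨hpos, ?_⟩
    rw [hrec (i + 1) hi, Nat.add_sub_cancel]
    have h3 : γ (i + 1) * v i * σ ≤ c (i + 1) * v (i + 1) := by
      have h4 : (σ * b i * v i) * γ (i + 1) ≤ (γ (i + 1) * v (i + 1)) * γ (i + 1) :=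
        mul_le_mul_of_nonneg_right h2 hg.le
      have h5 : (γ (i + 1) * v (i + 1)) * γ (i + 1) = b i * (c (i + 1) * v (i + 1)) := by
        linear_combination v (i + 1) * hγ i (by omega)
      rw [h5] at h4
      refine le_of_mul_le_mul_left ?_ hbi
      linarith
    have h6 := hfi (i + 1) hi
    have h7 : (b (i + 1) * σ ^ 2 - (θ - (k - b (i + 1) - c (i + 1))) * σ + c (i + 1)) * v (i + 1)
        ≤ 0 := mul_nonpos_of_nonpos_of_nonneg h6 hpos.le
    refine le_of_mul_le_mul_right ?_ hσ
    nlinarith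

/-- Above the band of the column `p`, the sequence grows geometrically up to `p`. -/
theorem initial_growth {k θ δ c₀ : ℝ} {b c γ v : ℕ → ℝ} {p : ℕ}
    (hb : ∀ i ≤ p, b p ≤ b i) (hc0 : ∀ i ≤ p, 0 ≤ c i) (hc : ∀ i ≤ p, c i ≤ c p)
    (hγ0 : γ 0 = 0) (hγ : ∀ i, i < p → γ (i + 1) ^ 2 = b i * c (i + 1))
    (hγpos : ∀ i, i < p → 0 < γ (i + 1))
    (hrec : ∀ i ≤ p, γ (i + 1) * v (i + 1) = (θ - (k - b i - c i)) * v i - γ i * v (i - 1))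
    (hv0 : 0 < v 0) (hcp : 0 < c p) (hc₀ : 0 ≤ c₀)
    (hbc : (1 + c₀) ^ 2 * c p ≤ b p) (hδ : c₀ ^ 2 * √(b p * c p) ≤ δ)
    (hθ : k - (√(b p) - √(c p)) ^ 2 + δ ≤ θ) :
    (∀ i ≤ p, 0 < v i) ∧ (∀ i < p, (1 + c₀) * v i ≤ v (i + 1)) ∧
      (1 + c₀) * √(c p * b p) * v p ≤ γ (p + 1) * v (p + 1) := by
  have hbp : 0 < b p := lt_of_lt_of_le (by positivity) hbc
  set s := √(b p) with hs
  set r := √(c p) with hr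
  have hs0 : 0 < s := Real.sqrt_pos.2 hbp
  have hr0 : 0 < r := Real.sqrt_pos.2 hcp
  have hs2 : s ^ 2 = b p := Real.sq_sqrt hbp.le
  have hr2 : r ^ 2 = c p := Real.sq_sqrt hcp.le
  have hsr : √(b p * c p) = s * r := Real.sqrt_mul hbp.le _
  rw [hsr] at hδ
  set σ := (1 + c₀) * r / s with hσdef
  have hσs : σ * s = (1 + c₀) * r := by rw [hσdef]; field_simp
  have hσ : 0 < σ := by positivity
  have hσ1 : σ ≤ 1 := by
    rw [hσdef, div_le_one hs0]
    refine abs_le_of_sq_le_sq' ?_ hs0.le |>.2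
    rw [mul_pow, hr2, hs2]; exact hbc
  have key := initial_lower_bound (k := k) (θ := θ) (σ := σ) hb hbp hc0 hc hγ0 hγ hγpos hrec hv0 hσ
    hσ1 (by
      rw [← hs2, ← hr2]
      have h1 : θ - (k - s ^ 2 - r ^ 2) ≥ 2 * s * r + δ := by nlinarith
      have h2 : (2 * s * r + δ) * σ ≤ (θ - (k - s ^ 2 - r ^ 2)) * σ :=
        mul_le_mul_of_nonneg_right h1 hσ.le
      have h3 : s ^ 2 * σ ^ 2 = (1 + c₀) ^ 2 * r ^ 2 := by rw [← mul_pow, mul_comm, hσs]; ring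
      have h4 : 2 * s * r * σ = 2 * (1 + c₀) * r ^ 2 := by linear_combination 2 * r * hσs
      have h5 : c₀ ^ 2 * r ^ 2 ≤ δ * σ := by
        have : c₀ ^ 2 * (s * r) * σ ≤ δ * σ := mul_le_mul_of_nonneg_right hδ hσ.le
        have h6 : c₀ ^ 2 * (s * r) * σ = c₀ ^ 2 * r ^ 2 * (1 + c₀) := by
          linear_combination c₀ ^ 2 * r * hσs
        have h7 : c₀ ^ 2 * r ^ 2 ≤ c₀ ^ 2 * r ^ 2 * (1 + c₀) :=
          le_mul_of_one_le_right (by positivity) (by linarith)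
        linarith
      nlinarith)
  refine ⟨fun i hi => (key i hi).1, fun i hi => ?_, ?_⟩
  · have h1 := (key i hi.le).2
    have hvi := (key i hi.le).1
    have hvi1 := (key (i + 1) hi).1
    have hbi : 0 < b i := hbp.trans_le (hb i hi.le)
    have h2 : (σ * b i * v i) ^ 2 ≤ (γ (i + 1) * v (i + 1)) ^ 2 :=
      pow_le_pow_left₀ (by positivity) h1 2
    rw [mul_pow (γ (i + 1)), hγ i hi] at h2
    have h3 : σ ^ 2 * b i * v i ^ 2 ≤ c (i + 1) * v (i + 1) ^ 2 := by
      refine le_of_mul_le_mul_left ?_ hbi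
      nlinarith
    have h4 : (1 + c₀) ^ 2 * c p = σ ^ 2 * b p := by
      rw [← hs2, ← hr2, ← mul_pow, ← mul_pow, hσs]
    have h5 : c p * ((1 + c₀) * v i) ^ 2 ≤ c p * v (i + 1) ^ 2 := by
      calc c p * ((1 + c₀) * v i) ^ 2 = σ ^ 2 * b p * v i ^ 2 := by rw [← h4]; ring
        _ ≤ σ ^ 2 * b i * v i ^ 2 := by gcongr; exact hb i hi.le
        _ ≤ c (i + 1) * v (i + 1) ^ 2 := h3
        _ ≤ c p * v (i + 1) ^ 2 := by gcongr; exact hc (i + 1) hi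
    exact abs_le_of_sq_le_sq' (le_of_mul_le_mul_left h5 hcp) hvi1.le |>.2
  · have h1 := (key p le_rfl).2
    refine le_trans (le_of_eq ?_) h1
    rw [mul_comm (c p), hsr, ← hs2]
    linear_combination (-(s * v p)) * hσs

/-- Monotonicity of the growth in the spectral parameter. -/
theorem growth_slope {θ θ' K : ℝ} {α γ v v' : ℕ → ℝ} {p : ℕ} (hγ0 : γ 0 = 0)
    (hγpos : ∀ i < p, 0 < γ (i + 1))
    (hrec : ∀ i < p, γ (i + 1) * v (i + 1) = (θ - α i) * v i - γ i * v (i - 1))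
    (hrec' : ∀ i < p, γ (i + 1) * v' (i + 1) = (θ' - α i) * v' i - γ i * v' (i - 1))
    (h0 : v 0 = 1) (h0' : v' 0 = 1) (hv : ∀ i ≤ p, 0 < v i) (hv' : ∀ i ≤ p, 0 < v' i)
    (hθ : θ ≤ θ') (hK : 0 < K) (hα : ∀ i < p, θ - α i ≤ K) :
    ∀ i ≤ p, (1 + (θ' - θ) / K) ^ i * v i ≤ v' i := by
  have hγnn : ∀ i ≤ p, 0 ≤ γ i := fun i hi => by
    cases i with
    | zero => exact hγ0.ge
    | succ i => exact (hγpos i (by omega)).le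
  have hW : ∀ i < p, (θ' - θ) * (v i * v' i) ≤ γ (i + 1) * (v' (i + 1) * v i - v (i + 1) * v' i) := by
    intro i
    induction i with
    | zero =>
      intro hi
      have e1 := hrec 0 hi
      have e2 := hrec' 0 hi
      rw [hγ0] at e1 e2
      apply le_of_eq
      linear_combination v' 0 * e1 - v 0 * e2
    | succ i ih =>
      intro hi
      have e1 := hrec (i + 1) hi
      have e2 := hrec' (i + 1) hi
      have e3 := ih (by omega)
      rw [Nat.add_sub_cancel] at e1 e2
      have h4 : 0 ≤ (θ' - θ) * (v i * v' i) :=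
        mul_nonneg (by linarith) (mul_pos (hv i (by omega)) (hv' i (by omega))).le
      have e5 : γ (i + 1 + 1) * (v' (i + 1 + 1) * v (i + 1) - v (i + 1 + 1) * v' (i + 1)) =
        (θ' - θ) * (v (i + 1) * v' (i + 1)) +
          γ (i + 1) * (v' (i + 1) * v i - v (i + 1) * v' i) := by
        linear_combination v (i + 1) * e2 - v' (i + 1) * e1
      linarith
  intro i
  induction i with
  | zero => intro _; simp [h0, h0']
  | succ i ih =>
    intro hi
    have e1 := ih (by omega)
    have e2 := hW i (by omega)
    have hvi := hv i (by omega)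
    have hvi' := hv' i (by omega)
    have hvi1 := hv (i + 1) hi
    have e3 : γ (i + 1) * v (i + 1) ≤ K * v i := by
      rw [hrec i (by omega)]
      have h1 : 0 ≤ γ i * v (i - 1) := mul_nonneg (hγnn i (by omega)) (hv _ (by omega)).le
      have h2 := mul_le_mul_of_nonneg_right (hα i (by omega)) hvi.le
      linarith
    set t := (θ' - θ) / K with ht
    have ht0 : 0 ≤ t := div_nonneg (by linarith) hK.le
    have htK : θ' - θ = t * K := by rw [ht]; field_simp
    have e4 : (1 + t) * v (i + 1) * v' i ≤ v' (i + 1) * v i := by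
      have hg := hγpos i (by omega)
      refine le_of_mul_le_mul_left ?_ hg
      have : t * (γ (i + 1) * v (i + 1)) * v' i ≤ t * (K * v i) * v' i := by gcongr
      rw [htK] at e2
      nlinarith
    have e5 : (1 + t) * v (i + 1) * ((1 + t) ^ i * v i) ≤ v' (i + 1) * v i :=
      (mul_le_mul_of_nonneg_left e1 (by positivity)).trans e4
    refine le_of_mul_le_mul_right ?_ hvi
    calc (1 + t) ^ (i + 1) * v (i + 1) * v i = (1 + t) * v (i + 1) * ((1 + t) ^ i * v i) := by ring
      _ ≤ _ := e5

/-- The conserved quantity of a constant-coefficient recurrence. -/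
theorem run_invariant {x : ℝ} {v : ℕ → ℝ} {l m : ℕ}
    (hrec : ∀ i, l < i → i < m → v (i + 1) = 2 * x * v i - v (i - 1)) :
    ∀ i, l ≤ i → i < m → v i ^ 2 + v (i + 1) ^ 2 - 2 * x * v i * v (i + 1) =
      v l ^ 2 + v (l + 1) ^ 2 - 2 * x * v l * v (l + 1) := by
  intro i hi
  induction i, hi using Nat.le_induction with
  | base => intro _; rfl
  | succ i hi ih =>
    intro him
    rw [← ih (by omega), hrec (i + 1) (by omega) him, Nat.add_sub_cancel]
    ring

end Growth

/-- The combinatorial constraints on the intersection numbers of a distance-regular graph. -/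
structure IArray (k d : ℕ) (b c : ℕ → ℕ) : Prop where
  b_zero : b 0 = k
  b_last : b d = 0
  c_zero : c 0 = 0
  b_pos : ∀ i < d, 1 ≤ b i
  c_pos : ∀ i, 1 ≤ i → i ≤ d → 1 ≤ c i
  b_anti : ∀ i j, i ≤ j → j ≤ d → b j ≤ b i
  c_mono : ∀ i j, i ≤ j → j ≤ d → c i ≤ c j
  add_le : ∀ i ≤ d, b i + c i ≤ k
  c_le_b : ∀ i j, i + j ≤ d → c j ≤ b i

/-- Diagonal entries of the symmetrized intersection matrix. -/
def diagSeq (k : ℕ) (b c : ℕ → ℕ) (i : ℕ) : ℝ := k - b i - c i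

/-- Off-diagonal entries of the symmetrized intersection matrix. -/
noncomputable def coupSeq (b c : ℕ → ℕ) (i : ℕ) : ℝ := √(b (i - 1) * c i)

/-- The standard sequence, normalized to be an eigenvector of the symmetrized matrix. -/
noncomputable def stdSeq (k : ℕ) (b c : ℕ → ℕ) (θ : ℝ) : ℕ → ℝ :=
  triSeq (diagSeq k b c) (coupSeq b c) θ

/-- The set of eigenvalues of the intersection matrix. -/
noncomputable def spec (k d : ℕ) (b c : ℕ → ℕ) : Finset ℝ :=
  triSpecF (diagSeq k b c) (coupSeq b c) d

/-- The squared norm of the standard sequence. -/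
noncomputable def sig (k d : ℕ) (b c : ℕ → ℕ) (θ : ℝ) : ℝ :=
  ∑ i ∈ Finset.range (d + 1), stdSeq k b c θ i ^ 2

/-- The local energy of the standard sequence. -/
noncomputable def energy (k : ℕ) (b c : ℕ → ℕ) (θ : ℝ) (i : ℕ) : ℝ :=
  stdSeq k b c θ i ^ 2 + stdSeq k b c θ (i + 1) ^ 2

theorem energy_nonneg (k : ℕ) (b c : ℕ → ℕ) (θ : ℝ) (i : ℕ) : 0 ≤ energy k b c θ i := by
  unfold energy; positivity

namespace IArray

variable {k d : ℕ} {b c : ℕ → ℕ}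

theorem one_le_d (h : IArray k d b c) (hk : 1 ≤ k) : 1 ≤ d := by
  rcases Nat.eq_zero_or_pos d with rfl | h1
  · have := h.b_zero; have := h.b_last; omega
  · exact h1

theorem coupSeq_zero (h : IArray k d b c) : coupSeq b c 0 = 0 := by simp [coupSeq, h.c_zero]

theorem coupSeq_sq (b c : ℕ → ℕ) (i : ℕ) : coupSeq b c (i + 1) ^ 2 = b i * c (i + 1) := by
  rw [coupSeq, Nat.add_sub_cancel, Real.sq_sqrt (by positivity)]

theorem one_le_coupSeq (h : IArray k d b c) {i : ℕ} (h1 : 1 ≤ i) (h2 : i ≤ d) :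
    1 ≤ coupSeq b c i := by
  rw [coupSeq, Real.one_le_sqrt]
  have e1 := h.b_pos (i - 1) (by omega)
  have e2 := h.c_pos i h1 h2
  exact_mod_cast Nat.mul_le_mul e1 e2

theorem b_le (h : IArray k d b c) {i : ℕ} (hi : i ≤ d) : b i ≤ k := by
  have := h.add_le i hi; omega

theorem c_le (h : IArray k d b c) {i : ℕ} (hi : i ≤ d) : c i ≤ k := by
  have := h.add_le i hi; omega

theorem coupSeq_nonneg (b c : ℕ → ℕ) (i : ℕ) : 0 ≤ coupSeq b c i := Real.sqrt_nonneg _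

theorem coupSeq_le (h : IArray k d b c) {i : ℕ} (h2 : i ≤ d) : coupSeq b c i ≤ k := by
  rw [coupSeq, Real.sqrt_le_left (by positivity), sq]
  have e1 := h.b_le (i := i - 1) (by omega)
  have e2 := h.c_le h2
  exact_mod_cast Nat.mul_le_mul e1 e2

theorem coupling (h : IArray k d b c) : Coupling (coupSeq b c) d where
  zero := h.coupSeq_zero
  last := by simp [coupSeq, h.b_last]
  pos i h1 h2 := lt_of_lt_of_le one_pos (h.one_le_coupSeq h1 h2)

theorem diagSeq_nonneg (h : IArray k d b c) {i : ℕ} (hi : i ≤ d) : 0 ≤ diagSeq k b c i := by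
  have : ((b i + c i : ℕ) : ℝ) ≤ k := by exact_mod_cast h.add_le i hi
  push_cast at this
  unfold diagSeq; linarith

theorem diagSeq_le (k : ℕ) (b c : ℕ → ℕ) (i : ℕ) : diagSeq k b c i ≤ k := by
  have h1 : (0 : ℝ) ≤ b i := by positivity
  have h2 : (0 : ℝ) ≤ c i := by positivity
  unfold diagSeq; linarith

theorem abs_sub_diagSeq_le (h : IArray k d b c) {θ : ℝ} (hθ : |θ| ≤ k) {i : ℕ} (hi : i ≤ d) :
    |θ - diagSeq k b c i| ≤ 2 * k := by
  have h1 := h.diagSeq_nonneg hi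
  have h2 := diagSeq_le k b c i
  obtain ⟨h3, h4⟩ := abs_le.1 hθ
  exact abs_le.2 ⟨by linarith, by linarith⟩

theorem stdSeq_rec (h : IArray k d b c) (θ : ℝ) {i : ℕ} (hi : i < d) :
    coupSeq b c (i + 1) * stdSeq k b c θ (i + 1) =
      (θ - diagSeq k b c i) * stdSeq k b c θ i - coupSeq b c i * stdSeq k b c θ (i - 1) :=
  triSeq_rec h.coupling θ hi

theorem energy_zero_le (h : IArray k d b c) (hk : 1 ≤ k) {θ : ℝ} (hθ : |θ| ≤ k) :
    energy k b c θ 0 ≤ 6 * (k : ℝ) ^ 2 := by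
  have hd := h.one_le_d hk
  have h1 := h.stdSeq_rec θ (i := 0) (by omega)
  have h2 : diagSeq k b c 0 = 0 := by simp [diagSeq, h.b_zero, h.c_zero]
  have h3 : stdSeq k b c θ 0 = 1 := by simp [stdSeq, triSeq]
  rw [h.coupSeq_zero, h2, h3] at h1
  have h4 := h.one_le_coupSeq le_rfl hd
  have hk' : (1 : ℝ) ≤ k := by exact_mod_cast hk
  have h5 : stdSeq k b c θ 1 ^ 2 ≤ (coupSeq b c 1 * stdSeq k b c θ 1) ^ 2 := by
    rw [mul_pow]
    exact le_mul_of_one_le_left (sq_nonneg _) (by nlinarith)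
  have h6 : θ ^ 2 ≤ (k : ℝ) ^ 2 := sq_le_sq.2 (by rwa [abs_of_nonneg (by positivity : (0:ℝ) ≤ k)])
  simp only [zero_add] at h1
  rw [h1] at h5
  simp only [energy, h3, zero_add]
  nlinarith

private theorem step_bound {K g g' t u v w : ℝ} (hg : 1 ≤ g) (hg' : |g'| ≤ K) (ht : |t| ≤ 2 * K)
    (hK : 1 ≤ K) (h : g * w = t * v - g' * u) : v ^ 2 + w ^ 2 ≤ 6 * K ^ 2 * (u ^ 2 + v ^ 2) := by
  have h1 : w ^ 2 ≤ (g * w) ^ 2 := by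
    rw [mul_pow]; exact le_mul_of_one_le_left (sq_nonneg _) (by nlinarith)
  rw [h] at h1
  have h2 : (t * v - g' * u) ^ 2 ≤ (t ^ 2 + g' ^ 2) * (u ^ 2 + v ^ 2) := by
    nlinarith [sq_nonneg (t * u + g' * v)]
  have h3 : t ^ 2 ≤ (2 * K) ^ 2 := sq_le_sq.2 (by rwa [abs_of_nonneg (by linarith : 0 ≤ 2 * K)])
  have h4 : g' ^ 2 ≤ K ^ 2 := sq_le_sq.2 (by rwa [abs_of_nonneg (by linarith : 0 ≤ K)])
  have h5 : (t ^ 2 + g' ^ 2) * (u ^ 2 + v ^ 2) ≤ 5 * K ^ 2 * (u ^ 2 + v ^ 2) := by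
    gcongr; nlinarith
  have h6 : 1 * (u ^ 2 + v ^ 2) ≤ K ^ 2 * (u ^ 2 + v ^ 2) := by gcongr; nlinarith
  nlinarith [sq_nonneg u]

theorem energy_succ_le (h : IArray k d b c) (hk : 1 ≤ k) {θ : ℝ} (hθ : |θ| ≤ k) {i : ℕ}
    (hi : i + 1 < d) : energy k b c θ (i + 1) ≤ 6 * (k : ℝ) ^ 2 * energy k b c θ i := by
  refine step_bound (h.one_le_coupSeq (by omega) (by omega : i + 1 + 1 ≤ d)) ?_
    (h.abs_sub_diagSeq_le hθ hi.le) (by exact_mod_cast hk) (h.stdSeq_rec θ hi)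
  rw [abs_of_nonneg (coupSeq_nonneg _ _ _)]
  exact h.coupSeq_le hi.le

theorem energy_le_succ (h : IArray k d b c) (hk : 1 ≤ k) {θ : ℝ} (hθ : |θ| ≤ k) {i : ℕ}
    (hi : i + 1 < d) : energy k b c θ i ≤ 6 * (k : ℝ) ^ 2 * energy k b c θ (i + 1) := by
  have h1 := h.stdSeq_rec θ hi
  rw [Nat.add_sub_cancel] at h1
  have h2 := step_bound (K := k) (g := coupSeq b c (i + 1)) (g' := coupSeq b c (i + 1 + 1))
    (t := θ - diagSeq k b c (i + 1)) (u := stdSeq k b c θ (i + 1 + 1))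
    (v := stdSeq k b c θ (i + 1)) (w := stdSeq k b c θ i)
    (h.one_le_coupSeq (by omega) (by omega)) ?_
    (h.abs_sub_diagSeq_le hθ hi.le) (by exact_mod_cast hk) (by linarith)
  · unfold energy; linarith
  · rw [abs_of_nonneg (coupSeq_nonneg _ _ _)]
    exact h.coupSeq_le (by omega)

theorem energy_le_pow (h : IArray k d b c) (hk : 1 ≤ k) {θ : ℝ} (hθ : |θ| ≤ k) {i j n : ℕ}
    (hij : i ≤ j) (hj : j < d) (hn : j ≤ i + n) :
    energy k b c θ j ≤ (6 * (k : ℝ) ^ 2) ^ n * energy k b c θ i := by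
  have hk' : (1 : ℝ) ≤ k := by exact_mod_cast hk
  have hC : (1 : ℝ) ≤ 6 * (k : ℝ) ^ 2 := by nlinarith
  have key : energy k b c θ j ≤ (6 * (k : ℝ) ^ 2) ^ (j - i) * energy k b c θ i := by
    induction j, hij using Nat.le_induction with
    | base => simp
    | succ j hij ih =>
      have h1 := ih (by omega) (by omega)
      rw [Nat.sub_add_comm hij, pow_succ]
      calc _ ≤ _ := h.energy_succ_le hk hθ hj
        _ ≤ 6 * (k : ℝ) ^ 2 * ((6 * (k : ℝ) ^ 2) ^ (j - i) * energy k b c θ i) := by gcongr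
        _ = _ := by ring
  exact key.trans (mul_le_mul_of_nonneg_right (pow_le_pow_right₀ hC (by omega))
    (energy_nonneg _ _ _ _ _))

theorem sig_le_sum_energy (h : IArray k d b c) (hk : 1 ≤ k) (θ : ℝ) :
    sig k d b c θ ≤ ∑ i ∈ Finset.range d, energy k b c θ i := by
  have hd := h.one_le_d hk
  obtain ⟨e, rfl⟩ := Nat.exists_eq_add_of_le' hd
  simp only [energy, Finset.sum_add_distrib]
  rw [sig, Finset.sum_range_succ]
  gcongr
  exact Finset.single_le_sum (f := fun i => stdSeq k b c θ (i + 1) ^ 2)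
    (fun i _ => sq_nonneg _) (Finset.mem_range.2 (Nat.lt_succ_self e))

theorem sum_energy_le (k : ℕ) (b c : ℕ → ℕ) (θ : ℝ) {I : Finset ℕ} (hI : ∀ i ∈ I, i < d) :
    ∑ i ∈ I, energy k b c θ i ≤ 2 * sig k d b c θ := by
  simp only [energy, Finset.sum_add_distrib, two_mul]
  unfold sig
  refine add_le_add ?_ ?_
  · exact Finset.sum_le_sum_of_subset_of_nonneg
      (fun i hi => Finset.mem_range.2 (by have := hI i hi; omega)) fun _ _ _ => sq_nonneg _
  · rw [← Finset.sum_image (f := fun i => stdSeq k b c θ i ^ 2) (g := fun i => i + 1)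
      (fun _ _ _ _ => by simp)]
    refine Finset.sum_le_sum_of_subset_of_nonneg (fun i hi => ?_) fun _ _ _ => sq_nonneg _
    obtain ⟨j, hj, rfl⟩ := Finset.mem_image.1 hi
    exact Finset.mem_range.2 (by have := hI j hj; omega)

end IArray

/-- A range of columns on which the tridiagonal matrix has constant coefficients. -/
structure IsRun (k d : ℕ) (b c : ℕ → ℕ) (l L : ℕ) (a β : ℝ) : Prop where
  le : L ≤ d
  diag : ∀ i, l ≤ i → i < L → diagSeq k b c i = a
  coup : ∀ i, l < i → i < L → coupSeq b c i = β

namespace IsRun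

variable {k d : ℕ} {b c : ℕ → ℕ} {l L : ℕ} {a β : ℝ}

theorem recurrence (hr : IsRun k d b c l L a β) (h : IArray k d b c) (hβ : 0 < β) (θ : ℝ)
    {j : ℕ} (h1 : l < j) (h2 : j + 1 < L) :
    stdSeq k b c θ (j + 1) = 2 * ((θ - a) / (2 * β)) * stdSeq k b c θ j - stdSeq k b c θ (j - 1) := by
  have hd := hr.le
  have e := h.stdSeq_rec θ (i := j) (by omega)
  rw [hr.diag j h1.le (by omega), hr.coup j h1 (by omega), hr.coup (j + 1) (by omega) (by omega)]
    at e
  field_simp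
  linarith

theorem invariant (hr : IsRun k d b c l L a β) (h : IArray k d b c) (hβ : 0 < β) (θ : ℝ)
    {i : ℕ} (hi : l ≤ i) (hiL : i + 1 < L) :
    stdSeq k b c θ i ^ 2 + stdSeq k b c θ (i + 1) ^ 2
      - 2 * ((θ - a) / (2 * β)) * stdSeq k b c θ i * stdSeq k b c θ (i + 1) =
    stdSeq k b c θ l ^ 2 + stdSeq k b c θ (l + 1) ^ 2
      - 2 * ((θ - a) / (2 * β)) * stdSeq k b c θ l * stdSeq k b c θ (l + 1) := by
  exact run_invariant (m := L - 1) (fun j h1 h2 => hr.recurrence h hβ θ h1 (by omega)) i hi (by omega)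


private theorem quad_bounds {x u v : ℝ} (hx : |x| ≤ 1) :
    (1 - |x|) * (u ^ 2 + v ^ 2) ≤ u ^ 2 + v ^ 2 - 2 * x * u * v ∧
      u ^ 2 + v ^ 2 - 2 * x * u * v ≤ 2 * (u ^ 2 + v ^ 2) := by
  have h1 : |2 * x * u * v| ≤ |x| * (u ^ 2 + v ^ 2) := by
    rw [abs_mul, abs_mul, abs_mul, abs_two]
    nlinarith [sq_nonneg (|u| - |v|), abs_nonneg x, sq_abs u, sq_abs v]
  have h2 : |x| * (u ^ 2 + v ^ 2) ≤ 1 * (u ^ 2 + v ^ 2) := by gcongr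
  obtain ⟨h3, h4⟩ := abs_le.1 h1
  constructor <;> linarith

private theorem abs_ratio_le {k : ℕ} {θ a β δ : ℝ} (hβ : 1 ≤ β) (hβk : β ≤ k) (hδ : 0 ≤ δ)
    (hθ : |θ - a| ≤ 2 * β - δ) : |(θ - a) / (2 * β)| ≤ 1 - δ / (2 * k) := by
  have h2 : 0 < 2 * β := by linarith
  rw [abs_div, abs_of_pos h2, div_le_iff₀ h2]
  have h3 : δ / (2 * k) * (2 * β) ≤ δ := by
    rw [div_mul_eq_mul_div, div_le_iff₀ (by linarith)]
    gcongr
  linarith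

/-- Inside the band, the energy is comparable along a run. -/
theorem energy_comparable (hr : IsRun k d b c l L a β) (h : IArray k d b c) (hk : 1 ≤ k)
    (hβ : 1 ≤ β) (hβk : β ≤ k) {θ δ : ℝ} (hδ : 0 < δ) (hδ1 : δ ≤ 1) (hθk : |θ| ≤ k)
    (hθ : |θ - a| ≤ 2 * β - δ) (hl : 1 ≤ l) {i : ℕ} (hi : l ≤ i + 1) (hiL : i + 1 ≤ max l L)
    (hld : l ≤ d) :
    energy k b c θ i ≤ (6 * (k : ℝ) ^ 2) ^ 2 * (4 * k / δ) * energy k b c θ (l - 1) ∧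
      energy k b c θ (l - 1) ≤ (6 * (k : ℝ) ^ 2) ^ 2 * (4 * k / δ) * energy k b c θ i := by
  have hk' : (1 : ℝ) ≤ k := by exact_mod_cast hk
  have hLd := hr.le
  set C : ℝ := 6 * (k : ℝ) ^ 2 with hC
  set D : ℝ := 4 * k / δ with hD
  have hC1 : 1 ≤ C := by nlinarith
  have hD1 : 1 ≤ D := by rw [hD, one_le_div hδ]; linarith
  have hen := energy_nonneg k b c θ
  have hx := abs_ratio_le hβ hβk hδ.le hθ
  set x := (θ - a) / (2 * β) with hxdef
  have hδk : 0 < δ / (2 * k) := by positivity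
  have core : ∀ j, l ≤ j → j + 1 < L → energy k b c θ j ≤ D * energy k b c θ l ∧
      energy k b c θ l ≤ D * energy k b c θ j := by
    intro j hj hjL
    have hQ := hr.invariant h (by linarith : 0 < β) θ hj hjL
    rw [← hxdef] at hQ
    obtain ⟨q1, q2⟩ := quad_bounds (x := x) (u := stdSeq k b c θ j) (v := stdSeq k b c θ (j + 1))
      (by linarith)
    obtain ⟨q3, q4⟩ := quad_bounds (x := x) (u := stdSeq k b c θ l) (v := stdSeq k b c θ (l + 1))
      (by linarith)
    rw [hQ] at q1 q2
    have e1 : δ / (2 * k) * energy k b c θ j ≤ (1 - |x|) * energy k b c θ j :=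
      mul_le_mul_of_nonneg_right (by linarith) (hen j)
    have e2 : δ / (2 * k) * energy k b c θ l ≤ (1 - |x|) * energy k b c θ l :=
      mul_le_mul_of_nonneg_right (by linarith) (hen l)
    have hDd : D * (δ / (2 * k)) = 2 := by rw [hD]; field_simp; norm_num
    constructor
    · refine le_of_mul_le_mul_left ?_ hδk
      rw [← mul_assoc, mul_comm _ D, hDd]
      exact (e1.trans q1).trans q4
    · refine le_of_mul_le_mul_left ?_ hδk
      rw [← mul_assoc, mul_comm _ D, hDd]
      exact (e2.trans q3).trans q2
  obtain ⟨l, rfl⟩ := Nat.exists_eq_add_of_le' hl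
  rw [Nat.add_sub_cancel]
  rcases Nat.lt_or_ge i (l + 1) with h1 | h1
  · obtain rfl : i = l := by omega
    have : 1 * energy k b c θ i ≤ C ^ 2 * D * energy k b c θ i := by
      gcongr
      · exact hen i
      · exact one_le_mul_of_one_le_of_one_le (one_le_pow₀ hC1) hD1
    exact ⟨by linarith, by linarith⟩
  have hL : i + 1 ≤ L := by omega
  have s1 := h.energy_succ_le hk hθk (i := l) (by omega)
  have s2 := h.energy_le_succ hk hθk (i := l) (by omega)
  rcases hL.lt_or_eq with h2 | h2
  · obtain ⟨c1, c2⟩ := core i h1 h2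
    constructor
    · calc energy k b c θ i ≤ D * energy k b c θ (l + 1) := c1
        _ ≤ D * (C * energy k b c θ l) := by gcongr
        _ ≤ C * (D * (C * energy k b c θ l)) := le_mul_of_one_le_left
            (mul_nonneg (by linarith) (mul_nonneg (by linarith) (hen _))) hC1
        _ = _ := by ring
    · calc energy k b c θ l ≤ C * energy k b c θ (l + 1) := s2
        _ ≤ C * (D * energy k b c θ i) := by gcongr
        _ ≤ C * (C * (D * energy k b c θ i)) := le_mul_of_one_le_left
            (mul_nonneg (by linarith) (mul_nonneg (by linarith) (hen _))) hC1
        _ = _ := by ring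
  · rcases h1.lt_or_eq with h3 | h3
    · obtain ⟨j, rfl⟩ := Nat.exists_eq_add_of_le' (by omega : 1 ≤ i)
      obtain ⟨c1, c2⟩ := core j (by omega) (by omega)
      have t1 := h.energy_succ_le hk hθk (i := j) (by omega)
      have t2 := h.energy_le_succ hk hθk (i := j) (by omega)
      constructor
      · calc energy k b c θ (j + 1) ≤ C * energy k b c θ j := t1
          _ ≤ C * (D * energy k b c θ (l + 1)) := by gcongr
          _ ≤ C * (D * (C * energy k b c θ l)) := by gcongr
          _ = _ := by ring
      · calc energy k b c θ l ≤ C * energy k b c θ (l + 1) := s2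
          _ ≤ C * (D * energy k b c θ j) := by gcongr
          _ ≤ C * (D * (C * energy k b c θ (j + 1))) := by gcongr
          _ = _ := by ring
    · subst h3
      have hCD : C ≤ C ^ 2 * D := by
        have := le_mul_of_one_le_right (by linarith : 0 ≤ C)
          (one_le_mul_of_one_le_of_one_le hC1 hD1)
        linarith
      exact ⟨s1.trans (mul_le_mul_of_nonneg_right hCD (hen _)),
        s2.trans (mul_le_mul_of_nonneg_right hCD (hen _))⟩

/-- In the closed band, the energy grows at most quadratically along a run. -/
theorem energy_le_of_closed_band (hr : IsRun k d b c l L a β) (h : IArray k d b c) (hk : 1 ≤ k)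
    (hβ : 1 ≤ β) {θ : ℝ} (hθk : |θ| ≤ k)
    (hθ : |θ - a| ≤ 2 * β) (hl : 1 ≤ l) {i : ℕ} (hi : l ≤ i + 1) (hiL : i + 1 ≤ max l L)
    (hld : l ≤ d) :
    energy k b c θ i ≤ (6 * (k : ℝ) ^ 2) ^ 2 * (18 * (d : ℝ) ^ 2) * energy k b c θ (l - 1) := by
  have hk' : (1 : ℝ) ≤ k := by exact_mod_cast hk
  have hd' : (1 : ℝ) ≤ d := by exact_mod_cast h.one_le_d hk
  have hLd := hr.le
  set C : ℝ := 6 * (k : ℝ) ^ 2 with hC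
  set D : ℝ := 18 * (d : ℝ) ^ 2 with hD
  have hC1 : 1 ≤ C := by nlinarith
  have hD1 : 1 ≤ D := by nlinarith
  have hen := energy_nonneg k b c θ
  have hx : |(θ - a) / (2 * β)| ≤ 1 := by
    rw [abs_div, abs_of_pos (by linarith : 0 < 2 * β), div_le_one (by linarith)]
    exact hθ
  set x := (θ - a) / (2 * β) with hxdef
  have hx2 : x ^ 2 ≤ 1 := by rw [← sq_abs]; nlinarith [abs_nonneg x]
  set s := √(energy k b c θ l) with hs
  have hs0 : 0 ≤ s := Real.sqrt_nonneg _
  have hs2 : s ^ 2 = energy k b c θ l := Real.sq_sqrt (hen l)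
  have lin : ∀ j, l ≤ j → j < L → |stdSeq k b c θ j| ≤ (1 + 2 * ((j - l : ℕ) : ℝ)) * s := by
    intro j hj
    induction j, hj using Nat.le_induction with
    | base =>
      intro _
      simp only [Nat.sub_self, Nat.cast_zero, mul_zero, add_zero, one_mul]
      refine Real.abs_le_sqrt ?_
      unfold energy; nlinarith [sq_nonneg (stdSeq k b c θ (l + 1))]
    | succ j hj ih =>
      intro hjL
      have ih := ih (by omega)
      have hQ := hr.invariant h (by linarith : 0 < β) θ hj hjL
      rw [← hxdef] at hQ
      have q4 := (quad_bounds (x := x) (u := stdSeq k b c θ l) (v := stdSeq k b c θ (l + 1)) hx).2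
      have hz : |stdSeq k b c θ (j + 1) - x * stdSeq k b c θ j| ≤ 2 * s := by
        refine abs_le_of_sq_le_sq ?_ (by positivity)
        have : (2 * s) ^ 2 = 4 * energy k b c θ l := by rw [mul_pow, hs2]; norm_num
        rw [this]
        have h0 : 0 ≤ (1 - x ^ 2) * stdSeq k b c θ j ^ 2 := mul_nonneg (by linarith) (sq_nonneg _)
        have := hen l
        unfold energy at this ⊢
        nlinarith
      have hxv : |x * stdSeq k b c θ j| ≤ |stdSeq k b c θ j| := by
        rw [abs_mul]; exact mul_le_of_le_one_left (abs_nonneg _) hx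
      have h3 := abs_add_le (stdSeq k b c θ (j + 1) - x * stdSeq k b c θ j) (x * stdSeq k b c θ j)
      rw [sub_add_cancel] at h3
      rw [Nat.sub_add_comm hj]
      push_cast
      linarith
  have core : ∀ j, l ≤ j → j + 1 < L → energy k b c θ j ≤ D * energy k b c θ l := by
    intro j hj hjL
    have hbd : ∀ m, l ≤ m → m < L → stdSeq k b c θ m ^ 2 ≤ (3 * d) ^ 2 * energy k b c θ l := by
      intro m hm hmL
      rw [← hs2, ← mul_pow, ← sq_abs]
      refine pow_le_pow_left₀ (abs_nonneg _) ((lin m hm hmL).trans ?_) 2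
      gcongr
      have : ((m - l : ℕ) : ℝ) ≤ d := by exact_mod_cast (by omega)
      linarith
    have h1 := hbd j hj (by omega)
    have h2 := hbd (j + 1) (by omega) (by omega)
    rw [energy, hD]
    linarith
  obtain ⟨l, rfl⟩ := Nat.exists_eq_add_of_le' hl
  rw [Nat.add_sub_cancel]
  rcases Nat.lt_or_ge i (l + 1) with h1 | h1
  · obtain rfl : i = l := by omega
    have : 1 * energy k b c θ i ≤ C ^ 2 * D * energy k b c θ i := by
      gcongr
      · exact hen i
      · exact one_le_mul_of_one_le_of_one_le (one_le_pow₀ hC1) hD1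
    linarith
  have hL : i + 1 ≤ L := by omega
  have s1 := h.energy_succ_le hk hθk (i := l) (by omega)
  rcases hL.lt_or_eq with h2 | h2
  · have c1 := core i h1 h2
    calc energy k b c θ i ≤ D * energy k b c θ (l + 1) := c1
        _ ≤ D * (C * energy k b c θ l) := by gcongr
        _ ≤ C * (D * (C * energy k b c θ l)) := le_mul_of_one_le_left
            (mul_nonneg (by linarith) (mul_nonneg (by linarith) (hen _))) hC1
        _ = _ := by ring
  · rcases h1.lt_or_eq with h3 | h3
    · obtain ⟨j, rfl⟩ := Nat.exists_eq_add_of_le' (by omega : 1 ≤ i)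
      have c1 := core j (by omega) (by omega)
      have t1 := h.energy_succ_le hk hθk (i := j) (by omega)
      calc energy k b c θ (j + 1) ≤ C * energy k b c θ j := t1
          _ ≤ C * (D * energy k b c θ (l + 1)) := by gcongr
          _ ≤ C * (D * (C * energy k b c θ l)) := by gcongr
          _ = _ := by ring
    · subst h3
      have hCD : C ≤ C ^ 2 * D := by
        have := le_mul_of_one_le_right (by linarith : 0 ≤ C)
          (one_le_mul_of_one_le_of_one_le hC1 hD1)
        linarith
      exact s1.trans (mul_le_mul_of_nonneg_right hCD (hen _))

end IsRun

/-- The difference of the square roots of the intersection numbers of a column. -/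
noncomputable def gapSeq (b c : ℕ → ℕ) (i : ℕ) : ℝ := √(b i : ℝ) - √(c i : ℝ)

/-- The possible absolute values of `gapSeq`. -/
noncomputable def gapSet (k : ℕ) : Finset ℝ :=
  (Finset.range (k + 1) ×ˢ Finset.range (k + 1)).image fun p => |√(p.1 : ℝ) - √(p.2 : ℝ)|

/-- A number separating the squares of the elements of `gapSet`. -/
structure GapSep (k : ℕ) (δ : ℝ) : Prop where
  pos : 0 < δ
  le_one : δ ≤ 1
  sep : ∀ y ∈ gapSet k, ∀ y' ∈ gapSet k, y < y' → y ^ 2 + 2 * δ ≤ y' ^ 2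

theorem exists_forall_pos_le {ι : Type*} (s : Finset ι) (f : ι → ℝ) :
    ∃ δ > 0, ∀ i ∈ s, 0 < f i → δ ≤ f i := by
  classical
  induction s using Finset.induction_on with
  | empty => exact ⟨1, one_pos, by simp⟩
  | insert i s _ ih =>
    obtain ⟨δ, h0, h1⟩ := ih
    by_cases hi : 0 < f i
    · refine ⟨min δ (f i), lt_min h0 hi, fun j hj hj0 => ?_⟩
      rcases Finset.mem_insert.1 hj with rfl | hj
      · exact min_le_right _ _
      · exact (min_le_left _ _).trans (h1 j hj hj0)
    · refine ⟨δ, h0, fun j hj hj0 => ?_⟩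
      rcases Finset.mem_insert.1 hj with rfl | hj
      · exact absurd hj0 hi
      · exact h1 j hj hj0

theorem gapSet_nonneg {k : ℕ} {y : ℝ} (hy : y ∈ gapSet k) : 0 ≤ y := by
  obtain ⟨p, _, rfl⟩ := Finset.mem_image.1 hy
  exact abs_nonneg _

theorem exists_gapSep (k : ℕ) : ∃ δ, GapSep k δ := by
  obtain ⟨δ, h0, h1⟩ := exists_forall_pos_le (gapSet k ×ˢ gapSet k)
    (fun p => (p.2 ^ 2 - p.1 ^ 2) / 2)
  refine ⟨min δ 1, lt_min h0 one_pos, min_le_right _ _, fun y hy y' hy' hlt => ?_⟩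
  have h2 := pow_lt_pow_left₀ hlt (gapSet_nonneg hy) two_ne_zero
  have h3 := h1 (y, y') (Finset.mk_mem_product hy hy') (by simp only; linarith)
  have h4 := min_le_left δ 1
  simp only at h3
  linarith

namespace IArray

variable {k d : ℕ} {b c : ℕ → ℕ}

theorem gapSeq_anti (h : IArray k d b c) {i j : ℕ} (hij : i ≤ j) (hj : j ≤ d) :
    gapSeq b c j ≤ gapSeq b c i := by
  have h1 : (b j : ℝ) ≤ b i := by exact_mod_cast h.b_anti i j hij hj
  have h2 : (c i : ℝ) ≤ c j := by exact_mod_cast h.c_mono i j hij hj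
  exact sub_le_sub (Real.sqrt_le_sqrt h1) (Real.sqrt_le_sqrt h2)

theorem abs_gapSeq_mem (h : IArray k d b c) {i : ℕ} (hi : i ≤ d) : |gapSeq b c i| ∈ gapSet k := by
  refine Finset.mem_image.2 ⟨(b i, c i), ?_, rfl⟩
  have h1 := h.b_le hi
  have h2 := h.c_le hi
  simp only [Finset.mem_product, Finset.mem_range]
  omega

theorem eq_of_gapSeq_eq (h : IArray k d b c) {i j : ℕ} (hij : i ≤ j) (hj : j ≤ d)
    (he : gapSeq b c i = gapSeq b c j) : b i = b j ∧ c i = c j := by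
  have h1 : (b j : ℝ) ≤ b i := by exact_mod_cast h.b_anti i j hij hj
  have h2 : (c i : ℝ) ≤ c j := by exact_mod_cast h.c_mono i j hij hj
  have h3 := Real.sqrt_le_sqrt h1
  have h4 := Real.sqrt_le_sqrt h2
  unfold gapSeq at he
  have h5 : √(b i : ℝ) = √(b j : ℝ) := by linarith
  have h6 : √(c i : ℝ) = √(c j : ℝ) := by linarith
  rw [Real.sqrt_inj (by positivity) (by positivity)] at h5 h6
  exact ⟨by exact_mod_cast h5, by exact_mod_cast h6⟩

/-- The reflection inequality for `gapSeq`. -/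
theorem neg_gapSeq_le (h : IArray k d b c) {i : ℕ} (hi : i ≤ d) :
    -gapSeq b c i ≤ gapSeq b c (d - i) := by
  have h1 : (c i : ℝ) ≤ b (d - i) := by exact_mod_cast h.c_le_b (d - i) i (by omega)
  have h2 : (c (d - i) : ℝ) ≤ b i := by exact_mod_cast h.c_le_b i (d - i) (by omega)
  have h3 := Real.sqrt_le_sqrt h1
  have h4 := Real.sqrt_le_sqrt h2
  unfold gapSeq
  linarith

theorem diagSeq_eq (k : ℕ) (b c : ℕ → ℕ) (i : ℕ) :
    diagSeq k b c i = k - gapSeq b c i ^ 2 - 2 * √(b i * c i : ℝ) := by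
  rw [diagSeq, gapSeq, sub_sq, Real.sq_sqrt (by positivity), Real.sq_sqrt (by positivity),
    Real.sqrt_mul (by positivity)]
  ring

theorem gapSeq_zero (h : IArray k d b c) : gapSeq b c 0 = √(k : ℝ) := by
  simp [gapSeq, h.b_zero, h.c_zero]

end IArray

/-- The positions at which `gapSeq` crosses the levels `ξ` and `-ξ`. -/
structure Level (d : ℕ) (b c : ℕ → ℕ) (ξ : ℝ) (P A B q : ℕ) : Prop where
  hPA : P ≤ A
  hAB : A ≤ B
  hBq : B ≤ q
  hqd : q ≤ d
  lt_P : ∀ i < d, i < P ↔ ξ < gapSeq b c i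
  lt_A : ∀ i < d, i < A ↔ ξ ≤ gapSeq b c i
  lt_B : ∀ i < d, i < B ↔ ξ ≤ gapSeq b c i ∨ -ξ < gapSeq b c i
  lt_q : ∀ i < d, i < q ↔ -ξ ≤ gapSeq b c i

theorem exists_lt_iff {d : ℕ} {p : ℕ → Prop} (hp : ∀ i j, i ≤ j → j < d → p j → p i) :
    ∃ m ≤ d, ∀ i < d, i < m ↔ p i := by
  classical
  have hex : ∃ m, m = d ∨ ¬ p m := ⟨d, Or.inl rfl⟩
  refine ⟨Nat.find hex, Nat.find_min' hex (Or.inl rfl), fun i hi => ⟨fun h => ?_, fun h => ?_⟩⟩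
  · have := Nat.find_min hex h
    push Not at this
    exact this.2
  · by_contra hle
    push Not at hle
    rcases Nat.find_spec hex with h1 | h1
    · omega
    · exact h1 (hp _ i hle hi h)

theorem IArray.exists_level {k d : ℕ} {b c : ℕ → ℕ} (h : IArray k d b c) {ξ : ℝ} (hξ : 0 ≤ ξ) :
    ∃ P A B q, Level d b c ξ P A B q := by
  obtain ⟨P, hP, hP'⟩ := exists_lt_iff (d := d) (p := fun i => ξ < gapSeq b c i)
    fun i j hij hj hp => hp.trans_le (h.gapSeq_anti hij hj.le)
  obtain ⟨A, hA, hA'⟩ := exists_lt_iff (d := d) (p := fun i => ξ ≤ gapSeq b c i)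
    fun i j hij hj hp => hp.trans (h.gapSeq_anti hij hj.le)
  obtain ⟨B, hB, hB'⟩ := exists_lt_iff (d := d) (p := fun i => ξ ≤ gapSeq b c i ∨ -ξ < gapSeq b c i)
    fun i j hij hj hp => hp.imp (fun hp => hp.trans (h.gapSeq_anti hij hj.le))
      (fun hp => hp.trans_le (h.gapSeq_anti hij hj.le))
  obtain ⟨q, hq, hq'⟩ := exists_lt_iff (d := d) (p := fun i => -ξ ≤ gapSeq b c i)
    fun i j hij hj hp => hp.trans (h.gapSeq_anti hij hj.le)
  have mono : ∀ {m n : ℕ} {p r : ℕ → Prop}, m ≤ d → (∀ i < d, i < m ↔ p i) →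
      (∀ i < d, i < n ↔ r i) → (∀ i, p i → r i) → m ≤ n := by
    intro m n p r hm h1 h2 h3
    by_contra hlt
    push Not at hlt
    have := (h2 n (by omega)).2 (h3 n ((h1 n (by omega)).1 hlt))
    omega
  exact ⟨P, A, B, q, mono hP hP' hA' fun i hi => hi.le, mono hA hA' hB' fun i hi => Or.inl hi,
    mono hB hB' hq' fun i hi => hi.elim (fun hi => by linarith) fun hi => hi.le, hq,
    hP', hA', hB', hq'⟩

namespace Level

variable {k d : ℕ} {b c : ℕ → ℕ} {ξ : ℝ} {P A B q : ℕ}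

theorem gap_left (hv : Level d b c ξ P A B q) {i : ℕ} (h1 : P ≤ i) (h2 : i < A) :
    gapSeq b c i = ξ := by
  have := hv.hAB; have := hv.hBq; have := hv.hqd
  have h3 := (hv.lt_A i (by omega)).1 h2
  have h4 := mt (hv.lt_P i (by omega)).2 (by omega)
  linarith

theorem gap_right (hv : Level d b c ξ P A B q) {i : ℕ} (h1 : B ≤ i) (h2 : i < q) :
    gapSeq b c i = -ξ := by
  have := hv.hqd
  have h3 := (hv.lt_q i (by omega)).1 h2
  have h4 := mt (hv.lt_B i (by omega)).2 (by omega)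
  push Not at h4
  linarith [h4.2]

theorem one_le_P (hv : Level d b c ξ P A B q) (h : IArray k d b c) (hk : 1 ≤ k) (hξ : ξ < √(k : ℝ)) :
    1 ≤ P := by
  rw [← h.gapSeq_zero] at hξ
  exact (hv.lt_P 0 (h.one_le_d hk)).2 hξ

theorem left_run (hv : Level d b c ξ P A B q) (h : IArray k d b c) :
    IsRun k d b c P A (k - ξ ^ 2 - 2 * √(b P * c P : ℝ)) (√(b P * c P : ℝ)) := by
  have := hv.hAB; have := hv.hBq; have := hv.hqd
  have key : ∀ i, P ≤ i → i < A → b P = b i ∧ c P = c i := fun i h1 h2 =>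
    h.eq_of_gapSeq_eq h1 (by omega) (by
      rw [hv.gap_left h1 h2, hv.gap_left le_rfl (h1.trans_lt h2)])
  refine ⟨by omega, fun i h1 h2 => ?_, fun i h1 h2 => ?_⟩
  · rw [IArray.diagSeq_eq, hv.gap_left h1 h2, (key i h1 h2).1, (key i h1 h2).2]
  · rw [coupSeq, (key i h1.le h2).2, (key (i - 1) (by omega) (by omega)).1]

theorem right_run (hv : Level d b c ξ P A B q) (h : IArray k d b c) :
    IsRun k d b c B q (k - ξ ^ 2 - 2 * √(b B * c B : ℝ)) (√(b B * c B : ℝ)) := by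
  have := hv.hqd
  have key : ∀ i, B ≤ i → i < q → b B = b i ∧ c B = c i := fun i h1 h2 =>
    h.eq_of_gapSeq_eq h1 (by omega) (by
      rw [hv.gap_right h1 h2, hv.gap_right le_rfl (h1.trans_lt h2)])
  refine ⟨by omega, fun i h1 h2 => ?_, fun i h1 h2 => ?_⟩
  · rw [IArray.diagSeq_eq, hv.gap_right h1 h2, (key i h1 h2).1, (key i h1 h2).2, neg_sq]
  · rw [coupSeq, (key i h1.le h2).2, (key (i - 1) (by omega) (by omega)).1]

theorem tail_le (hv : Level d b c ξ P A B q) (h : IArray k d b c) (hP : 1 ≤ P) : d ≤ q + P := by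
  have := hv.hPA; have := hv.hAB; have := hv.hBq
  rcases hv.hqd.lt_or_eq with h1 | h1
  · have h2 := mt (hv.lt_q q h1).2 (lt_irrefl q)
    have h3 := h.neg_gapSeq_le h1.le
    have h4 := (hv.lt_P (d - q) (by omega)).2 (by linarith)
    omega
  · omega

theorem half_le (hv : Level d b c ξ P A B q) (h : IArray k d b c) (hP : 1 ≤ P) : d ≤ B + A := by
  have := hv.hPA; have := hv.hAB; have := hv.hBq; have := hv.hqd
  rcases (show B ≤ d by omega).lt_or_eq with h1 | h1
  · have h2 := mt (hv.lt_B B h1).2 (lt_irrefl B)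
    push Not at h2
    have h3 := h.neg_gapSeq_le h1.le
    have h4 := (hv.lt_A (d - B) (by omega)).2 (by linarith)
    omega
  · omega

/-- A long right run is the reflection of the left run. -/
theorem swap (hv : Level d b c ξ P A B q) (h : IArray k d b c) (hP : 1 ≤ P) (hN : B + P < q) :
    P < A ∧ √(b B * c B : ℝ) = √(b P * c P : ℝ) := by
  have h1 := hv.hPA; have h2 := hv.hAB; have h3 := hv.hBq; have h4 := hv.hqd
  have e1 := hv.gap_right le_rfl (by omega : B < q)
  have e2 := h.neg_gapSeq_le (by omega : B ≤ d)
  have e3 := (hv.lt_A (d - B) (by omega)).2 (by linarith)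
  have e4 := hv.gap_left (by omega : P ≤ d - B) e3
  have e5 := h.eq_of_gapSeq_eq (by omega : P ≤ d - B) (by omega)
    ((hv.gap_left le_rfl (by omega)).trans e4.symm)
  have f1 : (c B : ℝ) ≤ b P := by rw [e5.1]; exact_mod_cast h.c_le_b (d - B) B (by omega)
  have f2 : (c P : ℝ) ≤ b B := by rw [e5.2]; exact_mod_cast h.c_le_b B (d - B) (by omega)
  have g1 := Real.sqrt_le_sqrt f1
  have g2 := Real.sqrt_le_sqrt f2
  have e6 := hv.gap_left le_rfl (by omega : P < A)
  unfold gapSeq at e1 e6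
  refine ⟨by omega, ?_⟩
  rw [Real.sqrt_mul (by positivity), Real.sqrt_mul (by positivity),
    show √(c B : ℝ) = √(b P : ℝ) by linarith, show √(b B : ℝ) = √(c P : ℝ) by linarith, mul_comm]

theorem coup_bounds (h : IArray k d b c) {i : ℕ} (h1 : 1 ≤ i) (h2 : i < d) :
    1 ≤ √(b i * c i : ℝ) ∧ √(b i * c i : ℝ) ≤ k := by
  constructor
  · rw [Real.one_le_sqrt]
    exact_mod_cast Nat.mul_le_mul (h.b_pos i h2) (h.c_pos i h1 h2.le)
  · rw [Real.sqrt_le_left (by positivity), sq]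
    exact_mod_cast Nat.mul_le_mul (h.b_le h2.le) (h.c_le h2.le)

end Level

namespace Level

variable {k d : ℕ} {b c : ℕ → ℕ} {ξ δ θ : ℝ} {P A B q : ℕ}

theorem GapSep.sq_le (hs : GapSep k δ) (h : IArray k d b c) (hξ : ξ ∈ gapSet k) {i : ℕ}
    (hi : i ≤ d) (hlt : ξ < |gapSeq b c i|) : ξ ^ 2 + 2 * δ ≤ gapSeq b c i ^ 2 := by
  rw [← sq_abs (gapSeq b c i)]
  exact hs.sep _ hξ _ (h.abs_gapSeq_mem hi) hlt

theorem rate_bounds (hk : 1 ≤ k) (hδ : 0 < δ) (hδ1 : δ ≤ 1) :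
    (1 + δ / (3 * k)) ^ 2 ≤ 1 + 1 / (k : ℝ) ∧ (δ / (3 * k)) ^ 2 * k ≤ δ := by
  have hk' : (1 : ℝ) ≤ k := by exact_mod_cast hk
  have h1 : 0 < δ / (3 * k) := by positivity
  have h2 : δ / (3 * k) * k = δ / 3 := by field_simp
  have h4 : δ / (3 * k) ≤ 1 := by rw [div_le_one (by positivity)]; linarith
  have h3 : 1 / (k : ℝ) * k = 1 := by field_simp
  have h5 : 3 * (δ / (3 * k)) ≤ 1 / k := by
    rw [le_div_iff₀ (by linarith)]; linarith
  constructor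
  · nlinarith
  · rw [sq, mul_assoc, h2]; nlinarith

private theorem rate_mul_le (hk : 1 ≤ k) (hδ : 0 < δ) (hδ1 : δ ≤ 1) {m n : ℕ} (hmn : m < n)
    (hn : n ≤ k) : (1 + δ / (3 * k)) ^ 2 * (m : ℝ) ≤ n := by
  have hk' : (1 : ℝ) ≤ k := by exact_mod_cast hk
  have h1 := (rate_bounds hk hδ hδ1).1
  have h2 : (m : ℝ) + 1 ≤ n := by exact_mod_cast hmn
  have h3 : (m : ℝ) ≤ k := by exact_mod_cast (by omega : m ≤ k)
  have h4 : 1 / (k : ℝ) * m ≤ 1 := by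
    rw [one_div, inv_mul_le_iff₀ (by linarith)]; linarith
  have h5 : (1 + δ / (3 * k)) ^ 2 * (m : ℝ) ≤ (1 + 1 / (k : ℝ)) * m := by gcongr
  linarith

private theorem rate_sqrt_le (hk : 1 ≤ k) (hδ : 0 < δ) (hδ1 : δ ≤ 1) {m n : ℕ} (hm : m ≤ k)
    (hn : n ≤ k) : (δ / (3 * k)) ^ 2 * √(m * n : ℝ) ≤ δ := by
  have h1 := (rate_bounds hk hδ hδ1).2
  have h2 : √(m * n : ℝ) ≤ k := by
    rw [Real.sqrt_le_left (by positivity), sq]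
    exact_mod_cast Nat.mul_le_mul hm hn
  exact (mul_le_mul_of_nonneg_left h2 (by positivity)).trans h1

theorem stdSeq_pos (hv : Level d b c ξ P A B q) (h : IArray k d b c) (hk : 1 ≤ k)
    (hs : GapSep k δ) (hξ : ξ ∈ gapSet k) (hP : 1 ≤ P) (hθ : k - ξ ^ 2 - δ ≤ θ) :
    (∀ i < P, 0 < stdSeq k b c θ i) ∧
      ∀ i, i + 1 < P → (1 + δ / (3 * k)) * stdSeq k b c θ i ≤ stdSeq k b c θ (i + 1) := by
  have h0 : stdSeq k b c θ 0 = 1 := by simp [stdSeq, triSeq]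
  rcases hP.eq_or_lt with rfl | hP
  · refine ⟨fun i hi => ?_, fun i hi => by omega⟩
    obtain rfl : i = 0 := by omega
    rw [h0]; exact one_pos
  obtain ⟨p, rfl⟩ := Nat.exists_eq_add_of_le' hP.le
  have := hv.hPA; have := hv.hAB; have := hv.hBq; have := hv.hqd
  have hgap := (hv.lt_P p (by omega)).1 (by omega)
  have hξ0 := gapSet_nonneg hξ
  have hgap2 := GapSep.sq_le hs h hξ (by omega : p ≤ d) (hgap.trans_le (le_abs_self _))
  have hlt : c p < b p := by
    by_contra hle
    have : (b p : ℝ) ≤ c p := by exact_mod_cast not_lt.1 hle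
    have := Real.sqrt_le_sqrt this
    unfold gapSeq at hgap
    linarith
  have hbk := h.b_le (by omega : p ≤ d)
  have hck := h.c_le (by omega : p ≤ d)
  have key := initial_growth (k := k) (θ := θ) (δ := δ) (c₀ := δ / (3 * k)) (b := fun i => b i)
    (c := fun i => c i) (γ := coupSeq b c) (v := stdSeq k b c θ) (p := p)
    (fun i hi => by exact_mod_cast h.b_anti i p hi (by omega)) (fun i _ => by positivity)
    (fun i hi => by exact_mod_cast h.c_mono i p hi (by omega)) h.coupSeq_zero
    (fun i _ => IArray.coupSeq_sq b c i)
    (fun i hi => lt_of_lt_of_le one_pos (h.one_le_coupSeq (by omega) (by omega)))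
    (fun i hi => h.stdSeq_rec θ (by omega)) (by rw [h0]; exact one_pos)
    (by exact_mod_cast h.c_pos p (by omega) (by omega))
    (div_nonneg hs.pos.le (by positivity))
    (rate_mul_le hk hs.pos hs.le_one hlt hbk) (rate_sqrt_le hk hs.pos hs.le_one hbk hck)
    (by have : gapSeq b c p = √(b p : ℝ) - √(c p : ℝ) := rfl
        rw [← this]; linarith)
  exact ⟨fun i hi => key.1 i (by omega), fun i hi => key.2.1 i (by omega)⟩

/-- Beyond the level `-ξ` the standard sequence of an eigenvalue decays. -/
theorem sq_stdSeq_tail_le (hv : Level d b c ξ P A B q) (h : IArray k d b c) (hk : 1 ≤ k)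
    (hs : GapSep k δ) (hξ : ξ ∈ gapSet k) (hP : 1 ≤ P) (hθ : k - ξ ^ 2 - δ ≤ θ)
    (hθs : θ ∈ spec k d b c) {i : ℕ} (hi : q ≤ i) (hid : i ≤ d) :
    stdSeq k b c θ i ^ 2 ≤ stdSeq k b c θ q ^ 2 := by
  have := hv.hPA; have := hv.hAB; have := hv.hBq
  rcases hv.hqd.eq_or_lt with rfl | hqd
  · obtain rfl : i = q := by omega
    rfl
  have hgap := mt (hv.lt_q q hqd).2 (lt_irrefl q)
  push Not at hgap
  have hξ0 := gapSet_nonneg hξ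
  have hgap2 := GapSep.sq_le hs h hξ hqd.le
    (lt_of_lt_of_le (by linarith) (neg_le_abs (gapSeq b c q)))
  have hlt : b q < c q := by
    by_contra hle
    have : (c q : ℝ) ≤ b q := by exact_mod_cast not_lt.1 hle
    have := Real.sqrt_le_sqrt this
    unfold gapSeq at hgap
    linarith
  have hbk := h.b_le hqd.le
  have hck := h.c_le hqd.le
  set α' : ℕ → ℝ := fun i => diagSeq k b c (d - i) with hα'
  set γ' : ℕ → ℝ := fun i => coupSeq b c (d + 1 - i) with hγ'
  have hcoup : Coupling γ' d :=
    { zero := h.coupling.last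
      last := by simp only [hγ', Nat.sub_self]; exact h.coupSeq_zero
      pos := fun j h1 h2 => h.coupling.pos _ (by omega) (by omega) }
  have heig : TriEig α' γ' d θ fun i => stdSeq k b c θ (d - i) := by
    intro j hj
    have e := triEig_triSeq h.coupling ((mem_triSpecF h.coupling).1 hθs) (d - j) (by omega)
    simp only [hα', hγ', stdSeq]
    rcases Nat.eq_zero_or_pos j with rfl | hj0
    · simp only [Nat.sub_zero, zero_add, Nat.add_sub_cancel, h.coupling.last] at e ⊢
      linarith
    · rw [show d + 1 - (j + 1) = d - j by omega, show d - (j + 1) = d - j - 1 by omega,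
        show d + 1 - j = d - j + 1 by omega, show d - (j - 1) = d - j + 1 by omega]
      linarith
  have hmul := heig.eq_mul_triSeq hcoup
  have e0 : (0 : ℕ) < q := by omega
  have key := initial_growth (k := k) (θ := θ) (δ := δ) (c₀ := δ / (3 * k))
    (b := fun i => c (d - i)) (c := fun i => b (d - i)) (γ := γ') (v := triSeq α' γ' θ) (p := d - q)
    (fun i hi => by exact_mod_cast h.c_mono (d - (d - q)) (d - i) (by omega) (by omega))
    (fun i _ => by positivity)
    (fun i hi => by exact_mod_cast h.b_anti (d - (d - q)) (d - i) (by omega) (by omega))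
    hcoup.zero
    (fun i hi => by
      have := IArray.coupSeq_sq b c (d - (i + 1))
      simp only [hγ']
      rw [show d + 1 - (i + 1) = d - (i + 1) + 1 by omega, this,
        show d - (i + 1) + 1 = d - i by omega, mul_comm])
    (fun i hi => hcoup.pos _ (by omega) (by omega))
    (fun i hi => by
      have := triSeq_rec (α := α') hcoup θ (i := i) (by omega)
      rw [this]
      simp only [hα', diagSeq]
      ring)
    (by simp [triSeq])
    (by rw [Nat.sub_sub_self hqd.le]; exact_mod_cast h.b_pos q hqd)
    (div_nonneg hs.pos.le (by positivity))
    (by rw [Nat.sub_sub_self hqd.le]; exact rate_mul_le hk hs.pos hs.le_one hlt hck)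
    (by rw [Nat.sub_sub_self hqd.le]; exact rate_sqrt_le hk hs.pos hs.le_one hck hbk)
    (by
      rw [Nat.sub_sub_self hqd.le]
      have : (√(c q : ℝ) - √(b q : ℝ)) ^ 2 = gapSeq b c q ^ 2 := by unfold gapSeq; ring
      rw [this]; linarith)
  have hmono : ∀ n ≤ d - q, ∀ m ≤ n, triSeq α' γ' θ m ≤ triSeq α' γ' θ n := by
    intro n hn m hm
    induction n, hm using Nat.le_induction with
    | base => rfl
    | succ n hmn ih =>
      refine (ih (by omega)).trans (le_trans ?_ (key.2.1 n (by omega)))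
      refine le_mul_of_one_le_left (key.1 n (by omega)).le ?_
      have := hs.pos
      have : 0 ≤ δ / (3 * k) := by positivity
      linarith
  have e1 := hmul (d - i) (by omega)
  have e2 := hmul (d - q) (by omega)
  simp only [Nat.sub_sub_self hid, Nat.sub_sub_self hqd.le] at e1 e2
  rw [e1, e2, mul_pow, mul_pow]
  exact mul_le_mul_of_nonneg_left (pow_le_pow_left₀ (key.1 _ (by omega)).le
    (hmono _ le_rfl _ (by omega)) 2) (sq_nonneg _)

theorem energy_initial_le (hv : Level d b c ξ P A B q) (h : IArray k d b c) (hk : 1 ≤ k)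
    (hs : GapSep k δ) (hξ : ξ ∈ gapSet k) (hP : 1 ≤ P) (hθ : k - ξ ^ 2 - δ ≤ θ) {i : ℕ}
    (hi : i < P) : energy k b c θ i ≤ 2 * energy k b c θ (P - 1) := by
  obtain ⟨h1, h2⟩ := hv.stdSeq_pos h hk hs hξ hP hθ
  have hmono : ∀ n < P, ∀ m ≤ n, stdSeq k b c θ m ≤ stdSeq k b c θ n := by
    intro n hn m hm
    induction n, hm using Nat.le_induction with
    | base => rfl
    | succ n hmn ih =>
      refine (ih (by omega)).trans (le_trans ?_ (h2 n hn))
      refine le_mul_of_one_le_left (h1 n (by omega)).le ?_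
      have := hs.pos
      have : 0 ≤ δ / (3 * k) := by positivity
      linarith
  rcases (show i ≤ P - 1 by omega).lt_or_eq with h3 | rfl
  · have e1 := pow_le_pow_left₀ (h1 i hi).le (hmono (P - 1) (by omega) i (by omega)) 2
    have e2 := pow_le_pow_left₀ (h1 (i + 1) (by omega)).le
      (hmono (P - 1) (by omega) (i + 1) (by omega)) 2
    have e3 := sq_nonneg (stdSeq k b c θ (P - 1 + 1))
    unfold energy
    linarith
  · linarith [energy_nonneg k b c θ (P - 1)]

end Level

section

variable {k d : ℕ} {b c : ℕ → ℕ} {ξ δ θ : ℝ} {P A B q : ℕ}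

/-- The comparability constant of the energies along a run. -/
noncomputable def runConst (k : ℕ) (δ : ℝ) : ℝ := (6 * (k : ℝ) ^ 2) ^ 2 * (4 * k / δ)

theorem one_le_runConst (hk : 1 ≤ k) (hδ : 0 < δ) (hδ1 : δ ≤ 1) : 1 ≤ runConst k δ := by
  have hk' : (1 : ℝ) ≤ k := by exact_mod_cast hk
  refine one_le_mul_of_one_le_of_one_le (one_le_pow₀ (by nlinarith)) ?_
  rw [one_le_div hδ]; linarith

theorem IsRun.energy_comparable' {l L : ℕ} {a β : ℝ} (hr : IsRun k d b c l L a β)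
    (h : IArray k d b c) (hk : 1 ≤ k) (hβ : l < L → 1 ≤ β ∧ β ≤ k) (hδ : 0 < δ) (hδ1 : δ ≤ 1)
    (hθk : |θ| ≤ k) (hθ : l < L → |θ - a| ≤ 2 * β - δ) (hl : 1 ≤ l) (hlL : l ≤ L) {i : ℕ}
    (hi : l ≤ i + 1) (hiL : i + 1 ≤ L) :
    energy k b c θ i ≤ runConst k δ * energy k b c θ (l - 1) ∧
      energy k b c θ (l - 1) ≤ runConst k δ * energy k b c θ i := by
  have hLd := hr.le
  rcases hlL.lt_or_eq with h1 | h1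
  · exact hr.energy_comparable h hk (hβ h1).1 (hβ h1).2 hδ hδ1 hθk (hθ h1) hl hi
      (hiL.trans (le_max_right _ _)) (by omega)
  · obtain rfl : i = l - 1 := by omega
    have := le_mul_of_one_le_left (energy_nonneg k b c θ (l - 1)) (one_le_runConst hk hδ hδ1)
    exact ⟨this, this⟩

theorem IsRun.energy_le_of_closed_band' {l L : ℕ} {a β : ℝ} (hr : IsRun k d b c l L a β)
    (h : IArray k d b c) (hk : 1 ≤ k) (hβ : l < L → 1 ≤ β) (hθk : |θ| ≤ k)
    (hθ : l < L → |θ - a| ≤ 2 * β) (hl : 1 ≤ l) (hlL : l ≤ L) {i : ℕ}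
    (hi : l ≤ i + 1) (hiL : i + 1 ≤ L) :
    energy k b c θ i ≤ (6 * (k : ℝ) ^ 2) ^ 2 * (18 * (d : ℝ) ^ 2) * energy k b c θ (l - 1) := by
  have hLd := hr.le
  rcases hlL.lt_or_eq with h1 | h1
  · exact hr.energy_le_of_closed_band h hk (hβ h1) hθk (hθ h1) hl hi
      (hiL.trans (le_max_right _ _)) (by omega)
  · obtain rfl : i = l - 1 := by omega
    have hk' : (1 : ℝ) ≤ k := by exact_mod_cast hk
    have hd' : (1 : ℝ) ≤ d := by exact_mod_cast h.one_le_d hk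
    exact le_mul_of_one_le_left (energy_nonneg k b c θ (l - 1))
      (one_le_mul_of_one_le_of_one_le (one_le_pow₀ (by nlinarith)) (by nlinarith))

namespace Level

theorem energy_le_of_runs (hv : Level d b c ξ P A B q) (h : IArray k d b c) (hk : 1 ≤ k)
    (hθk : |θ| ≤ k) (hP : 1 ≤ P) {G₁ G₂ : ℝ} (hG₁ : 1 ≤ G₁) (hG₂ : 1 ≤ G₂)
    (hl : ∀ i, P ≤ i + 1 → i + 1 ≤ A → energy k b c θ i ≤ G₁ * energy k b c θ (P - 1))
    (hr : ∀ i, B ≤ i + 1 → i + 1 ≤ q → energy k b c θ i ≤ G₂ * energy k b c θ (B - 1)) {i : ℕ}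
    (hi : P ≤ i + 1) (hiq : i < q) :
    energy k b c θ i ≤ G₂ * ((6 * (k : ℝ) ^ 2) ^ (B - A) * (G₁ * energy k b c θ (P - 1))) := by
  have := hv.hPA; have := hv.hAB; have := hv.hBq; have := hv.hqd
  have hk' : (1 : ℝ) ≤ k := by exact_mod_cast hk
  have hC1 : (1 : ℝ) ≤ (6 * (k : ℝ) ^ 2) ^ (B - A) := one_le_pow₀ (by nlinarith)
  have hE := energy_nonneg k b c θ
  have m1 : ∀ j, P ≤ j + 1 → j + 1 ≤ A →
      energy k b c θ j ≤ (6 * (k : ℝ) ^ 2) ^ (B - A) * (G₁ * energy k b c θ (P - 1)) :=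
    fun j h1 h2 => (hl j h1 h2).trans
      (le_mul_of_one_le_left (mul_nonneg (by linarith) (hE _)) hC1)
  have m2 : ∀ j, A ≤ j + 1 → j + 1 ≤ B →
      energy k b c θ j ≤ (6 * (k : ℝ) ^ 2) ^ (B - A) * (G₁ * energy k b c θ (P - 1)) :=
    fun j h1 h2 => (h.energy_le_pow hk hθk (i := A - 1) (j := j) (n := B - A) (by omega) (by omega)
      (by omega)).trans (mul_le_mul_of_nonneg_left (hl (A - 1) (by omega) (by omega)) (by linarith))
  have m12 : ∀ j, P ≤ j + 1 → j + 1 ≤ B →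
      energy k b c θ j ≤ (6 * (k : ℝ) ^ 2) ^ (B - A) * (G₁ * energy k b c θ (P - 1)) := by
    intro j h1 h2
    rcases Nat.le_total (j + 1) A with h3 | h3
    · exact m1 j h1 h3
    · exact m2 j h3 h2
  have hM : 0 ≤ (6 * (k : ℝ) ^ 2) ^ (B - A) * (G₁ * energy k b c θ (P - 1)) :=
    mul_nonneg (by linarith) (mul_nonneg (by linarith) (hE _))
  rcases Nat.le_total (i + 1) B with h3 | h3
  · exact (m12 i hi h3).trans (le_mul_of_one_le_left hM hG₂)
  · exact (hr i h3 (by omega)).trans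
      (mul_le_mul_of_nonneg_left (m12 (B - 1) (by omega) (by omega)) (by linarith))

/-- The interval just below the edge of the band of the level `ξ`. -/
structure Top (k : ℕ) (ξ δ θ : ℝ) : Prop where
  abs_le : |θ| ≤ k
  lower : k - ξ ^ 2 - δ ≤ θ
  upper : θ ≤ k - ξ ^ 2 - δ / 2

theorem Top.band (ht : Top k ξ δ θ) (hδ1 : δ ≤ 1) {β : ℝ} (hβ : 1 ≤ β) :
    |θ - (k - ξ ^ 2 - 2 * β)| ≤ 2 * β - δ / 2 := by
  have := ht.lower; have := ht.upper
  exact _root_.abs_le.2 ⟨by linarith, by linarith⟩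

theorem left_comparable (hv : Level d b c ξ P A B q) (h : IArray k d b c) (hk : 1 ≤ k)
    (hs : GapSep k δ) (hP : 1 ≤ P) (ht : Top k ξ δ θ) {i : ℕ} (hi : P ≤ i + 1) (hiL : i + 1 ≤ A) :
    energy k b c θ i ≤ runConst k (δ / 2) * energy k b c θ (P - 1) ∧
      energy k b c θ (P - 1) ≤ runConst k (δ / 2) * energy k b c θ i := by
  have := hv.hAB; have := hv.hBq; have := hv.hqd; have := hs.pos; have := hs.le_one
  exact (hv.left_run h).energy_comparable' h hk (fun hlt => coup_bounds h hP (by omega))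
    (by linarith) (by linarith) ht.abs_le
    (fun hlt => ht.band hs.le_one (coup_bounds h hP (by omega)).1) hP hv.hPA hi hiL

theorem right_comparable (hv : Level d b c ξ P A B q) (h : IArray k d b c) (hk : 1 ≤ k)
    (hs : GapSep k δ) (hP : 1 ≤ P) (ht : Top k ξ δ θ) {i : ℕ} (hi : B ≤ i + 1) (hiL : i + 1 ≤ q) :
    energy k b c θ i ≤ runConst k (δ / 2) * energy k b c θ (B - 1) := by
  have := hv.hAB; have := hv.hPA; have := hv.hqd; have := hs.pos; have := hs.le_one
  exact ((hv.right_run h).energy_comparable' h hk (fun hlt => coup_bounds h (by omega) (by omega))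
    (by linarith) (by linarith) ht.abs_le
    (fun hlt => ht.band hs.le_one (coup_bounds h (by omega) (by omega)).1) (by omega) hv.hBq hi
      hiL).1

theorem sig_le_of_top (hv : Level d b c ξ P A B q) (h : IArray k d b c) (hk : 1 ≤ k)
    (hs : GapSep k δ) (hξ : ξ ∈ gapSet k) (hP : 1 ≤ P) (ht : Top k ξ δ θ)
    (hθs : θ ∈ spec k d b c) :
    sig k d b c θ ≤ d * (2 * runConst k (δ / 2) ^ 2 * (6 * (k : ℝ) ^ 2) ^ (B - A) *
      energy k b c θ (P - 1)) := by
  have := hv.hPA; have := hv.hAB; have := hv.hBq; have := hv.hqd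
  have hk' : (1 : ℝ) ≤ k := by exact_mod_cast hk
  have hC1 : (1 : ℝ) ≤ (6 * (k : ℝ) ^ 2) ^ (B - A) := one_le_pow₀ (by nlinarith)
  have hR := one_le_runConst (δ := δ / 2) hk (by linarith [hs.pos]) (by linarith [hs.pos, hs.le_one])
  have hE := energy_nonneg k b c θ
  have main := fun i => hv.energy_le_of_runs h hk ht.abs_le hP hR hR
    (fun i h1 h2 => (hv.left_comparable h hk hs hP ht h1 h2).1)
    (fun i h1 h2 => hv.right_comparable h hk hs hP ht h1 h2) (i := i)
  set R := runConst k (δ / 2)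
  set X := R * ((6 * (k : ℝ) ^ 2) ^ (B - A) * (R * energy k b c θ (P - 1))) with hX
  have hEX : energy k b c θ (P - 1) ≤ X := main (P - 1) (by omega) (by omega)
  have all : ∀ i ∈ Finset.range d, energy k b c θ i ≤ 2 * X := by
    intro i hi
    rw [Finset.mem_range] at hi
    rcases Nat.lt_or_ge i P with h1 | h1
    · exact (hv.energy_initial_le h hk hs hξ hP ht.lower h1).trans (by linarith)
    rcases Nat.lt_or_ge i q with h2 | h2
    · have := main i (by omega) h2
      have := hE i
      linarith
    · have e1 := hv.sq_stdSeq_tail_le h hk hs hξ hP ht.lower hθs h2 hi.le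
      have e2 := hv.sq_stdSeq_tail_le h hk hs hξ hP ht.lower hθs (by omega : q ≤ i + 1) hi
      have e3 := main (q - 1) (by omega) (by omega)
      have e4 : stdSeq k b c θ q ^ 2 ≤ energy k b c θ (q - 1) := by
        rw [energy, Nat.sub_add_cancel (by omega)]
        linarith [sq_nonneg (stdSeq k b c θ (q - 1))]
      rw [energy]
      linarith
  calc sig k d b c θ ≤ _ := h.sig_le_sum_energy hk θ
    _ ≤ ∑ i ∈ Finset.range d, 2 * X := Finset.sum_le_sum all
    _ = _ := by rw [Finset.sum_const, Finset.card_range, nsmul_eq_mul, hX]; ring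

theorem le_sig_of_top (hv : Level d b c ξ P A B q) (h : IArray k d b c) (hk : 1 ≤ k)
    (hs : GapSep k δ) (hP : 1 ≤ P) (ht : Top k ξ δ θ) :
    ((A - P : ℕ) + 1) * energy k b c θ (P - 1) ≤ 2 * runConst k (δ / 2) * sig k d b c θ := by
  have := hv.hPA; have := hv.hAB; have := hv.hBq; have := hv.hqd
  have hR := one_le_runConst (δ := δ / 2) hk (by linarith [hs.pos]) (by linarith [hs.pos, hs.le_one])
  have h1 : ∑ _i ∈ Finset.Ico (P - 1) A, energy k b c θ (P - 1) ≤
      ∑ i ∈ Finset.Ico (P - 1) A, runConst k (δ / 2) * energy k b c θ i := by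
    refine Finset.sum_le_sum fun i hi => ?_
    rw [Finset.mem_Ico] at hi
    exact (hv.left_comparable h hk hs hP ht (by omega) (by omega)).2
  rw [Finset.sum_const, Nat.card_Ico, nsmul_eq_mul, ← Finset.mul_sum,
    show A - (P - 1) = A - P + 1 by omega] at h1
  have h2 := IArray.sum_energy_le (d := d) k b c θ (I := Finset.Ico (P - 1) A)
    fun i hi => by rw [Finset.mem_Ico] at hi; omega
  push_cast at h1
  have h3 := mul_le_mul_of_nonneg_left h2 (by linarith : 0 ≤ runConst k (δ / 2))
  linarith

theorem energy_le_sq (hv : Level d b c ξ P A B q) (h : IArray k d b c) (hk : 1 ≤ k)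
    (hs : GapSep k δ) (hξ : ξ ∈ gapSet k) (hP : 1 ≤ P) (hPd : P ≤ d) (ht : Top k ξ δ θ) :
    energy k b c θ (P - 1) ≤ 10 * (k : ℝ) ^ 2 * stdSeq k b c θ (P - 1) ^ 2 := by
  have hk' : (1 : ℝ) ≤ k := by exact_mod_cast hk
  rcases hP.eq_or_lt with rfl | hP1
  · have h0 : stdSeq k b c θ 0 = 1 := by simp [stdSeq, triSeq]
    have := h.energy_zero_le hk ht.abs_le
    rw [Nat.sub_self, h0]
    nlinarith
  obtain ⟨p, rfl⟩ := Nat.exists_eq_add_of_le' (by omega : 2 ≤ P)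
  obtain ⟨h1, h2⟩ := hv.stdSeq_pos h hk hs hξ hP ht.lower
  have hp0 := h1 p (by omega)
  have hp1 := h1 (p + 1) (by omega)
  have hp2 := h2 p (by omega)
  have h3 : stdSeq k b c θ p ≤ stdSeq k b c θ (p + 1) := by
    refine (le_mul_of_one_le_left hp0.le ?_).trans hp2
    have := hs.pos
    have : 0 ≤ δ / (3 * k) := by positivity
    linarith
  have e := h.stdSeq_rec θ (i := p + 1) (by omega)
  have g1 := h.one_le_coupSeq (i := p + 1 + 1) (by omega) (by omega)
  have g2 := h.coupSeq_le (i := p + 1) (by omega)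
  have g3 := IArray.coupSeq_nonneg b c (p + 1)
  have g4 := h.abs_sub_diagSeq_le ht.abs_le (i := p + 1) (by omega)
  rw [Nat.add_sub_cancel] at e
  have h5 : |stdSeq k b c θ (p + 1 + 1)| ≤ 3 * k * stdSeq k b c θ (p + 1) := by
    calc |stdSeq k b c θ (p + 1 + 1)|
        ≤ |coupSeq b c (p + 1 + 1) * stdSeq k b c θ (p + 1 + 1)| := by
          rw [abs_mul, abs_of_pos (by linarith : 0 < coupSeq b c (p + 1 + 1))]
          exact le_mul_of_one_le_left (abs_nonneg _) g1
      _ ≤ |(θ - diagSeq k b c (p + 1)) * stdSeq k b c θ (p + 1)| +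
          |coupSeq b c (p + 1) * stdSeq k b c θ p| := by rw [e]; exact abs_sub _ _
      _ ≤ 2 * k * stdSeq k b c θ (p + 1) + k * stdSeq k b c θ (p + 1) := by
          rw [abs_mul, abs_mul, abs_of_pos hp0, abs_of_pos hp1, abs_of_nonneg g3]
          gcongr
      _ = _ := by ring
  have h6 : stdSeq k b c θ (p + 1 + 1) ^ 2 ≤ (3 * k * stdSeq k b c θ (p + 1)) ^ 2 := by
    rw [← sq_abs]; exact pow_le_pow_left₀ (abs_nonneg _) h5 2
  rw [show p + 2 - 1 = p + 1 by omega, energy]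
  have h7 : 1 * stdSeq k b c θ (p + 1) ^ 2 ≤ (k : ℝ) ^ 2 * stdSeq k b c θ (p + 1) ^ 2 := by
    gcongr; nlinarith
  linarith

/-- Eigenvalues near the edge with equal norm of the standard sequence are close. -/
theorem pow_le_of_sig_eq (hv : Level d b c ξ P A B q) (h : IArray k d b c) (hk : 1 ≤ k)
    (hs : GapSep k δ) (hξ : ξ ∈ gapSet k) (hP : 1 ≤ P) {θ' : ℝ} (ht : Top k ξ δ θ)
    (ht' : Top k ξ δ θ') (hθs : θ ∈ spec k d b c) (hle : θ ≤ θ')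
    (hsig : sig k d b c θ = sig k d b c θ') :
    (1 + (θ' - θ) / k) ^ (2 * (P - 1)) ≤
      40 * (k : ℝ) ^ 2 * runConst k (δ / 2) ^ 3 * (6 * (k : ℝ) ^ 2) ^ (B - A) *
        (2 * P + (B - A : ℕ) + 2) := by
  have := hv.hPA; have := hv.hAB; have := hv.hBq; have := hv.hqd
  have hk' : (1 : ℝ) ≤ k := by exact_mod_cast hk
  have hR := one_le_runConst (δ := δ / 2) hk (by linarith [hs.pos]) (by linarith [hs.pos, hs.le_one])
  have u1 := hv.le_sig_of_top h hk hs hP ht'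
  have u2 := hv.sig_le_of_top h hk hs hξ hP ht hθs
  have u3 := hv.energy_le_sq h hk hs hξ hP (by omega) ht
  obtain ⟨h1, -⟩ := hv.stdSeq_pos h hk hs hξ hP ht.lower
  obtain ⟨h1', -⟩ := hv.stdSeq_pos h hk hs hξ hP ht'.lower
  have slope := growth_slope (θ := θ) (θ' := θ') (K := k) (α := diagSeq k b c) (γ := coupSeq b c)
    (v := stdSeq k b c θ) (v' := stdSeq k b c θ') (p := P - 1) h.coupSeq_zero
    (fun i hi => h.coupling.pos _ (by omega) (by omega))
    (fun i hi => h.stdSeq_rec θ (by omega)) (fun i hi => h.stdSeq_rec θ' (by omega))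
    (by simp [stdSeq, triSeq]) (by simp [stdSeq, triSeq]) (fun i hi => h1 i (by omega))
    (fun i hi => h1' i (by omega)) hle (by linarith)
    (fun i hi => by
      have := h.diagSeq_nonneg (i := i) (by omega)
      linarith [(abs_le.1 ht.abs_le).2]) (P - 1) le_rfl
  have hv0 := h1 (P - 1) (by omega)
  set R := runConst k (δ / 2)
  set C := (6 * (k : ℝ) ^ 2) ^ (B - A) with hC
  set w := stdSeq k b c θ (P - 1)
  set w' := stdSeq k b c θ' (P - 1)
  set E := energy k b c θ (P - 1)
  set E' := energy k b c θ' (P - 1) with hE'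
  set N := A - P with hN
  set K := B - A with hK
  have hC0 : 0 < C := by positivity
  have hE0 : 0 ≤ E := energy_nonneg k b c θ (P - 1)
  have hd : (d : ℝ) ≤ (2 * P + K + 2) * (N + 1) := by
    have : d ≤ 2 * P + 2 * N + K := by have := hv.half_le h hP; omega
    have : (d : ℝ) ≤ 2 * P + 2 * N + K := by exact_mod_cast this
    have h2 : (0 : ℝ) ≤ P * N := by positivity
    have h3 : (0 : ℝ) ≤ K * N := by positivity
    nlinarith
  have u4 : (N + 1 : ℝ) * E' ≤ (N + 1) * (4 * R ^ 3 * C * (2 * P + K + 2) * E) := by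
    rw [← hsig] at u1
    calc (N + 1 : ℝ) * E' ≤ 2 * R * sig k d b c θ := u1
      _ ≤ 2 * R * (d * (2 * R ^ 2 * C * E)) := by gcongr
      _ ≤ 2 * R * ((2 * P + K + 2) * (N + 1) * (2 * R ^ 2 * C * E)) := by gcongr
      _ = _ := by ring
  have u5 := le_of_mul_le_mul_left u4 (by positivity)
  have u6 : ((1 + (θ' - θ) / k) ^ (P - 1) * w) ^ 2 ≤ E' := by
    have h0 : 0 ≤ (θ' - θ) / k := div_nonneg (by linarith) (by linarith)
    refine (pow_le_pow_left₀ (by positivity) slope 2).trans ?_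
    rw [hE', energy]
    linarith [sq_nonneg (stdSeq k b c θ' (P - 1 + 1))]
  refine le_of_mul_le_mul_right ?_ (by positivity : 0 < w ^ 2)
  calc (1 + (θ' - θ) / k) ^ (2 * (P - 1)) * w ^ 2 = ((1 + (θ' - θ) / k) ^ (P - 1) * w) ^ 2 := by
        rw [mul_pow, ← pow_mul, mul_comm 2]
    _ ≤ E' := u6
    _ ≤ 4 * R ^ 3 * C * (2 * P + K + 2) * E := u5
    _ ≤ 4 * R ^ 3 * C * (2 * P + K + 2) * (10 * (k : ℝ) ^ 2 * w ^ 2) := by gcongr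
    _ = _ := by ring

end Level

end

/-- Eigenvalues are algebraic integers whose conjugates are eigenvalues of the same norm. -/
structure GaloisClosed (k d : ℕ) (b c : ℕ → ℕ) : Prop where
  abs_le : ∀ θ ∈ spec k d b c, |θ| ≤ k
  integral : ∀ θ ∈ spec k d b c, IsIntegral ℤ θ
  conj : ∀ θ ∈ spec k d b c, ∀ z : ℂ, Polynomial.aeval z (minpoly ℤ θ) = 0 →
    ∃ θ' ∈ spec k d b c, (θ' : ℂ) = z ∧ sig k d b c θ' = sig k d b c θ

theorem GaloisClosed.sig_eq {k d : ℕ} {b c : ℕ → ℕ} (hg : GaloisClosed k d b c) {θ θ' : ℝ}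
    (hθ' : θ' ∈ spec k d b c) (h : minpoly ℤ θ = minpoly ℤ θ') :
    sig k d b c θ = sig k d b c θ' := by
  obtain ⟨t, -, h2, h3⟩ := hg.conj θ' hθ' (θ : ℂ) (by
    rw [← h]
    have : Polynomial.aeval ((algebraMap ℝ ℂ) θ) (minpoly ℤ θ) = 0 := by
      rw [Polynomial.aeval_algebraMap_apply, minpoly.aeval, map_zero]
    exact this)
  rw [← h3, Complex.ofReal_injective h2]

/-- A set of eigenvalues determined by values of `sig` is closed under conjugation. -/
theorem GaloisClosed.conjIn {k d : ℕ} {b c : ℕ → ℕ} (hg : GaloisClosed k d b c) {S : Finset ℝ}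
    (hS : S ⊆ spec k d b c)
    (hsat : ∀ t ∈ S, ∀ t' ∈ spec k d b c, sig k d b c t' = sig k d b c t → t' ∈ S) {t : ℝ}
    (ht : t ∈ S) : ConjIn S t := by
  refine ⟨hg.integral t (hS ht), fun z hz => ?_⟩
  obtain ⟨t', h1, h2, h3⟩ := hg.conj t (hS ht) z hz
  exact ⟨t', hsat t ht t' h1 h3, h2⟩

namespace Level

variable {k : ℕ} {δ : ℝ}

open Classical in
theorem exists_card_top_lower (k : ℕ) (hk : 1 ≤ k) {ε : ℝ} (hε : 0 < ε) (hε1 : ε ≤ 1) :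
    ∃ m : ℕ, ∀ d b c, IArray k d b c → GaloisClosed k d b c → ∀ ξ P A B q,
      Level d b c ξ P A B q → 1 ≤ P → 1 ≤ (A - P) + (q - B) →
      (((A - P) + (q - B) : ℕ) : ℝ) ≤
        m * (((spec k d b c).filter fun t => Top k ξ ε t).card + 1) := by
  have hk' : (1 : ℝ) ≤ k := by exact_mod_cast hk
  obtain ⟨m, hm⟩ := exists_nat_ge (128 * (k : ℝ) ^ 3 / ε ^ 3)
  refine ⟨2 * (2 * (m + 1) + 2), fun d b c h hg ξ P A B q hv hP hn => ?_⟩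
  have := hv.hPA; have := hv.hAB; have := hv.hBq; have := hv.hqd
  have hm1 : 128 * (k : ℝ) ^ 3 / ε ^ 3 ≤ (m + 1 : ℕ) := by push_cast; linarith
  generalize m + 1 = m' at hm1
  have hm0 : 1 ≤ m' := by
    have : (0 : ℝ) < m' := lt_of_lt_of_le (by positivity) hm1
    exact_mod_cast this
  have key : ∀ l L : ℕ, IsRun k d b c l L (k - ξ ^ 2 - 2 * √(b l * c l : ℝ)) (√(b l * c l : ℝ)) →
      1 ≤ l → l < L →
      (L - l) / (2 * m' + 2) ≤ ((spec k d b c).filter fun t => Top k ξ ε t).card := by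
    intro l L hr hl hlL
    have hLd := hr.le
    obtain ⟨hβ1, hβk⟩ := coup_bounds h hl (by omega : l < d)
    set β : ℝ := √(b l * c l : ℝ) with hβ
    have hx1 : 3 * ε / (8 * β) ≤ 3 / 8 := by
      rw [div_le_div_iff₀ (by linarith) (by norm_num)]; nlinarith
    have hx0 : 3 * ε / (8 * k) ≤ 3 * ε / (8 * β) := by gcongr
    have hx2 : 0 < 3 * ε / (8 * k) := by positivity
    have hcos : Real.cos (Real.arccos (1 - 3 * ε / (8 * β))) = 1 - 3 * ε / (8 * β) :=
      Real.cos_arccos (by linarith) (by linarith)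
    have habs : |1 - 3 * ε / (8 * β)| = 1 - 3 * ε / (8 * β) := abs_of_nonneg (by linarith)
    refine (le_card_triSpecF_near_of_run h.coupling (a := k - ξ ^ 2 - 2 * β) (β := β)
      (φ := Real.arccos (1 - 3 * ε / (8 * β))) (ε := ε / 4) (by linarith) (l := l) (L := L - l)
      (by omega) (fun i h1 h2 => hr.diag i h1 (by omega)) (fun i h1 h2 => hr.coup i h1 (by omega))
      (m := m') (R := (L - l) / (2 * m' + 2)) hm0 (by rw [hcos, habs]; linarith) ?_
      (Nat.div_mul_le_self _ _)).trans ?_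
    · rw [hcos, habs]
      have e1 : 3 * (k : ℝ) ^ 2 = (ε / 4) ^ 2 * (128 * (k : ℝ) ^ 3 / ε ^ 3 * (3 * ε / (8 * k))) := by
        field_simp; norm_num
      calc 3 * β ^ 2 ≤ 3 * (k : ℝ) ^ 2 := by gcongr
        _ = _ := e1
        _ ≤ (ε / 4) ^ 2 * (m' * (1 - (1 - 3 * ε / (8 * β)))) := by
          gcongr
          linarith
    · refine Finset.card_le_card fun t ht => ?_
      rw [Finset.mem_filter] at ht ⊢
      have hab := hg.abs_le t ht.1
      have e : k - ξ ^ 2 - 2 * β + 2 * β * (1 - 3 * ε / (8 * β)) = k - ξ ^ 2 - 3 * ε / 4 := by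
        field_simp; ring
      rw [hcos, e, abs_le] at ht
      exact ⟨ht.1, hab, by linarith [ht.2.1], by linarith [ht.2.2]⟩
  set T := ((spec k d b c).filter fun t => Top k ξ ε t).card
  have fin : ∀ n L : ℕ, n ≤ 2 * L → L / (2 * m' + 2) ≤ T →
      (n : ℝ) ≤ (2 * (2 * m' + 2) : ℕ) * (T + 1) := by
    intro n L h1 h2
    have h3 := Nat.div_add_mod L (2 * m' + 2)
    have h4 := Nat.mod_lt L (show 0 < 2 * m' + 2 by omega)
    have h5 : (2 * m' + 2) * (L / (2 * m' + 2)) ≤ (2 * m' + 2) * T := Nat.mul_le_mul_left _ h2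
    have h6 : n ≤ 2 * (2 * m' + 2) * (T + 1) := by nlinarith
    exact_mod_cast h6
  rcases le_total (q - B) (A - P) with h1 | h1
  · exact_mod_cast fin ((A - P) + (q - B)) _ (by omega) (key P A (hv.left_run h) hP (by omega))
  · exact_mod_cast fin ((A - P) + (q - B)) _ (by omega) (key B q (hv.right_run h) (by omega) (by omega))

theorem exists_dist_le (hk : 1 ≤ k) (hs : GapSep k δ) {l : ℝ} (hl : 0 < l) :
    ∃ J M : ℕ, ∀ d b c, IArray k d b c → ∀ ξ ∈ gapSet k, ∀ P A B q,
      Level d b c ξ P A B q → M ≤ P → J * (B - A) ≤ P → ∀ θ ∈ spec k d b c, ∀ θ' ∈ spec k d b c,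
      Top k ξ δ θ → Top k ξ δ θ' → sig k d b c θ = sig k d b c θ' → |θ - θ'| ≤ l := by
  have hk' : (1 : ℝ) ≤ k := by exact_mod_cast hk
  set r : ℝ := 1 + l / k with hr
  have hr1 : 1 < r := by rw [hr]; have : 0 < l / k := by positivity
                         linarith
  obtain ⟨J, hJ⟩ := pow_unbounded_of_one_lt (6 * (k : ℝ) ^ 2) hr1
  set D : ℝ := 40 * (k : ℝ) ^ 2 * runConst k (δ / 2) ^ 3 with hD
  have lim : Tendsto (fun n : ℕ => r ^ 2 * D * (3 * ((n : ℝ) ^ 1 / r ^ n) + 2 * ((n : ℝ) ^ 0 / r ^ n)))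
      atTop (nhds (r ^ 2 * D * (3 * 0 + 2 * 0))) :=
    ((((tendsto_pow_const_div_const_pow_of_one_lt 1 hr1).const_mul 3).add
      ((tendsto_pow_const_div_const_pow_of_one_lt 0 hr1).const_mul 2)).const_mul _)
  obtain ⟨M, hM⟩ := eventually_atTop.1 (lim.eventually_lt_const (u := 1) (by simp))
  refine ⟨J + 1, M + 1, fun d b c h ξ hξ P A B q hv hMP hJP => ?_⟩
  have hP : 1 ≤ P := by omega
  have key : ∀ θ ∈ spec k d b c, ∀ θ' ∈ spec k d b c, Top k ξ δ θ → Top k ξ δ θ' →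
      sig k d b c θ = sig k d b c θ' → θ ≤ θ' → θ' - θ ≤ l := by
    intro θ hθ θ' hθ' ht ht' hsig hle
    by_contra! hcon
    have h1 := hv.pow_le_of_sig_eq h hk hs hξ hP ht ht' hθ hle hsig
    have h2 := hM P (by omega)
    have hR := one_le_runConst (δ := δ / 2) hk (by linarith [hs.pos])
      (by linarith [hs.pos, hs.le_one])
    have hD0 : 0 < D := by positivity
    have h3 : r ^ (2 * (P - 1)) ≤ (1 + (θ' - θ) / k) ^ (2 * (P - 1)) := by
      have : l / k ≤ (θ' - θ) / k := by gcongr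
      exact pow_le_pow_left₀ (by linarith) (by linarith) _
    have h4 : (6 * (k : ℝ) ^ 2) ^ (B - A) ≤ r ^ P := by
      calc _ ≤ (r ^ J) ^ (B - A) := by gcongr
        _ = r ^ (J * (B - A)) := by rw [pow_mul]
        _ ≤ r ^ P := pow_le_pow_right₀ hr1.le (by nlinarith)
    have h5 : ((B - A : ℕ) : ℝ) ≤ P := by
      have : B - A ≤ P := by nlinarith
      exact_mod_cast this
    have h6 : r ^ (2 * (P - 1)) ≤ D * r ^ P * (3 * P + 2) :=
      h3.trans (h1.trans (by gcongr; linarith))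
    have hrP : 0 < r ^ P := by positivity
    have h7 : r ^ (2 * (P - 1)) * r ^ 2 = r ^ P * r ^ P := by
      rw [← pow_add, ← pow_add]; congr 1; omega
    have h8 : r ^ P * r ^ P ≤ r ^ P * (r ^ 2 * D * (3 * P + 2)) := by
      rw [← h7]
      calc _ ≤ D * r ^ P * (3 * P + 2) * r ^ 2 := by gcongr
        _ = _ := by ring
    have h9 := le_of_mul_le_mul_left h8 hrP
    have h10 : r ^ 2 * D * (3 * ((P : ℝ) ^ 1 / r ^ P) + 2 * ((P : ℝ) ^ 0 / r ^ P)) =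
        r ^ 2 * D * (3 * P + 2) / r ^ P := by
      field_simp
    rw [h10, div_lt_one hrP] at h2
    linarith
  intro θ hθ θ' hθ' ht ht' hsig
  rcases le_total θ θ' with h1 | h1
  · have := key θ hθ θ' hθ' ht ht' hsig h1
    exact _root_.abs_le.2 ⟨by linarith, by linarith⟩
  · have := key θ' hθ' θ hθ ht' ht hsig.symm h1
    exact _root_.abs_le.2 ⟨by linarith, by linarith⟩

open Classical in
theorem exists_card_lt (hk : 1 ≤ k) (hs : GapSep k δ) (R : ℕ) :
    ∃ J M : ℕ, ∀ d b c, IArray k d b c → GaloisClosed k d b c → ∀ ξ ∈ gapSet k, ∀ P A B q,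
      Level d b c ξ P A B q → M ≤ P → J * (B - A) ≤ P → M ≤ (A - P) + (q - B) →
      R * ((A - P) + (q - B)) < ((spec k d b c).filter fun t =>
        ∃ θ ∈ spec k d b c, Top k ξ δ θ ∧ sig k d b c t = sig k d b c θ).card := by
  have hk' : (1 : ℝ) ≤ k := by exact_mod_cast hk
  obtain ⟨m, hm⟩ := exists_card_top_lower k hk hs.pos hs.le_one
  obtain ⟨l, hl, M₀, hM₀⟩ := conj_concentration k hk' (1 / (2 * (m + 1) * (R + 1))) (by positivity)
  obtain ⟨J, M₁, hJ⟩ := exists_dist_le hk hs hl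
  refine ⟨J, M₁ + 2 * (m + 1) * (M₀ + 1) + 1, fun d b c h hg ξ hξ P A B q hv hMP hJP hMn => ?_⟩
  by_contra! hcard
  set S := (spec k d b c).filter fun t =>
        ∃ θ ∈ spec k d b c, Top k ξ δ θ ∧ sig k d b c t = sig k d b c θ with hS
  set T := (spec k d b c).filter fun t => Top k ξ δ t with hT
  have hn := hm d b c h hg ξ P A B q hv (by omega) (by omega)
  have hc := hM₀ S (fun θ hθ => ⟨hg.conjIn (Finset.filter_subset _ _) (fun t ht t' ht' he => by
      rw [Finset.mem_filter] at ht ⊢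
      obtain ⟨-, θ, h1, h2, h3⟩ := ht
      exact ⟨ht', θ, h1, h2, he.trans h3⟩) hθ, hg.abs_le θ (Finset.filter_subset _ _ hθ)⟩) T
    (fun θ hθ => by
      rw [hT, Finset.mem_filter] at hθ
      rw [hS, Finset.mem_filter]
      exact ⟨hθ.1, θ, hθ.1, hθ.2, rfl⟩)
    (fun θ hθ θ' hθ' he => by
      rw [hT, Finset.mem_filter] at hθ hθ'
      exact hJ d b c h ξ hξ P A B q hv (by omega) hJP θ hθ.1 θ' hθ'.1 hθ.2 hθ'.2
        (hg.sig_eq hθ'.1 he))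
  set n := (A - P) + (q - B)
  have hcard' : (S.card : ℝ) ≤ (R + 1) * n := by
    have : (S.card : ℝ) ≤ R * n := by exact_mod_cast hcard
    have : (0 : ℝ) ≤ n := by positivity
    linarith
  have h1 : 1 / (2 * (m + 1) * (R + 1)) * (S.card : ℝ) ≤ n / (2 * (m + 1)) := by
    calc _ ≤ 1 / (2 * (m + 1) * (R + 1)) * ((R + 1) * n : ℝ) := by gcongr
      _ = _ := by field_simp
  have h2 : (n : ℝ) ≤ (m + 1) * (T.card + 1) := by
    have : (0 : ℝ) ≤ T.card := by positivity
    linarith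
  have h3 : (T.card : ℝ) ≤ n / (2 * (m + 1)) + M₀ := hc.trans (by linarith)
  have h4 : (n : ℝ) ≤ n / 2 + (m + 1) * (M₀ + 1) := by
    calc (n : ℝ) ≤ (m + 1) * (n / (2 * (m + 1)) + M₀ + 1) := h2.trans (by gcongr)
      _ = _ := by field_simp; ring
  have h5 : ((2 * (m + 1) * (M₀ + 1) + 1 : ℕ) : ℝ) ≤ n := by exact_mod_cast (by omega)
  push_cast at h5
  linarith

end Level

namespace Level

variable {k d : ℕ} {b c : ℕ → ℕ} {ξ : ℝ} {P A B q : ℕ} {θ : ℝ}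

theorem sig_le_of_run_bounds (hv : Level d b c ξ P A B q) (h : IArray k d b c) (hk : 1 ≤ k)
    (hθk : |θ| ≤ k) (hP : 1 ≤ P) {G : ℝ} (hG : 1 ≤ G)
    (hl : ∀ i, P ≤ i + 1 → i + 1 ≤ A → energy k b c θ i ≤ G * energy k b c θ (P - 1))
    (hr : B + P < q →
      ∀ i, B ≤ i + 1 → i + 1 ≤ q → energy k b c θ i ≤ G * energy k b c θ (B - 1)) :
    sig k d b c θ ≤ d * (G ^ 2 * (6 * (k : ℝ) ^ 2) ^ (3 * P + (B - A))) := by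
  have := hv.hPA; have := hv.hAB; have := hv.hBq; have := hv.hqd
  have hd := h.one_le_d hk
  have htail := hv.tail_le h hP
  have hk' : (1 : ℝ) ≤ k := by exact_mod_cast hk
  have he0 := h.energy_zero_le hk hθk
  set C : ℝ := 6 * (k : ℝ) ^ 2 with hC
  have hC1 : 1 ≤ C := by nlinarith
  have hCP : 1 ≤ C ^ P := one_le_pow₀ hC1
  have hCK : 1 ≤ C ^ (B - A) := one_le_pow₀ hC1
  have hE := energy_nonneg k b c θ
  have pre : ∀ i < P, energy k b c θ i ≤ C ^ P := fun i hi => by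
    calc _ ≤ C ^ (P - 1) * energy k b c θ 0 :=
          h.energy_le_pow hk hθk (Nat.zero_le i) (by omega) (by omega)
      _ ≤ C ^ (P - 1) * C := by gcongr
      _ = C ^ P := by rw [← pow_succ]; congr 1; omega
  have hr' : ∀ i, B ≤ i + 1 → i + 1 ≤ q →
      energy k b c θ i ≤ G * C ^ P * energy k b c θ (B - 1) := by
    intro i h1 h2
    by_cases hN : B + P < q
    · calc _ ≤ G * energy k b c θ (B - 1) := hr hN i h1 h2
        _ ≤ G * C ^ P * energy k b c θ (B - 1) :=
          mul_le_mul_of_nonneg_right (le_mul_of_one_le_right (by linarith) hCP) (hE _)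
    · calc _ ≤ C ^ P * energy k b c θ (B - 1) :=
            h.energy_le_pow hk hθk (by omega) (by omega) (by omega)
        _ ≤ G * C ^ P * energy k b c θ (B - 1) :=
          mul_le_mul_of_nonneg_right (le_mul_of_one_le_left (by linarith) hG) (hE _)
  have mid : ∀ i < q, energy k b c θ i ≤ G * C ^ P * (C ^ (B - A) * (G * C ^ P)) := by
    intro i hi
    rcases le_or_gt P (i + 1) with h1 | h1
    · refine (hv.energy_le_of_runs h hk hθk hP hG (by nlinarith) hl hr' h1 hi).trans ?_
      have := pre (P - 1) (by omega)
      gcongr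
    · refine (pre i (by omega)).trans ?_
      have h2 : 1 ≤ G * C ^ P := one_le_mul_of_one_le_of_one_le hG hCP
      have h3 : C ^ P ≤ G * C ^ P := le_mul_of_one_le_left (by linarith) hG
      calc C ^ P ≤ G * C ^ P * (1 * 1) := by linarith
        _ ≤ _ := by gcongr
  have all : ∀ i < d, energy k b c θ i ≤ G ^ 2 * C ^ (3 * P + (B - A)) := by
    intro i hi
    have e : G ^ 2 * C ^ (3 * P + (B - A)) = C ^ P * (G * C ^ P * (C ^ (B - A) * (G * C ^ P))) := by
      rw [pow_add, pow_mul']; ring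
    rw [e]
    rcases lt_or_ge i q with h1 | h1
    · refine (mid i h1).trans (le_mul_of_one_le_left (by positivity) hCP)
    · calc _ ≤ C ^ P * energy k b c θ (q - 1) :=
            h.energy_le_pow hk hθk (by omega) hi (by omega)
        _ ≤ _ := by
          have := mid (q - 1) (by omega)
          gcongr
  refine (h.sig_le_sum_energy hk θ).trans ((Finset.sum_le_card_nsmul _ _ _
    fun i hi => all i (Finset.mem_range.1 hi)).trans ?_)
  rw [Finset.card_range, nsmul_eq_mul]

theorem sig_le_of_band (hv : Level d b c ξ P A B q) (h : IArray k d b c) (hk : 1 ≤ k)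
    (hθk : |θ| ≤ k) (hP : 1 ≤ P) (hPA : P < A) {δ : ℝ} (hδ : 0 < δ) (hδ1 : δ ≤ 1)
    (hθ : |θ - (k - ξ ^ 2 - 2 * √(b P * c P : ℝ))| ≤ 2 * √(b P * c P : ℝ) - δ) :
    sig k d b c θ ≤ d * (runConst k δ ^ 2 * (6 * (k : ℝ) ^ 2) ^ (3 * P + (B - A))) := by
  have := hv.hAB; have := hv.hBq; have := hv.hqd
  refine hv.sig_le_of_run_bounds h hk hθk hP (one_le_runConst hk hδ hδ1) (fun i h1 h2 => ?_)
    fun hN i h1 h2 => ?_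
  · exact ((hv.left_run h).energy_comparable' h hk (fun _ => coup_bounds h hP (by omega)) hδ hδ1 hθk
      (fun _ => hθ) hP hPA.le h1 h2).1
  · refine ((hv.right_run h).energy_comparable' h hk (fun _ => coup_bounds h (by omega) (by omega))
      hδ hδ1 hθk (fun _ => ?_) (by omega) hv.hBq h1 h2).1
    rw [(hv.swap h hP hN).2]
    exact hθ

theorem sig_le_of_closed_band (hv : Level d b c ξ P A B q) (h : IArray k d b c) (hk : 1 ≤ k)
    (hθk : |θ| ≤ k) (hP : 1 ≤ P) (hPA : P < A)
    (hθ : |θ - (k - ξ ^ 2 - 2 * √(b P * c P : ℝ))| ≤ 2 * √(b P * c P : ℝ)) :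
    sig k d b c θ ≤ d * (((6 * (k : ℝ) ^ 2) ^ 2 * (18 * (d : ℝ) ^ 2)) ^ 2 *
      (6 * (k : ℝ) ^ 2) ^ (3 * P + (B - A))) := by
  have := hv.hAB; have := hv.hBq; have := hv.hqd
  have hk' : (1 : ℝ) ≤ k := by exact_mod_cast hk
  have hd' : (1 : ℝ) ≤ d := by exact_mod_cast h.one_le_d hk
  refine hv.sig_le_of_run_bounds h hk hθk hP
    (one_le_mul_of_one_le_of_one_le (one_le_pow₀ (by nlinarith)) (by nlinarith))
    (fun i h1 h2 => ?_) fun hN i h1 h2 => ?_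
  · exact (hv.left_run h).energy_le_of_closed_band' h hk (fun _ => (coup_bounds h hP (by omega)).1)
      hθk (fun _ => hθ) hP hPA.le h1 h2
  · refine (hv.right_run h).energy_le_of_closed_band' h hk
      (fun _ => (coup_bounds h (by omega) (by omega)).1) hθk (fun _ => ?_) (by omega) hv.hBq h1 h2
    rw [(hv.swap h hP hN).2]
    exact hθ

theorem card_outside_le (hv : Level d b c ξ P A B q) (h : IArray k d b c) (hP : 1 ≤ P) :
    ((spec k d b c).filter fun t =>
      ¬ |t - (k - ξ ^ 2 - 2 * √(b P * c P : ℝ))| ≤ 2 * √(b P * c P : ℝ)).card ≤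
      3 * P + (B - A) + 5 := by
  have := hv.hPA; have := hv.hAB; have := hv.hBq; have := hv.hqd
  have htail := hv.tail_le h hP
  have hl := hv.left_run h
  have hr := hv.right_run h
  have hcard : (spec k d b c).card = d + 1 := card_triSpecF h.coupling
  have hsplit := Finset.card_filter_add_card_filter_not (s := spec k d b c)
    (fun t => |t - (k - ξ ^ 2 - 2 * √(b P * c P : ℝ))| ≤ 2 * √(b P * c P : ℝ))
  by_cases hN : B + P < q
  · have h1 := card_le_card_triSpecF_band h.coupling (α := diagSeq k b c)
      (a := k - ξ ^ 2 - 2 * √(b P * c P : ℝ)) (β := √(b P * c P : ℝ))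
      (Real.sqrt_nonneg _) (Finset.Ioo P (A - 1) ∪ Finset.Ioo B (q - 1)) (fun i hi => by
        rw [Finset.mem_union, Finset.mem_Ioo, Finset.mem_Ioo] at hi
        rw [← (hv.swap h hP hN).2] at hl ⊢
        rcases hi with hi | hi
        · exact ⟨by omega, by omega, hl.diag i (by omega) (by omega),
            hl.coup i (by omega) (by omega), hl.coup (i + 1) (by omega) (by omega)⟩
        · exact ⟨by omega, by omega, hr.diag i (by omega) (by omega),
            hr.coup i (by omega) (by omega), hr.coup (i + 1) (by omega) (by omega)⟩)
    rw [Finset.card_union_of_disjoint (Finset.disjoint_left.2 fun i hi hi' => by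
      rw [Finset.mem_Ioo] at hi hi'; omega), Nat.card_Ioo, Nat.card_Ioo] at h1
    unfold spec at *
    omega
  · have h1 := card_le_card_triSpecF_band h.coupling (α := diagSeq k b c)
      (a := k - ξ ^ 2 - 2 * √(b P * c P : ℝ)) (β := √(b P * c P : ℝ))
      (Real.sqrt_nonneg _) (Finset.Ioo P (A - 1)) (fun i hi => by
        rw [Finset.mem_Ioo] at hi
        exact ⟨by omega, by omega, hl.diag i (by omega) (by omega),
            hl.coup i (by omega) (by omega), hl.coup (i + 1) (by omega) (by omega)⟩)
    rw [Nat.card_Ioo] at h1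
    unfold spec at *
    omega

end Level

/-- The sum of squares along a constant-coefficient recurrence. -/
theorem run_sum_sq {x : ℝ} {v : ℕ → ℝ} {l m : ℕ}
    (hrec : ∀ i, l < i → i < m → v (i + 1) = 2 * x * v i - v (i - 1)) {n : ℕ} (hn : l + n < m) :
    4 * (1 - x ^ 2) * ∑ j ∈ Finset.range n, v (l + 1 + j) ^ 2 =
      2 * n * (v l ^ 2 + v (l + 1) ^ 2 - 2 * x * v l * v (l + 1))
        - (v (l + n + 1) ^ 2 - v (l + n) ^ 2) + (v (l + 1) ^ 2 - v l ^ 2) := by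
  induction n with
  | zero => simp
  | succ n ih =>
    have h1 := run_invariant hrec (l + n) (by omega) (by omega)
    have h2 := hrec (l + (n + 1)) (by omega) (by omega)
    rw [Finset.sum_range_succ, mul_add, ih (by omega), ← h1]
    rw [show l + (n + 1) - 1 = l + n by omega, show l + (n + 1) = l + n + 1 by ring] at h2
    rw [show l + 1 + n = l + n + 1 by ring, show l + (n + 1) = l + n + 1 by ring, h2]
    push_cast
    ring

theorem IsRun.le_sig {k d : ℕ} {b c : ℕ → ℕ} {l L : ℕ} {a β θ ε : ℝ} (hr : IsRun k d b c l L a β)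
    (h : IArray k d b c) (hβ : 1 ≤ β) (hβk : β ≤ k) (hε : 0 < ε) (hε1 : ε ≤ 1)
    (h1 : a + 2 * β - ε ≤ θ) (h2 : θ ≤ a + 2 * β - ε / 2) (hl : l + 2 ≤ L) :
    (stdSeq k b c θ l ^ 2 + stdSeq k b c θ (l + 1) ^ 2
        - 2 * ((θ - a) / (2 * β)) * stdSeq k b c θ l * stdSeq k b c θ (l + 1)) *
      ((L - l : ℕ) - 2 - 4 * k / ε) ≤
      2 * (1 - ((θ - a) / (2 * β)) ^ 2) * sig k d b c θ := by
  have hLd := hr.le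
  have hrec : ∀ i, l < i → i < L - 1 → stdSeq k b c θ (i + 1) =
      2 * ((θ - a) / (2 * β)) * stdSeq k b c θ i - stdSeq k b c θ (i - 1) :=
    fun i h1 h2 => hr.recurrence h (by linarith) θ h1 (by omega)
  set x := (θ - a) / (2 * β) with hx
  have hx1 : x ≤ 1 - ε / (4 * k) := by
    rw [hx, div_le_iff₀ (by linarith)]
    have : ε / (4 * k) * (2 * β) ≤ ε / 2 := by
      rw [div_mul_eq_mul_div, div_le_div_iff₀ (by linarith) (by norm_num)]
      nlinarith
    linarith
  have hx0 : 1 / 2 ≤ x := by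
    rw [hx, le_div_iff₀ (by linarith)]; linarith
  have hpos : 0 < ε / (4 * k) := div_pos hε (by linarith)
  have hx2 : ε / (4 * k) ≤ 1 - x ^ 2 := by nlinarith
  obtain ⟨n, rfl⟩ : ∃ n, L = l + n + 2 := ⟨L - l - 2, by omega⟩
  have hs := run_sum_sq hrec (n := n) (by omega)
  have hi := run_invariant hrec (l + n) (by omega) (by omega)
  set v := stdSeq k b c θ with hv
  set Q := v l ^ 2 + v (l + 1) ^ 2 - 2 * x * v l * v (l + 1) with hQ
  have e1 : (1 - x ^ 2) * v (l + n + 1) ^ 2 ≤ Q := by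
    rw [← hi]; nlinarith [sq_nonneg (v (l + n) - x * v (l + n + 1))]
  have e2 : (1 - x ^ 2) * v l ^ 2 ≤ Q := by
    rw [hQ]; nlinarith [sq_nonneg (v (l + 1) - x * v l)]
  have e3 : ∀ y : ℝ, (1 - x ^ 2) * y ^ 2 ≤ Q → y ^ 2 ≤ Q * (4 * k / ε) := by
    intro y hy
    have h5 : ε / (4 * k) * y ^ 2 ≤ Q :=
      (mul_le_mul_of_nonneg_right hx2 (sq_nonneg y)).trans hy
    calc y ^ 2 = ε / (4 * k) * y ^ 2 * (4 * k / ε) := by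
          have : (k : ℝ) ≠ 0 := by linarith
          field_simp
      _ ≤ _ := by
          refine mul_le_mul_of_nonneg_right h5 (div_nonneg (by linarith) hε.le)
  have e4 : ∑ j ∈ Finset.range n, v (l + 1 + j) ^ 2 ≤ sig k d b c θ := by
    rw [← Finset.sum_image (f := fun i => v i ^ 2) (g := fun j => l + 1 + j)
      (fun _ _ _ _ => by simp)]
    refine Finset.sum_le_sum_of_subset_of_nonneg (fun i hi => ?_) fun _ _ _ => sq_nonneg _
    obtain ⟨j, hj, rfl⟩ := Finset.mem_image.1 hi
    rw [Finset.mem_range] at hj ⊢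
    omega
  have e5 := mul_le_mul_of_nonneg_left e4 (by linarith : 0 ≤ 2 * (1 - x ^ 2))
  have e6 := e3 _ e1
  have e7 := e3 _ e2
  have e8 : ((l + n + 2 - l : ℕ) : ℝ) = n + 2 := by
    rw [show l + n + 2 - l = n + 2 by omega]; push_cast; ring
  rw [e8]
  nlinarith [sq_nonneg (v (l + n)), sq_nonneg (v (l + 1))]

private theorem exists_edge_slope {k β b c b' c' t ε : ℝ} (hk : 1 ≤ k) (hβ1 : 1 ≤ β)
    (hβsq : β ^ 2 = b * c) (hβ0 : β ≤ k) (hb : c + 1 ≤ b) (hbk : b ≤ k) (hbb : b ≤ b') (hcc : c' ≤ c)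
    (hc : 1 ≤ c) (hne : c' + 1 ≤ c ∨ b + 1 ≤ b') (hε : ε ≤ 1 / (16 * k ^ 2)) (ht : t ≤ ε)
    {X : ℝ} (hX : X = 2 * β - b - c - t) :
    ∃ s, 1 / k ≤ s ∧ s * b = β ∧ s * β = c ∧ (1 + 1 / (4 * k ^ 2)) * s ≤ 1 ∧
      b' * ((1 + 1 / (4 * k ^ 2)) * s) ^ 2 - (X + b' + c') * ((1 + 1 / (4 * k ^ 2)) * s) + c' ≤ 0 := by
  have hbr : 0 < b := by linarith
  obtain ⟨s, hsdef⟩ : ∃ s, s = β / b := ⟨_, rfl⟩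
  have hsb : s * b = β := by rw [hsdef]; field_simp
  have hsβ : s * β = c := by
    rw [hsdef, div_mul_eq_mul_div, ← sq, hβsq]; field_simp
  have hs0 : 0 < s := by rw [hsdef]; positivity
  have hs1 : 1 / k ≤ s := by
    rw [hsdef, div_le_div_iff₀ (by linarith) hbr]; nlinarith
  have hs2 : s ≤ 1 - 1 / (2 * k) := by
    have e1 : s ^ 2 * b = c := by rw [← hsβ, ← hsb]; ring
    have e2 : s ^ 2 ≤ 1 - 1 / k := by
      have e3 : s ^ 2 * b ≤ (1 - 1 / k) * b := by
        rw [e1, sub_mul, div_mul_eq_mul_div, one_mul]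
        have : b / k ≤ 1 := by rw [div_le_one (by linarith)]; exact hbk
        linarith
      exact le_of_mul_le_mul_right e3 hbr
    have e3 : 1 - 1 / k ≤ (1 - 1 / (2 * k)) ^ 2 := by
      have : (1 - 1 / (2 * k)) ^ 2 = 1 - 1 / k + (1 / (2 * k)) ^ 2 := by field_simp; ring
      rw [this]; linarith [sq_nonneg (1 / (2 * k))]
    refine le_of_sq_le_sq (e2.trans e3) ?_
    rw [sub_nonneg, div_le_one (by linarith)]; linarith
  obtain ⟨η, hη⟩ : ∃ η, η = 1 / (4 * k ^ 2) := ⟨_, rfl⟩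
  have hη0 : 0 < η := by rw [hη]; positivity
  have hηk : η * k = 1 / (4 * k) := by rw [hη]; field_simp
  have hηk2 : k * η ^ 2 ≤ 1 / (16 * k) := by
    have : k * η ^ 2 = 1 / (16 * k) / k ^ 2 := by rw [hη]; field_simp; norm_num
    rw [this]; exact div_le_self (by positivity) (by nlinarith)
  have hηle : η ≤ 1 / (4 * k) := by rw [← hηk]; nlinarith
  have hk4 : 1 / (4 * k) = 4 * (1 / (16 * k)) ∧ 1 / (2 * k) = 8 * (1 / (16 * k)) := by
    constructor <;> (field_simp; norm_num)
  have hk16 : 0 < 1 / (16 * k) := by positivity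
  have f4 : ε ≤ 1 / (16 * k) := hε.trans (by gcongr; nlinarith)
  obtain ⟨σ, hσ⟩ : ∃ σ, σ = (1 + η) * s := ⟨_, rfl⟩
  have hσs : s ≤ σ := by rw [hσ]; nlinarith
  have hσ0 : 0 < σ := by linarith
  have hσ1 : σ ≤ 1 - 1 / (4 * k) := by
    have : η * s ≤ η := mul_le_of_le_one_right hη0.le (by linarith)
    rw [hσ]; linarith
  refine ⟨s, hs1, hsb, hsβ, ?_, ?_⟩ <;> rw [← hη, ← hσ]
  · linarith
  have f1 : b * σ ^ 2 - (X + b + c) * σ + c = c * η ^ 2 + t * σ := by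
    rw [hX, ← hsβ, hσ, ← hsb]; ring
  have f2 : c * η ^ 2 ≤ k * η ^ 2 * σ := by
    calc c * η ^ 2 = s * β * η ^ 2 := by rw [hsβ]
      _ ≤ σ * k * η ^ 2 := by gcongr
      _ = _ := by ring
  have f3 : t * σ ≤ ε * σ := mul_le_mul_of_nonneg_right (by linarith) hσ0.le
  have f5 : (1 - σ) * σ ≤ (1 - σ) * ((c - c') + (b' - b) * σ) := by
    have : σ ≤ (c - c') + (b' - b) * σ := by
      rcases hne with hne | hne
      · have : 0 ≤ (b' - b) * σ := mul_nonneg (by linarith) hσ0.le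
        linarith
      · have : 1 * σ ≤ (b' - b) * σ := mul_le_mul_of_nonneg_right (by linarith) hσ0.le
        linarith
    exact mul_le_mul_of_nonneg_left this (by linarith)
  have f6 : k * η ^ 2 * σ + ε * σ ≤ (1 - σ) * σ := by
    rw [← add_mul]
    exact mul_le_mul_of_nonneg_right (by linarith) hσ0.le
  have f7 : b' * σ ^ 2 - (X + b' + c') * σ + c' =
      (b * σ ^ 2 - (X + b + c) * σ + c) - (1 - σ) * ((c - c') + (b' - b) * σ) := by ring
  linarith

private theorem edge_step {β s η g w w' w'' X ε k c b' : ℝ} (hk : 1 ≤ k) (hη : 0 < η)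
    (hη4 : η ≤ 1 / 4) (hε : ε ≤ η / 4) (hβ : 1 ≤ β) (hs : 1 / k ≤ s)
    (hsβ : s * β = c) (hb' : 1 ≤ b') (hw : 1 ≤ w) (hg1 : 1 ≤ g) (hgk : g ≤ k)
    (hg : g ^ 2 = b' * c) (hpre : (1 + η) * s * b' * w ≤ g * w') (hX : 2 * β - ε ≤ X)
    (hrec : β * w'' = X * w' - g * w) : 1 / k ^ 2 ≤ w' ∧ (1 + η / 4) * w' ≤ w'' := by
  have hs0 : 0 < s := lt_of_lt_of_le (by positivity) hs
  have hw'0 : 1 / k ^ 2 ≤ w' := by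
    have e1 : 1 / k ≤ g * w' := by
      calc 1 / k ≤ 1 * s * 1 * 1 := by linarith
        _ ≤ (1 + η) * s * b' * w := by gcongr; linarith
        _ ≤ g * w' := hpre
    have e2 : 0 < w' := by
      have : 0 < g * w' := lt_of_lt_of_le (by positivity) e1
      exact pos_of_mul_pos_right this (by linarith)
    have e3 : 1 / k ≤ k * w' := e1.trans (by gcongr)
    rw [div_le_iff₀ (by positivity)] at e3 ⊢
    linarith
  have hw' : 0 < w' := lt_of_lt_of_le (by positivity) hw'0
  refine ⟨hw'0, ?_⟩
  have hgw : (1 + η) * (g * w) ≤ β * w' := by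
    have e2 : (s * b') * ((1 + η) * (g * w)) ≤ (s * b') * (β * w') := by
      calc _ = g * ((1 + η) * s * b' * w) := by ring
        _ ≤ g * (g * w') := by gcongr
        _ = g ^ 2 * w' := by ring
        _ = _ := by rw [hg, ← hsβ]; ring
    exact le_of_mul_le_mul_left e2 (by positivity)
  have e1 : g * w ≤ (1 - η + η ^ 2) * (β * w') := by
    have e2 : (1 - η + η ^ 2) * ((1 + η) * (g * w)) ≤ (1 - η + η ^ 2) * (β * w') := by
      refine mul_le_mul_of_nonneg_left hgw (by nlinarith)
    have e3 : (1 - η + η ^ 2) * ((1 + η) * (g * w)) = g * w + η ^ 3 * (g * w) := by ring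
    have e4 : 0 ≤ η ^ 3 * (g * w) := by positivity
    linarith
  have e2 : ε * w' ≤ η / 4 * (β * w') := by
    calc ε * w' ≤ η / 4 * w' := by gcongr
      _ ≤ η / 4 * (β * w') := by gcongr; exact le_mul_of_one_le_left hw'.le hβ
  have e3 : β * ((1 + η / 4) * w') ≤ β * w'' := by
    rw [hrec]
    have e5 : (2 * β - ε) * w' ≤ X * w' := by gcongr
    have e6 : η ^ 2 * (β * w') ≤ η / 4 * (β * w') := by
      gcongr; nlinarith
    have e7 : 0 ≤ η * (β * w') := by positivity
    nlinarith [e1, e2, e5, e6, e7]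
  exact le_of_mul_le_mul_left e3 (by linarith)

namespace Level

variable {k d : ℕ} {b c : ℕ → ℕ} {ξ : ℝ} {P A B q : ℕ} {θ δ ε : ℝ}

/-- At the foot of a run with positive gap, the standard sequence is large and increasing. -/
theorem stdSeq_edge (hv : Level d b c ξ P A B q) (h : IArray k d b c) (hk : 1 ≤ k)
    (hs : GapSep k δ) (hξ : ξ ∈ gapSet k) (hξ0 : 0 < ξ) (hP : 1 ≤ P) (hPA : P + 1 < A)
    (hεδ : ε ≤ δ) (hεk : ε ≤ 1 / (16 * k ^ 2)) (h1 : k - ξ ^ 2 - ε ≤ θ) :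
    1 / (k : ℝ) ^ 2 ≤ stdSeq k b c θ P ∧
      (1 + 1 / (4 * k ^ 2) / 4) * stdSeq k b c θ P ≤ stdSeq k b c θ (P + 1) := by
  have := hv.hAB; have := hv.hBq; have := hv.hqd
  have hk' : (1 : ℝ) ≤ k := by exact_mod_cast hk
  have hpos := hv.stdSeq_pos h hk hs hξ hP (θ := θ) (by linarith)
  obtain ⟨p, rfl⟩ := Nat.exists_eq_add_of_le' hP
  have hg := hv.gap_left le_rfl (by omega : p + 1 < A)
  have hgp := (hv.lt_P p (by omega)).1 (by omega)
  have hb1 : c (p + 1) < b (p + 1) := by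
    by_contra! hcon
    have := Real.sqrt_le_sqrt (show (b (p + 1) : ℝ) ≤ c (p + 1) by exact_mod_cast hcon)
    unfold gapSeq at hg
    linarith
  have hbb := h.b_anti p (p + 1) (by omega) (by omega)
  have hcc := h.c_mono p (p + 1) (by omega) (by omega)
  have hne : c p + 1 ≤ c (p + 1) ∨ b (p + 1) + 1 ≤ b p := by
    by_contra! hcon
    have e1 : b p = b (p + 1) := by omega
    have e2 : c p = c (p + 1) := by omega
    rw [gapSeq, e1, e2, ← gapSeq, hg] at hgp
    exact lt_irrefl _ hgp
  have hbk := h.b_le (i := p + 1) (by omega)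
  have hc1 := h.c_pos (p + 1) (by omega) (by omega)
  obtain ⟨hβ1, hβk⟩ := coup_bounds h (by omega : 1 ≤ p + 1) (by omega : p + 1 < d)
  have hrun := hv.left_run h
  have hdiag := hrun.diag (p + 1) le_rfl (by omega)
  have hcoup := hrun.coup (p + 1 + 1) (by omega) (by omega)
  have hβsq : √(b (p + 1) * c (p + 1) : ℝ) ^ 2 = b (p + 1) * c (p + 1) :=
    Real.sq_sqrt (by positivity)
  generalize √(b (p + 1) * c (p + 1) : ℝ) = β at *
  have hdiag' := hdiag
  unfold diagSeq at hdiag'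
  have hbp1 : (1 : ℝ) ≤ b p := by exact_mod_cast (by omega : 1 ≤ b p)
  obtain ⟨s, hs1, hsb, hsβ, hσ1, hf⟩ := exists_edge_slope (k := k) (β := β) (b := b (p + 1))
    (c := c (p + 1)) (b' := b p) (c' := c p) (t := k - ξ ^ 2 - θ) (ε := ε) (X := θ - k) hk' hβ1 hβsq
    hβk (by exact_mod_cast hb1) (by exact_mod_cast hbk) (by exact_mod_cast hbb)
    (by exact_mod_cast hcc) (by exact_mod_cast hc1) (by exact_mod_cast hne) hεk (by linarith)
    (by linarith)
  have hs0 : 0 < s := lt_of_lt_of_le (by positivity) hs1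
  have hpre := (initial_lower_bound (k := k) (θ := θ) (σ := (1 + 1 / (4 * k ^ 2)) * s)
    (b := fun i => b i)
    (c := fun i => c i) (γ := coupSeq b c) (v := stdSeq k b c θ) (p := p)
    (fun i hi => by exact_mod_cast h.b_anti i p hi (by omega)) (by linarith)
    (fun i _ => by positivity) (fun i hi => by exact_mod_cast h.c_mono i p hi (by omega))
    h.coupSeq_zero (fun i _ => IArray.coupSeq_sq b c i)
    (fun i hi => h.coupling.pos _ (by omega) (by omega))
    (fun i hi => h.stdSeq_rec θ (by omega)) (by simp [stdSeq, triSeq]) (by positivity) hσ1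
    (by linarith) p le_rfl).2
  have hvp : 1 ≤ stdSeq k b c θ p := by
    have : ∀ i ≤ p, 1 ≤ stdSeq k b c θ i := by
      intro i hi
      induction i with
      | zero => simp [stdSeq, triSeq]
      | succ i ih =>
        have e1 := hpos.2 i (by omega)
        have e2 := ih (by omega)
        have e3 : 0 ≤ δ / (3 * k) := div_nonneg hs.pos.le (by linarith)
        nlinarith
    exact this p le_rfl
  have hrec := h.stdSeq_rec θ (i := p + 1) (by omega)
  rw [Nat.add_sub_cancel, hdiag, hcoup] at hrec
  have e0 : 1 / (16 * (k : ℝ) ^ 2) = 1 / (4 * k ^ 2) / 4 := by field_simp; norm_num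
  exact edge_step hk' (η := 1 / (4 * k ^ 2)) (by positivity) (by
      rw [div_le_div_iff₀ (by positivity) (by norm_num)]; nlinarith) (hεk.trans_eq e0) hβ1 hs1
    hsβ hbp1 hvp (h.one_le_coupSeq (by omega : 1 ≤ p + 1) (by omega))
    (h.coupSeq_le (by omega : p + 1 ≤ d)) (IArray.coupSeq_sq b c p) hpre (by linarith) hrec

/-- The standard sequence has large norm at eigenvalues close to the edge of the band. -/
theorem le_sig_of_edge (hv : Level d b c ξ P A B q) (h : IArray k d b c) (hk : 1 ≤ k)
    (hs : GapSep k δ) (hξ : ξ ∈ gapSet k) (hξ0 : 0 < ξ) (hP : 1 ≤ P) (hPA : P + 1 < A) (hε : 0 < ε)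
    (hεδ : ε ≤ δ) (hεk : ε ≤ 1 / (16 * k ^ 2)) (ht : Top k ξ ε θ)
    (hN : 2 + 4 * k / ε ≤ (A - P : ℕ)) :
    (1 / (4 * k ^ 2) / 4 * (1 / k ^ 2)) ^ 2 * ((A - P : ℕ) - 2 - 4 * k / ε) ≤
      2 * ε * sig k d b c θ := by
  have := hv.hAB; have := hv.hBq; have := hv.hqd
  have hk' : (1 : ℝ) ≤ k := by exact_mod_cast hk
  have hsp := hs.le_one
  obtain ⟨e1, e2⟩ := hv.stdSeq_edge h hk hs hξ hξ0 hP hPA hεδ hεk ht.lower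
  obtain ⟨hβ1, hβk⟩ := coup_bounds h (by omega : 1 ≤ P) (by omega : P < d)
  have e3 := (hv.left_run h).le_sig h hβ1 hβk hε (by linarith) (θ := θ)
    (by linarith [ht.lower]) (by linarith [ht.upper]) (by omega)
  have hx : (θ - (k - ξ ^ 2 - 2 * √(b P * c P : ℝ))) / (2 * √(b P * c P : ℝ)) =
      1 - (k - ξ ^ 2 - θ) / (2 * √(b P * c P : ℝ)) := by
    field_simp; ring
  rw [hx] at e3
  generalize √(b P * c P : ℝ) = β at *
  have hy0 : 0 ≤ (k - ξ ^ 2 - θ) / (2 * β) := div_nonneg (by linarith [ht.upper]) (by linarith)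
  have hy1 : (k - ξ ^ 2 - θ) / (2 * β) ≤ ε / 2 := by
    rw [div_le_div_iff₀ (by linarith) (by norm_num)]
    nlinarith [ht.lower]
  generalize (k - ξ ^ 2 - θ) / (2 * β) = y at *
  have hsig : 0 ≤ sig k d b c θ := Finset.sum_nonneg fun _ _ => sq_nonneg _
  set v := stdSeq k b c θ P
  set w := stdSeq k b c θ (P + 1)
  have hη : (0 : ℝ) < 1 / (4 * k ^ 2) / 4 := by positivity
  have hv0 : 0 < v := lt_of_lt_of_le (by positivity) e1
  generalize (1 : ℝ) / (4 * k ^ 2) / 4 = η at *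
  have hw0 : 0 < w := lt_of_lt_of_le (by positivity) e2
  have e4 : (η * (1 / k ^ 2)) ^ 2 ≤ v ^ 2 + w ^ 2 - 2 * (1 - y) * v * w := by
    have e5 : (η * (1 / k ^ 2)) ^ 2 ≤ (w - v) ^ 2 := by
      refine pow_le_pow_left₀ (by positivity) ?_ 2
      calc η * (1 / (k : ℝ) ^ 2) ≤ η * v := by gcongr
        _ ≤ w - v := by linarith
    have e6 : 0 ≤ y * (v * w) := by positivity
    nlinarith
  calc _ ≤ (v ^ 2 + w ^ 2 - 2 * (1 - y) * v * w) * ((A - P : ℕ) - 2 - 4 * k / ε) :=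
        mul_le_mul_of_nonneg_right e4 (by linarith)
    _ ≤ _ := e3
    _ ≤ 2 * ε * sig k d b c θ := by
      refine mul_le_mul_of_nonneg_right ?_ hsig
      nlinarith

end Level

namespace Level

variable {k : ℕ} {δ : ℝ}

open Classical in
/-- If both runs at a positive level make up all but a bounded part of the array, then the
diameter is bounded. -/
theorem exists_diam_le_of_pos (hk : 1 ≤ k) (hs : GapSep k δ) (B₀ : ℕ) :
    ∃ D : ℕ, ∀ d b c, IArray k d b c → GaloisClosed k d b c → ∀ ξ ∈ gapSet k, 0 < ξ → ξ < √k →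
      ∀ P A B q, Level d b c ξ P A B q → P ≤ B₀ → B - A ≤ B₀ → d ≤ D := by
  have hk' : (1 : ℝ) ≤ k := by exact_mod_cast hk
  obtain ⟨l, hl, M₀, hM₀⟩ := conj_concentration k hk' (1 / 4) (by norm_num)
  obtain ⟨δ', hδ', hδ'1, hδ'l⟩ : ∃ δ' > 0, δ' ≤ 1 ∧ δ' ≤ l :=
    ⟨min 1 l, lt_min one_pos hl, min_le_left _ _, min_le_right _ _⟩
  have hR := one_le_runConst hk hδ' hδ'1
  set C := runConst k δ' ^ 2 * (6 * (k : ℝ) ^ 2) ^ (4 * B₀) with hC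
  have hC0 : 0 < C := by positivity
  set κ : ℝ := (1 / (4 * k ^ 2) / 4 * (1 / k ^ 2)) ^ 2 with hκ
  have hκ0 : 0 < κ := by positivity
  obtain ⟨ε, hε, hεδ, hεk, hεC⟩ : ∃ ε > 0, ε ≤ δ ∧ ε ≤ 1 / (16 * (k : ℝ) ^ 2) ∧
      ε ≤ κ / (16 * C) :=
    ⟨min δ (min (1 / (16 * (k : ℝ) ^ 2)) (κ / (16 * C))),
      lt_min hs.pos (lt_min (by positivity) (by positivity)), min_le_left _ _,
      (min_le_right _ _).trans (min_le_left _ _), (min_le_right _ _).trans (min_le_right _ _)⟩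
  obtain ⟨m, hm⟩ := exists_card_top_lower k hk hε (hεδ.trans hs.le_one)
  obtain ⟨E, hE⟩ := exists_nat_ge (4 * (k : ℝ) / ε)
  refine ⟨4 * (3 * B₀ + 3 + E) + 2 * (m * (8 * B₀ + 11 + 4 * M₀)) + 3 * B₀,
    fun d b c h hg ξ hξ hξ0 hξk P A B q hv hPB hKB => ?_⟩
  by_contra! hd
  have := hv.hPA; have := hv.hAB; have := hv.hBq; have := hv.hqd
  have hP := hv.one_le_P h hk hξk
  have hhalf := hv.half_le h hP
  have hNd : d ≤ 2 * (A - P) + 3 * B₀ := by omega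
  have hNd' : (d : ℝ) ≤ 2 * (A - P : ℕ) + 3 * B₀ := by exact_mod_cast hNd
  have hdE : 4 * (3 * (B₀ : ℝ) + 3 + E) ≤ d := by exact_mod_cast (by omega)
  have hd0 : (0 : ℝ) < d := by
    have : (0 : ℝ) ≤ B₀ := by positivity
    have : (0 : ℝ) ≤ E := by positivity
    linarith
  have hNlow : (d : ℝ) / 4 ≤ (A - P : ℕ) - 2 - 4 * k / ε := by linarith
  have hbig : ∀ θ, Top k ξ ε θ → d * C < sig k d b c θ := fun θ ht => by
    have e1 := hv.le_sig_of_edge h hk hs hξ hξ0 hP (by omega) hε hεδ hεk ht (by linarith)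
    rw [← hκ] at e1
    have e2 : κ * (d / 4) ≤ 2 * ε * sig k d b c θ := le_trans (by gcongr) e1
    rw [le_div_iff₀ (by positivity)] at hεC
    have e3 : 2 * ε * (d * C) < 2 * ε * sig k d b c θ := by
      refine lt_of_lt_of_le ?_ e2
      have e4 := mul_le_mul_of_nonneg_right hεC hd0.le
      have e5 := mul_pos hκ0 hd0
      linarith
    exact lt_of_mul_lt_mul_left e3 (by positivity)
  obtain ⟨hβ1, -⟩ := coup_bounds h hP (by omega)
  have hmid : ∀ t : ℝ, |t| ≤ k → |t - (k - ξ ^ 2 - 2 * √(b P * c P : ℝ))| ≤ 2 * √(b P * c P : ℝ) - δ' →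
      sig k d b c t ≤ d * C := fun t ht ht' => by
    refine (hv.sig_le_of_band h hk ht hP (by omega) hδ' hδ'1 ht').trans ?_
    have : (1 : ℝ) ≤ 6 * k ^ 2 := by nlinarith
    rw [hC]
    gcongr
    omega
  have hout := hv.card_outside_le h hP
  generalize √(b P * c P : ℝ) = β at *
  set S := (spec k d b c).filter fun t =>
        ∃ θ ∈ spec k d b c, Top k ξ ε θ ∧ sig k d b c t = sig k d b c θ with hS
  set T := (spec k d b c).filter fun t => Top k ξ ε t with hT
  have hn := hm d b c h hg ξ P A B q hv hP (by omega)
  have hTS : T ⊆ S := fun θ hθ => by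
    rw [hT, Finset.mem_filter] at hθ
    rw [hS, Finset.mem_filter]
    exact ⟨hθ.1, θ, hθ.1, hθ.2, rfl⟩
  have hconc := hM₀ S (fun θ hθ => ⟨hg.conjIn (Finset.filter_subset _ _) (fun t ht t' ht' he => by
      rw [Finset.mem_filter] at ht ⊢
      obtain ⟨-, θ, h1, h2, h3⟩ := ht
      exact ⟨ht', θ, h1, h2, he.trans h3⟩) hθ, hg.abs_le θ (Finset.filter_subset _ _ hθ)⟩)
  rw [← hT] at hn
  clear_value S T
  have h1 := hconc (S.filter fun t => t ∈ Set.Icc (k - ξ ^ 2 - δ') (k - ξ ^ 2))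
    (Finset.filter_subset _ _) (fun t ht t' ht' _ => by
      have e1 := (Finset.mem_filter.1 ht).2
      have e2 := (Finset.mem_filter.1 ht').2
      rw [Set.mem_Icc] at e1 e2
      exact abs_le.2 ⟨by linarith, by linarith⟩)
  have h2 := hconc (S.filter fun t =>
      t ∈ Set.Icc (k - ξ ^ 2 - 2 * β - 2 * β) (k - ξ ^ 2 - 2 * β - 2 * β + δ'))
    (Finset.filter_subset _ _) (fun t ht t' ht' _ => by
      have e1 := (Finset.mem_filter.1 ht).2
      have e2 := (Finset.mem_filter.1 ht').2
      rw [Set.mem_Icc] at e1 e2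
      exact abs_le.2 ⟨by linarith, by linarith⟩)
  have hcover : S ⊆ ((spec k d b c).filter fun t => ¬ |t - (k - ξ ^ 2 - 2 * β)| ≤ 2 * β) ∪
      ((S.filter fun t => t ∈ Set.Icc (k - ξ ^ 2 - δ') (k - ξ ^ 2)) ∪ (S.filter fun t =>
      t ∈ Set.Icc (k - ξ ^ 2 - 2 * β - 2 * β) (k - ξ ^ 2 - 2 * β - 2 * β + δ'))) := fun t ht => by
    have ht0 := ht
    rw [hS, Finset.mem_filter] at ht
    obtain ⟨hts, θ, -, hθ, he⟩ := ht
    rw [Finset.mem_union, Finset.mem_union, Finset.mem_filter, Finset.mem_filter,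
      Finset.mem_filter, Set.mem_Icc, Set.mem_Icc]
    by_cases hin : |t - (k - ξ ^ 2 - 2 * β)| ≤ 2 * β
    · right
      have hnot : ¬ |t - (k - ξ ^ 2 - 2 * β)| ≤ 2 * β - δ' := fun hcon =>
        absurd (hmid t (hg.abs_le t hts) hcon) (not_le.2 (he ▸ hbig θ hθ))
      rw [abs_le] at hin
      rw [not_le, lt_abs] at hnot
      rcases hnot with h3 | h3
      · exact Or.inl ⟨ht0, by linarith, by linarith⟩
      · exact Or.inr ⟨ht0, by linarith, by linarith⟩
    · exact Or.inl ⟨hts, hin⟩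
  have hcard := (Finset.card_le_card hcover).trans
    ((Finset.card_union_le _ _).trans (Nat.add_le_add_left (Finset.card_union_le _ _) _))
  have hcard' : (S.card : ℝ) ≤ (4 * B₀ + 5) + (1 / 4 * S.card + M₀ + (1 / 4 * S.card + M₀)) := by
    refine le_trans (Nat.cast_le.2 hcard) ?_
    push_cast
    refine add_le_add ?_ (add_le_add h1 h2)
    exact_mod_cast hout.trans (by omega)
  have hS2 : S.card ≤ 2 * (4 * B₀ + 5) + 4 * M₀ := by
    have : (S.card : ℝ) ≤ 2 * (4 * B₀ + 5) + 4 * M₀ := by linarith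
    exact_mod_cast this
  have hTc : T.card ≤ S.card := Finset.card_le_card hTS
  have hn' : (A - P) + (q - B) ≤ m * (T.card + 1) := by exact_mod_cast hn
  have : m * (T.card + 1) ≤ m * (8 * B₀ + 11 + 4 * M₀) := Nat.mul_le_mul_left _ (by omega)
  omega

end Level

private theorem slow_decrease {b c u : ℕ → ℝ} {P : ℕ} {τ ε : ℝ} (hτ : 0 ≤ τ) (hτε : τ ≤ ε)
    (hε : (P : ℝ) ^ 2 * ε ≤ 1 / 10) (hb : ∀ i < P, 1 ≤ b i) (hc : ∀ i < P, 0 ≤ c i ∧ c i ≤ b i)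
    (hu : u 0 = 1)
    (hrec : ∀ i < P, b i * (u i - u (i + 1)) = τ * u i + c i * (u (i - 1) - u i)) :
    ∀ i ≤ P, (1 - (i : ℝ) ^ 2 * ε ≤ u i ∧ u i ≤ 1) ∧
      (i < P → 0 ≤ u i - u (i + 1) ∧ u i - u (i + 1) ≤ (i + 1) * ε) := by
  have hε0 : 0 ≤ ε := hτ.trans hτε
  have step : ∀ i < P, 1 - (i : ℝ) ^ 2 * ε ≤ u i → u i ≤ 1 →
      0 ≤ c i * (u (i - 1) - u i) → c i * (u (i - 1) - u i) ≤ b i * (i * ε) →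
      0 ≤ u i - u (i + 1) ∧ u i - u (i + 1) ≤ (i + 1) * ε := by
    intro i hi h1 h2 h3 h4
    have hb1 := hb i hi
    have hiP : (i : ℝ) ^ 2 * ε ≤ (P : ℝ) ^ 2 * ε := by gcongr
    have hu0 : 0 ≤ u i := by linarith
    have e1 : 0 ≤ τ * u i := mul_nonneg hτ hu0
    have e2 : τ * u i ≤ b i * ε := by
      calc τ * u i ≤ τ * 1 := by gcongr
        _ ≤ 1 * ε := by linarith
        _ ≤ b i * ε := by gcongr
    have e3 := hrec i hi
    constructor
    · exact le_of_mul_le_mul_left (by rw [mul_zero, e3]; linarith) (by linarith : 0 < b i)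
    · exact le_of_mul_le_mul_left (by rw [e3]; linarith) (by linarith : 0 < b i)
  intro i hi
  induction i with
  | zero =>
    have h0 : (1 - ((0 : ℕ) : ℝ) ^ 2 * ε ≤ u 0 ∧ u 0 ≤ 1) := by simp [hu]
    refine ⟨h0, fun hlt => ?_⟩
    exact step 0 hlt h0.1 h0.2 (by simp) (by simp)
  | succ i ih =>
    obtain ⟨⟨h1, h2⟩, h3⟩ := ih (by omega)
    obtain ⟨h4, h5⟩ := h3 (by omega)
    have h6 : 1 - ((i + 1 : ℕ) : ℝ) ^ 2 * ε ≤ u (i + 1) ∧ u (i + 1) ≤ 1 := by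
      refine ⟨?_, by linarith⟩
      have : (0 : ℝ) ≤ i * ε := by positivity
      push_cast
      nlinarith
    refine ⟨h6, fun hlt => step (i + 1) hlt h6.1 h6.2 ?_ ?_⟩
    · exact mul_nonneg (hc _ hlt).1 (by simpa using h4)
    · rw [Nat.add_sub_cancel]
      push_cast
      exact mul_le_mul (hc _ hlt).2 h5 h4 (by linarith [hb _ hlt])

namespace IArray

variable {k d : ℕ} {b c : ℕ → ℕ}

theorem coupSeq_mul_stdSeq_valency (h : IArray k d b c) {i : ℕ} (hi : i < d) :
    coupSeq b c (i + 1) * stdSeq k b c k (i + 1) = b i * stdSeq k b c k i ∧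
      coupSeq b c (i + 1) * stdSeq k b c k i = c (i + 1) * stdSeq k b c k (i + 1) := by
  have key : ∀ j < d, coupSeq b c (j + 1) * stdSeq k b c k (j + 1) = b j * stdSeq k b c k j →
      coupSeq b c (j + 1) * stdSeq k b c k j = c (j + 1) * stdSeq k b c k (j + 1) := by
    intro j hj hcon
    have hb : (0 : ℝ) < b j := by exact_mod_cast h.b_pos j hj
    refine mul_left_cancel₀ hb.ne' ?_
    calc b j * (coupSeq b c (j + 1) * stdSeq k b c k j)
        = coupSeq b c (j + 1) * (b j * stdSeq k b c k j) := by ring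
      _ = coupSeq b c (j + 1) ^ 2 * stdSeq k b c k (j + 1) := by rw [← hcon]; ring
      _ = _ := by rw [coupSeq_sq]; ring
  refine ⟨?_, key i hi ?_⟩ <;>
  induction i with
  | zero =>
    have := h.stdSeq_rec k hi
    rw [this, h.coupSeq_zero, diagSeq, h.c_zero]
    push_cast; ring
  | succ i ih =>
    have e1 := key i (by omega) (ih (by omega))
    have e2 := h.stdSeq_rec k hi
    rw [Nat.add_sub_cancel, e1, diagSeq] at e2
    rw [e2]; ring

theorem stdSeq_valency_pos (h : IArray k d b c) {i : ℕ} (hi : i ≤ d) :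
    0 < stdSeq k b c k i := by
  induction i with
  | zero => simp [stdSeq, triSeq]
  | succ i ih =>
    have e1 := (h.coupSeq_mul_stdSeq_valency (i := i) (by omega)).1
    have e2 : (0 : ℝ) < b i := by exact_mod_cast h.b_pos i (by omega)
    have e3 : 0 < coupSeq b c (i + 1) * stdSeq k b c k (i + 1) := by
      rw [e1]; exact mul_pos e2 (ih (by omega))
    exact pos_of_mul_pos_right e3 (coupSeq_nonneg b c _)

theorem mul_sq_stdSeq_valency (h : IArray k d b c) {i : ℕ} (hi : i < d) :
    c (i + 1) * stdSeq k b c k (i + 1) ^ 2 = b i * stdSeq k b c k i ^ 2 := by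
  obtain ⟨e1, e2⟩ := h.coupSeq_mul_stdSeq_valency hi
  have e3 : 0 < coupSeq b c (i + 1) := h.coupling.pos _ (by omega) (by omega)
  refine mul_left_cancel₀ e3.ne' ?_
  calc coupSeq b c (i + 1) * (c (i + 1) * stdSeq k b c k (i + 1) ^ 2)
      = (coupSeq b c (i + 1) * stdSeq k b c k (i + 1)) * (c (i + 1) * stdSeq k b c k (i + 1)) := by
        ring
    _ = _ := by rw [e1, ← e2]; ring

/-- The ratio of the standard sequences at `θ` and at the valency satisfies the
usual three-term recurrence. -/
theorem ratio_rec (h : IArray k d b c) (θ : ℝ) {i : ℕ} (hi : i < d) :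
    b i * (stdSeq k b c θ i / stdSeq k b c k i - stdSeq k b c θ (i + 1) / stdSeq k b c k (i + 1)) =
      (k - θ) * (stdSeq k b c θ i / stdSeq k b c k i) +
      c i * (stdSeq k b c θ (i - 1) / stdSeq k b c k (i - 1) -
        stdSeq k b c θ i / stdSeq k b c k i) := by
  have s0 := h.stdSeq_valency_pos hi.le
  have s1 := h.stdSeq_valency_pos (i := i + 1) hi
  have s2 := h.stdSeq_valency_pos (i := i - 1) (by omega)
  have e1 := (h.coupSeq_mul_stdSeq_valency hi).1
  have e2 := h.stdSeq_rec θ hi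
  have e3 : coupSeq b c i * stdSeq k b c k (i - 1) = c i * stdSeq k b c k i := by
    rcases i with _ | i
    · simp [h.coupSeq_zero, h.c_zero]
    · exact (h.coupSeq_mul_stdSeq_valency (i := i) (by omega)).2
  have f1 : coupSeq b c (i + 1) * stdSeq k b c θ (i + 1) =
      b i * stdSeq k b c k i * (stdSeq k b c θ (i + 1) / stdSeq k b c k (i + 1)) := by
    rw [← e1]; field_simp
  have f2 : coupSeq b c i * stdSeq k b c θ (i - 1) =
      c i * stdSeq k b c k i * (stdSeq k b c θ (i - 1) / stdSeq k b c k (i - 1)) := by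
    rw [← e3]; field_simp
  have f3 : stdSeq k b c θ i = stdSeq k b c k i * (stdSeq k b c θ i / stdSeq k b c k i) := by
    field_simp
  rw [f1, f2, f3, diagSeq] at e2
  refine mul_left_cancel₀ s0.ne' ?_
  linear_combination -e2

end IArray

namespace Level

variable {k d : ℕ} {b c : ℕ → ℕ} {P A B q : ℕ} {δ ε θ : ℝ}

theorem eq_of_level_zero (hv : Level d b c 0 P A B q) : A = q := by
  have := hv.hAB; have := hv.hBq; have := hv.hqd
  by_contra hne
  have h1 := (hv.lt_q A (by omega)).1 (by omega)
  have h2 := mt (hv.lt_A A (by omega)).2 (by omega)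
  exact h2 (by linarith)

theorem b_eq_c_of_level_zero (hv : Level d b c 0 P A B q) (hPA : P < A) : b P = c P := by
  have := hv.hAB; have := hv.hBq; have := hv.hqd
  have h1 := hv.gap_left le_rfl hPA
  rw [gapSeq, sub_eq_zero, Real.sqrt_inj (by positivity) (by positivity)] at h1
  exact_mod_cast h1

theorem sq_stdSeq_valency_le (hv : Level d b c 0 P A B q) (h : IArray k d b c) (hPA : P < A)
    {i : ℕ} (hi : i ≤ d) : stdSeq k b c k i ^ 2 ≤ stdSeq k b c k P ^ 2 := by
  have := hv.hAB; have := hv.hBq; have := hv.hqd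
  have hbc := hv.b_eq_c_of_level_zero hPA
  have hinc : ∀ i < P, stdSeq k b c k i ^ 2 ≤ stdSeq k b c k (i + 1) ^ 2 := fun i hi => by
    have e1 := h.mul_sq_stdSeq_valency (i := i) (by omega)
    have e2 : c (i + 1) ≤ b i := by
      have := h.c_mono (i + 1) P (by omega) (by omega)
      have := h.b_anti i P (by omega) (by omega)
      omega
    have e3 : (0 : ℝ) < b i := by exact_mod_cast h.b_pos i (by omega)
    have e4 : (c (i + 1) : ℝ) ≤ b i := by exact_mod_cast e2
    refine le_of_mul_le_mul_left ?_ e3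
    rw [← e1]
    gcongr
  have hdec : ∀ i, P ≤ i → i < d → stdSeq k b c k (i + 1) ^ 2 ≤ stdSeq k b c k i ^ 2 :=
    fun i hi hid => by
      have e1 := h.mul_sq_stdSeq_valency hid
      have e2 : b i ≤ c (i + 1) := by
        have := h.c_mono P (i + 1) (by omega) (by omega)
        have := h.b_anti P i (by omega) (by omega)
        omega
      have e3 : (0 : ℝ) < c (i + 1) := by exact_mod_cast h.c_pos (i + 1) (by omega) (by omega)
      have e4 : (b i : ℝ) ≤ c (i + 1) := by exact_mod_cast e2
      refine le_of_mul_le_mul_left ?_ e3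
      rw [e1]
      gcongr
  rcases le_total i P with hiP | hiP
  · induction hiP using Nat.decreasingInduction with
    | self => exact le_rfl
    | of_succ i hi' ih => exact (hinc i hi').trans (ih (by omega))
  · induction i, hiP using Nat.le_induction with
    | base => exact le_rfl
    | succ i hi' ih => exact (hdec i hi' (by omega)).trans (ih (by omega))

theorem sig_valency_le (hv : Level d b c 0 P A B q) (h : IArray k d b c) (hPA : P < A) :
    sig k d b c k ≤ (d + 1) * stdSeq k b c k P ^ 2 := by
  have h1 : sig k d b c k ≤ ∑ _i ∈ Finset.range (d + 1), stdSeq k b c k P ^ 2 :=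
    Finset.sum_le_sum fun i hi => hv.sq_stdSeq_valency_le h hPA
      (Nat.lt_succ_iff.1 (Finset.mem_range.1 hi))
  rwa [Finset.sum_const, Finset.card_range, nsmul_eq_mul, Nat.cast_add, Nat.cast_one] at h1

theorem stdSeq_near_valency (hv : Level d b c 0 P A B q) (h : IArray k d b c) (hPA : P < A)
    (hε : (P : ℝ) ^ 2 * ε ≤ 1 / 10) (h1 : k - ε ≤ θ) (h2 : θ ≤ k) :
    9 / 10 * stdSeq k b c k P ≤ stdSeq k b c θ P := by
  have := hv.hAB; have := hv.hBq; have := hv.hqd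
  have hbc := hv.b_eq_c_of_level_zero hPA
  have h3 := ((slow_decrease (b := fun i => b i) (c := fun i => c i)
    (u := fun i => stdSeq k b c θ i / stdSeq k b c k i) (τ := k - θ) (ε := ε) (P := P)
    (by linarith) (by linarith) hε (fun i hi => by exact_mod_cast h.b_pos i (by omega))
    (fun i hi => ⟨by positivity, by
      have := h.c_mono i P (by omega) (by omega)
      have := h.b_anti i P (by omega) (by omega)
      exact_mod_cast (by omega)⟩) (by simp [stdSeq, triSeq])
    (fun i hi => h.ratio_rec θ (by omega))) P le_rfl).1.1
  rw [← le_div_iff₀ (h.stdSeq_valency_pos (by omega))]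
  linarith

theorem le_sig_near_valency (hv : Level d b c 0 P A B q) (h : IArray k d b c) (hP : 1 ≤ P)
    (hPA : P + 2 ≤ A) (hε : 0 < ε) (hε1 : ε ≤ 1) (ht : Top k 0 ε θ) :
    stdSeq k b c θ P ^ 2 * ((A - P : ℕ) - 2 - 4 * k / ε) ≤ 2 * sig k d b c θ := by
  have := hv.hAB; have := hv.hBq; have := hv.hqd
  obtain ⟨hβ1, hβk⟩ := coup_bounds h hP (by omega : P < d)
  have hlow := ht.lower
  have hupp := ht.upper
  have hsig : 0 ≤ sig k d b c θ := Finset.sum_nonneg fun _ _ => sq_nonneg _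
  rcases le_or_gt (((A - P : ℕ) : ℝ) - 2 - 4 * k / ε) 0 with hN | hN
  · exact (mul_nonpos_of_nonneg_of_nonpos (sq_nonneg _) hN).trans (by linarith)
  have e3 := (hv.left_run h).le_sig h hβ1 hβk hε hε1 (θ := θ) (by linarith) (by linarith) hPA
  have hx : (θ - (k - 0 ^ 2 - 2 * √(b P * c P : ℝ))) / (2 * √(b P * c P : ℝ)) =
      1 - (k - θ) / (2 * √(b P * c P : ℝ)) := by
    field_simp; ring
  rw [hx] at e3
  generalize √(b P * c P : ℝ) = β at *
  have hy0 : 0 < (k - θ) / (2 * β) := div_pos (by linarith) (by linarith)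
  have hy1 : (k - θ) / (2 * β) ≤ 1 := by
    rw [div_le_one (by linarith)]; linarith
  have hx1 : 0 < 1 - (1 - (k - θ) / (2 * β)) ^ 2 := by nlinarith
  generalize 1 - (k - θ) / (2 * β) = x at *
  generalize (((A - P : ℕ) : ℝ) - 2 - 4 * k / ε) = N at *
  refine le_of_mul_le_mul_left ?_ hx1
  calc (1 - x ^ 2) * (stdSeq k b c θ P ^ 2 * N)
      ≤ (stdSeq k b c θ P ^ 2 + stdSeq k b c θ (P + 1) ^ 2
        - 2 * x * stdSeq k b c θ P * stdSeq k b c θ (P + 1)) * N := by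
        rw [← mul_assoc]
        gcongr
        nlinarith [sq_nonneg (stdSeq k b c θ (P + 1) - x * stdSeq k b c θ P)]
    _ ≤ _ := by linarith

open Classical in
/-- If eigenvalues close to the valency have multiplicity at least three, and the run at level
zero makes up all but a bounded part of the array, then the diameter is bounded. -/
theorem exists_diam_le_of_zero (hk : 1 ≤ k) {η : ℝ} (hη : 0 < η) (B₀ : ℕ) :
    ∃ D : ℕ, ∀ d b c, IArray k d b c → GaloisClosed k d b c →
      (∀ θ ∈ spec k d b c, k - η < θ → θ < k → 3 * sig k d b c θ ≤ sig k d b c k) →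
      ∀ P A B q, Level d b c 0 P A B q → P ≤ B₀ → d ≤ D := by
  have hk' : (1 : ℝ) ≤ k := by exact_mod_cast hk
  obtain ⟨ε, hε, hε1, hεη, hεB⟩ : ∃ ε > 0, ε ≤ 1 ∧ ε < η ∧ (B₀ : ℝ) ^ 2 * ε ≤ 1 / 10 := by
    refine ⟨min 1 (min (η / 2) (1 / (10 * ((B₀ : ℝ) ^ 2 + 1)))), by positivity, min_le_left _ _,
      ((min_le_right _ _).trans (min_le_left _ _)).trans_lt (by linarith), ?_⟩
    have h1 : min 1 (min (η / 2) (1 / (10 * ((B₀ : ℝ) ^ 2 + 1)))) ≤ 1 / (10 * ((B₀ : ℝ) ^ 2 + 1)) :=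
      (min_le_right _ _).trans (min_le_right _ _)
    rw [le_div_iff₀ (by positivity)] at h1
    have h2 : 0 < min 1 (min (η / 2) (1 / (10 * ((B₀ : ℝ) ^ 2 + 1)))) := by positivity
    linarith
  obtain ⟨m, hm⟩ := exists_card_top_lower k hk hε hε1
  obtain ⟨E, hE⟩ := exists_nat_ge (4 * (k : ℝ) / ε)
  refine ⟨5 * (2 + 3 * (2 * B₀ + 2 + E)) + m, fun d b c h hg h3 P A B q hv hPB => ?_⟩
  by_contra! hd
  have := hv.hPA; have := hv.hAB; have := hv.hBq; have := hv.hqd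
  have hP := hv.one_le_P h hk (by positivity)
  have htail := hv.tail_le h hP
  have hAq := hv.eq_of_level_zero
  have hn := hm d b c h hg 0 P A B q hv hP (by omega)
  have hne : ((spec k d b c).filter fun t => Top k 0 ε t).Nonempty := by
    rw [Finset.nonempty_iff_ne_empty]
    intro he
    rw [he, Finset.card_empty, Nat.cast_zero, zero_add, mul_one] at hn
    have : (A - P) + (q - B) ≤ m := by exact_mod_cast hn
    omega
  obtain ⟨θ, hθ⟩ := hne
  obtain ⟨hθs, ht⟩ := Finset.mem_filter.1 hθ
  have hlow := ht.lower
  have hupp := ht.upper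
  have e1 := h3 θ hθs (by linarith) (by linarith)
  have e2 := hv.le_sig_near_valency h hP (by omega) hε hε1 ht
  have e3 := hv.sig_valency_le h (by omega)
  have hPB' : (P : ℝ) ^ 2 * ε ≤ (B₀ : ℝ) ^ 2 * ε := by gcongr
  have e4 := hv.stdSeq_near_valency h (by omega) (hPB'.trans hεB) (θ := θ) (by linarith)
    (by linarith)
  have hs := h.stdSeq_valency_pos (i := P) (by omega)
  have hN : (d : ℝ) ≤ (A - P : ℕ) + 2 * B₀ := by exact_mod_cast (by omega)
  have hD : 5 * (2 + 3 * (2 * (B₀ : ℝ) + 2 + E)) + 1 ≤ d := by exact_mod_cast (by omega)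
  have hB0 : (0 : ℝ) ≤ B₀ := by positivity
  have hE0 : (0 : ℝ) ≤ E := by positivity
  have e5 : (81 / 100 * stdSeq k b c k P ^ 2) * ((A - P : ℕ) - 2 - 4 * k / ε) ≤
      2 * sig k d b c θ := by
    refine le_trans ?_ e2
    gcongr
    · linarith
    · nlinarith
  have hs2 : 0 < stdSeq k b c k P ^ 2 := by positivity
  have e6 : stdSeq k b c k P ^ 2 * (3 * (81 / 100 * (((A - P : ℕ) : ℝ) - 2 - 4 * k / ε))) ≤
      stdSeq k b c k P ^ 2 * (2 * (d + 1)) := by linarith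
  have e7 := le_of_mul_le_mul_left e6 hs2
  linarith

end Level

open Classical in
/-- The number of positions at which `gapSeq` has absolute value `ξ`. -/
noncomputable def levelCount (d : ℕ) (b c : ℕ → ℕ) (ξ : ℝ) : ℕ :=
  ((Finset.range d).filter fun i => |gapSeq b c i| = ξ).card

open Classical in
theorem IArray.card_filter_eq_sum_levelCount {k d : ℕ} {b c : ℕ → ℕ} (h : IArray k d b c)
    (p : ℝ → Prop) :
    ((Finset.range d).filter fun i => p |gapSeq b c i|).card =
      ∑ ξ ∈ (gapSet k).filter p, levelCount d b c ξ := by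
  rw [Finset.card_eq_sum_card_fiberwise (f := fun i => |gapSeq b c i|) (t := (gapSet k).filter p)]
  · refine Finset.sum_congr rfl fun ξ hξ => ?_
    rw [levelCount, Finset.filter_filter]
    congr 1
    ext i
    simp only [Finset.mem_filter, and_congr_right_iff, and_iff_right_iff_imp]
    rintro - rfl
    exact (Finset.mem_filter.1 hξ).2
  · intro i hi
    simp only [Finset.coe_filter, Finset.mem_range, Set.mem_ofPred_eq] at hi ⊢
    exact ⟨h.abs_gapSeq_mem hi.1.le, hi.2⟩

open Classical in
theorem IArray.sum_levelCount {k d : ℕ} {b c : ℕ → ℕ} (h : IArray k d b c) :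
    ∑ ξ ∈ gapSet k, levelCount d b c ξ = d := by
  have := h.card_filter_eq_sum_levelCount fun _ => True
  simpa using this.symm

namespace Level

variable {k d : ℕ} {b c : ℕ → ℕ} {ξ δ : ℝ} {P A B q : ℕ}

theorem levelCount_eq (hv : Level d b c ξ P A B q) (hξ : 0 ≤ ξ) :
    levelCount d b c ξ = (A - P) + (q - B) := by
  classical
  have := hv.hPA; have := hv.hAB; have := hv.hBq; have := hv.hqd
  have : (Finset.range d).filter (fun i => |gapSeq b c i| = ξ) = Finset.Ico P A ∪ Finset.Ico B q := by
    ext i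
    rw [Finset.mem_filter, Finset.mem_union, Finset.mem_Ico, Finset.mem_Ico, Finset.mem_range]
    constructor
    · rintro ⟨hi, he⟩
      rcases eq_or_eq_neg_of_abs_eq he with h1 | h1
      · left
        have h2 := mt (hv.lt_P i hi).1 (by rw [h1]; exact lt_irrefl _)
        have h3 := (hv.lt_A i hi).2 h1.ge
        omega
      · have h3 := (hv.lt_q i hi).2 h1.ge
        by_cases h4 : i < B
        · left
          rcases (hv.lt_B i hi).1 h4 with h5 | h5
          · have h6 := mt (hv.lt_P i hi).1 (by linarith)
            have h7 := (hv.lt_A i hi).2 h5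
            omega
          · exact absurd h5 (by rw [h1]; exact lt_irrefl _)
        · right; omega
    · rintro (hi | hi)
      · exact ⟨by omega, by rw [hv.gap_left hi.1 hi.2, abs_of_nonneg hξ]⟩
      · exact ⟨by omega, by rw [hv.gap_right hi.1 hi.2, abs_neg, abs_of_nonneg hξ]⟩
  rw [levelCount, this, Finset.card_union_of_disjoint (Finset.disjoint_left.2 fun i hi hi' => by
      rw [Finset.mem_Ico] at hi hi'; omega), Nat.card_Ico, Nat.card_Ico]

open Classical in
theorem sum_levelCount_lt (hv : Level d b c ξ P A B q) (h : IArray k d b c) :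
    ∑ ξ' ∈ (gapSet k).filter (· < ξ), levelCount d b c ξ' = B - A := by
  have := hv.hPA; have := hv.hAB; have := hv.hBq; have := hv.hqd
  rw [← h.card_filter_eq_sum_levelCount fun x => x < ξ, ← Nat.card_Ico]
  congr 1
  ext i
  rw [Finset.mem_filter, Finset.mem_range, Finset.mem_Ico, abs_lt]
  constructor
  · rintro ⟨hi, h1, h2⟩
    have h3 := mt (hv.lt_A i hi).1 (by linarith)
    have h4 := (hv.lt_B i hi).2 (Or.inr h1)
    omega
  · rintro ⟨h1, h2⟩
    have hi : i < d := by omega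
    have h3 := mt (hv.lt_A i hi).2 (by omega)
    have h4 := (hv.lt_B i hi).1 h2
    rw [not_le] at h3
    exact ⟨hi, h4.resolve_left (by linarith), h3⟩

theorem pow_le_sig (hv : Level d b c ξ P A B q) (h : IArray k d b c) (hk : 1 ≤ k)
    (hs : GapSep k δ) (hξ : ξ ∈ gapSet k) (hP : 1 ≤ P) {θ : ℝ} (ht : Top k ξ δ θ) :
    (1 + δ / (3 * k)) ^ (2 * (P - 1)) ≤ sig k d b c θ := by
  have := hv.hPA; have := hv.hAB; have := hv.hBq; have := hv.hqd
  have hpos := hv.stdSeq_pos h hk hs hξ hP ht.lower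
  have hρ : 0 ≤ 1 + δ / (3 * k) := by
    have := hs.pos
    positivity
  have key : ∀ i < P, (1 + δ / (3 * k)) ^ i ≤ stdSeq k b c θ i := by
    intro i hi
    induction i with
    | zero => simp [stdSeq, triSeq]
    | succ i ih =>
      rw [pow_succ']
      exact (mul_le_mul_of_nonneg_left (ih (by omega)) hρ).trans (hpos.2 i hi)
  rw [mul_comm 2 (P - 1), pow_mul]
  refine (pow_le_pow_left₀ (by positivity) (key (P - 1) (by omega)) 2).trans ?_
  exact Finset.single_le_sum (f := fun i => stdSeq k b c θ i ^ 2) (fun _ _ => sq_nonneg _)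
    (Finset.mem_range.2 (by omega))

theorem exists_pow_bound {ρ : ℝ} (hρ : 1 < ρ) (C : ℝ) :
    ∃ n₀ : ℕ, ∀ n ≥ n₀, C * (n : ℝ) ^ 5 < ρ ^ n := by
  have h1 := (tendsto_pow_const_div_const_pow_of_one_lt 5 hρ).const_mul C
  rw [mul_zero] at h1
  obtain ⟨n₀, hn₀⟩ := eventually_atTop.1 (h1.eventually_lt_const one_pos)
  refine ⟨n₀, fun n hn => ?_⟩
  have := hn₀ n hn
  rwa [← mul_div_assoc, div_lt_one (by positivity)] at this

open Classical in
/-- The middle segment of a level cannot be long unless it, or the initial segment, makes up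
a positive proportion of the array. -/
theorem exists_lt_mul_of_middle (hk : 1 ≤ k) (hs : GapSep k δ) (Λ : ℕ) :
    ∃ D K₀ : ℕ, ∀ d b c, IArray k d b c → GaloisClosed k d b c → ∀ ξ ∈ gapSet k, ξ < √k →
      ∀ P A B q, Level d b c ξ P A B q → K₀ ≤ B - A → P ≤ Λ * (B - A) →
      D * P ≤ d → d < D * (B - A) := by
  have hk' : (1 : ℝ) ≤ k := by exact_mod_cast hk
  have hδ := hs.pos
  set ρ : ℝ := 1 + δ / (3 * k) with hρ
  have hρ1 : 1 < ρ := by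
    have : 0 < δ / (3 * k) := by positivity
    linarith
  obtain ⟨s, hsG⟩ := pow_unbounded_of_one_lt (6 * (k : ℝ) ^ 2) hρ1
  obtain ⟨n₀, hn₀⟩ := exists_pow_bound hρ1 (((6 * (k : ℝ) ^ 2) ^ 2 * 18) ^ 2 * 4 ^ 5)
  set r := (gapSet k).card with hr
  obtain ⟨J, M, hα⟩ := exists_card_lt hk hs (r * (3 * Λ + 6))
  refine ⟨32 * s + 8 * J + 8, r * M + M + n₀ + 1,
    fun d b c h hg ξ hξ hξk P A B q hv hK hPK hDP => ?_⟩
  by_contra! hDK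
  have := hv.hPA; have := hv.hAB; have := hv.hBq; have := hv.hqd
  have hP := hv.one_le_P h hk hξk
  have hhalf := hv.half_le h hP
  have hK1 : 32 * (s * (B - A)) ≤ d := le_trans (by nlinarith) hDK
  have hK2 : 8 * (J * (B - A)) ≤ d := le_trans (by nlinarith) hDK
  have hK3 : 8 * (B - A) ≤ d := le_trans (by nlinarith) hDK
  have hP1 : 32 * (s * P) ≤ d := le_trans (by nlinarith) hDP
  have hP3 : 8 * P ≤ d := le_trans (by nlinarith) hDP
  have hsum := hv.sum_levelCount_lt h
  obtain ⟨j, hj, hjc⟩ : ∃ j ∈ (gapSet k).filter (· < ξ), B - A ≤ r * levelCount d b c j := by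
    by_contra! hcon
    have h1 : ∑ ξ' ∈ (gapSet k).filter (· < ξ), (r * levelCount d b c ξ' + 1) ≤
        ∑ ξ' ∈ (gapSet k).filter (· < ξ), (B - A) := Finset.sum_le_sum fun x hx => hcon x hx
    rw [Finset.sum_add_distrib, ← Finset.mul_sum, hsum, Finset.sum_const, Finset.sum_const,
      smul_eq_mul, smul_eq_mul] at h1
    have h2 : ((gapSet k).filter (· < ξ)).card ≤ r := Finset.card_filter_le _ _
    have h3 : ((gapSet k).filter (· < ξ)).card * (B - A) ≤ r * (B - A) :=
      Nat.mul_le_mul_right _ h2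
    have h4 : ((gapSet k).filter (· < ξ)).Nonempty := by
      rw [Finset.nonempty_iff_ne_empty]
      intro he
      rw [he, Finset.sum_empty] at hsum
      omega
    have := h4.card_pos
    omega
  obtain ⟨hjk, hjξ⟩ := Finset.mem_filter.1 hj
  have hj0 := gapSet_nonneg hjk
  obtain ⟨P', A', B', q', hv'⟩ := h.exists_level hj0
  rw [hv'.levelCount_eq hj0] at hjc
  have := hv'.hPA; have := hv'.hAB; have := hv'.hBq; have := hv'.hqd
  have hAP' : A ≤ P' := by
    by_contra! hcon
    have h1 := (hv.lt_A (A - 1) (by omega)).1 (by omega)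
    have h2 := mt (hv'.lt_P (A - 1) (by omega)).2 (by omega)
    exact h2 (hjξ.trans_le h1)
  have hBB' : B' ≤ B := by
    by_contra! hcon
    have h1 := (hv'.lt_B (B' - 1) (by omega)).1 (by omega)
    have h2 := mt (hv.lt_B (B' - 1) (by omega)).2 (by omega)
    rw [not_or, not_le, not_lt] at h2
    rcases h1 with h1 | h1 <;> linarith
  have hn' : M ≤ (A' - P') + (q' - B') := by
    by_contra! hcon
    have := Nat.mul_le_mul_left r hcon.le
    omega
  have hJ' : J * (B' - A') ≤ J * (B - A) := Nat.mul_le_mul_left _ (by omega)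
  have hcard := hα d b c h hg j hjk P' A' B' q' hv' (by omega) (by omega) hn'
  have hsub : ((spec k d b c).filter fun t =>
      ∃ θ ∈ spec k d b c, Top k j δ θ ∧ sig k d b c t = sig k d b c θ) ⊆
      (spec k d b c).filter fun t =>
      ¬ |t - (k - ξ ^ 2 - 2 * √(b P * c P : ℝ))| ≤ 2 * √(b P * c P : ℝ) := by
    intro t ht
    obtain ⟨hts, θ, -, hθ, he⟩ := Finset.mem_filter.1 ht
    refine Finset.mem_filter.2 ⟨hts, fun hband => ?_⟩
    have e1 := hv.sig_le_of_closed_band h hk (hg.abs_le t hts) hP (by omega) hband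
    have e2 := hv'.pow_le_sig h hk hs hjk (by omega) hθ
    rw [← hρ, ← he] at e2
    have e3 := e2.trans e1
    have hm := hn₀ (d / 2) (by omega)
    have hd4 : (d : ℝ) ≤ 4 * (d / 2 : ℕ) := by exact_mod_cast (by omega)
    have e4 : (d : ℝ) * (((6 * (k : ℝ) ^ 2) ^ 2 * (18 * (d : ℝ) ^ 2)) ^ 2 *
        (6 * (k : ℝ) ^ 2) ^ (3 * P + (B - A))) ≤
        ((6 * (k : ℝ) ^ 2) ^ 2 * 18) ^ 2 * 4 ^ 5 * ((d / 2 : ℕ) : ℝ) ^ 5 *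
          ρ ^ (s * (3 * P + (B - A))) := by
      calc _ = ((6 * (k : ℝ) ^ 2) ^ 2 * 18) ^ 2 * (d : ℝ) ^ 5 *
            (6 * (k : ℝ) ^ 2) ^ (3 * P + (B - A)) := by ring
        _ ≤ ((6 * (k : ℝ) ^ 2) ^ 2 * 18) ^ 2 * (4 * (d / 2 : ℕ)) ^ 5 *
            (ρ ^ s) ^ (3 * P + (B - A)) := by gcongr
        _ = _ := by rw [← pow_mul]; ring
    have e5 : ρ ^ (d / 2) * ρ ^ (s * (3 * P + (B - A))) ≤ ρ ^ (2 * (P' - 1)) := by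
      rw [← pow_add]
      refine pow_le_pow_right₀ hρ1.le ?_
      rw [mul_add, mul_left_comm]
      omega
    have e6 : 0 < ρ ^ (s * (3 * P + (B - A))) := by positivity
    have e7 := mul_lt_mul_of_pos_right hm e6
    linarith
  have hout := (Finset.card_le_card hsub).trans (hv.card_outside_le h hP)
  have e1 : 3 * P + (B - A) + 5 ≤ (3 * Λ + 6) * (B - A) := by
    have : (3 * Λ + 6) * (B - A) = 3 * (Λ * (B - A)) + 6 * (B - A) := by ring
    omega
  have e2 := Nat.mul_le_mul_left (3 * Λ + 6) hjc
  have e3 : (3 * Λ + 6) * (r * ((A' - P') + (q' - B'))) =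
      r * (3 * Λ + 6) * ((A' - P') + (q' - B')) := by ring
  omega

end Level

/-- Among finitely many nonnegative weights, some weight dominates the total of all smaller
levels by any prescribed factor, depending on the proportion this weight has. -/
theorem exists_dominant_level (g : ℕ → ℕ) (Ξ : Finset ℝ) (τ₀ : ℕ) :
    ∃ T : ℕ, ∀ (n : ℝ → ℕ) (d : ℕ), 1 ≤ d → d ≤ τ₀ * ∑ ξ ∈ Ξ, n ξ →
      ∃ ξ ∈ Ξ, ∃ τ ≤ T, d ≤ τ * n ξ ∧ g τ * ∑ ξ' ∈ Ξ.filter (· < ξ), n ξ' ≤ d := by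
  induction Ξ using Finset.induction_on_max generalizing τ₀ with
  | empty => exact ⟨0, fun n d h1 h2 => by simp at h2; omega⟩
  | insert a s ha ih =>
    obtain ⟨T, hT⟩ := ih (max (2 * τ₀) (g (2 * τ₀)))
    have has : a ∉ s := fun h => lt_irrefl _ (ha a h)
    refine ⟨max (2 * τ₀) T, fun n d h1 h2 => ?_⟩
    rw [Finset.sum_insert has] at h2
    have hself : (insert a s).filter (· < a) = s := by
      rw [Finset.filter_insert, if_neg (lt_irrefl a), Finset.filter_true_of_mem ha]
    by_cases hcase : d ≤ 2 * τ₀ * n a ∧ g (2 * τ₀) * ∑ ξ' ∈ s, n ξ' ≤ d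
    · exact ⟨a, Finset.mem_insert_self _ _, 2 * τ₀, le_max_left _ _, hcase.1, by
        rw [hself]; exact hcase.2⟩
    · have h3 : d ≤ max (2 * τ₀) (g (2 * τ₀)) * ∑ ξ' ∈ s, n ξ' := by
        rw [not_and_or, not_le, not_le] at hcase
        rcases hcase with h3 | h3
        · refine le_trans ?_ (Nat.mul_le_mul_right _ (le_max_left _ _))
          rw [mul_add] at h2
          rw [mul_assoc] at h3 ⊢
          omega
        · exact h3.le.trans (Nat.mul_le_mul_right _ (le_max_right _ _))
      obtain ⟨ξ, hξ, τ, hτ, h4, h5⟩ := hT n d h1 h3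
      refine ⟨ξ, Finset.mem_insert_of_mem hξ, τ, hτ.trans (le_max_right _ _), h4, ?_⟩
      rwa [Finset.filter_insert, if_neg (ha ξ hξ).not_gt]

namespace IArray

variable {k d : ℕ} {b c : ℕ → ℕ}

theorem levelCount_le_one (h : IArray k d b c) {ξ : ℝ} (hξ : √k ≤ ξ) :
    levelCount d b c ξ ≤ 1 := by
  classical
  have : (Finset.range d).filter (fun i => |gapSeq b c i| = ξ) ⊆ {0} := by
    intro i hi
    obtain ⟨hid, he⟩ := Finset.mem_filter.1 hi
    rw [Finset.mem_range] at hid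
    rw [Finset.mem_singleton]
    by_contra hi0
    have hb : 0 < √(b i : ℝ) := Real.sqrt_pos.2 (by exact_mod_cast h.b_pos i hid)
    have hc : 0 < √(c i : ℝ) :=
      Real.sqrt_pos.2 (by exact_mod_cast h.c_pos i (by omega) hid.le)
    have hb' : √(b i : ℝ) ≤ √k := Real.sqrt_le_sqrt (by exact_mod_cast h.b_le hid.le)
    have hc' : √(c i : ℝ) ≤ √k := Real.sqrt_le_sqrt (by exact_mod_cast h.c_le hid.le)
    have : |gapSeq b c i| < √k := abs_lt.2 ⟨by unfold gapSeq; linarith, by unfold gapSeq; linarith⟩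
    linarith
  exact (Finset.card_le_card this).trans (by simp)

end IArray

namespace Level

variable {k : ℕ} {δ η : ℝ}

theorem exists_diam_le_of_balanced (hk : 1 ≤ k) (hs : GapSep k δ) (hη : 0 < η) (B₀ : ℕ) :
    ∃ D : ℕ, ∀ d b c, IArray k d b c → GaloisClosed k d b c →
      (∀ θ ∈ spec k d b c, k - η < θ → θ < k → 3 * sig k d b c θ ≤ sig k d b c k) →
      ∀ ξ ∈ gapSet k, ξ < √k →
      ∀ P A B q, Level d b c ξ P A B q → P ≤ B₀ → B - A ≤ B₀ → d ≤ D := by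
  obtain ⟨D₁, h₁⟩ := exists_diam_le_of_pos hk hs B₀
  obtain ⟨D₂, h₂⟩ := exists_diam_le_of_zero hk hη B₀
  refine ⟨max D₁ D₂, fun d b c h hg h3 ξ hξ hξk P A B q hv hP hK => ?_⟩
  rcases (gapSet_nonneg hξ).eq_or_lt with rfl | hξ0
  · exact (h₂ d b c h hg h3 P A B q hv hP).trans (le_max_right _ _)
  · exact (h₁ d b c h hg ξ hξ hξ0 hξk P A B q hv hP hK).trans (le_max_left _ _)

end Level

/-- The diameter of an intersection array is bounded in terms of the valency, provided the
eigenvalues satisfy the Galois symmetry and those near the valency are at least triple. -/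
theorem exists_diam_le {k : ℕ} (hk : 1 ≤ k) {η : ℝ} (hη : 0 < η) :
    ∃ D : ℕ, ∀ d b c, IArray k d b c → GaloisClosed k d b c →
      (∀ θ ∈ spec k d b c, k - η < θ → θ < k → 3 * sig k d b c θ ≤ sig k d b c k) → d ≤ D := by
  classical
  obtain ⟨δ, hs⟩ := exists_gapSep k
  obtain ⟨J₁, M₁, hα₁⟩ := Level.exists_card_lt hk hs 3
  obtain ⟨D, K₀, hmid⟩ := Level.exists_lt_mul_of_middle hk hs (M₁ + J₁)
  choose J M hα using fun τ => Level.exists_card_lt hk hs (2 * τ)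
  obtain ⟨D₁, hbal⟩ := Level.exists_diam_le_of_balanced hk hs hη (M₁ + J₁ * K₀ + K₀)
  obtain ⟨T, hT⟩ := exists_dominant_level (fun τ => (D + 8) * (J τ + 1)) (gapSet k) 1
  refine ⟨D₁ + T + 8 + ∑ τ ∈ Finset.range (T + 1), (D + 8 + τ) * (M τ + M₁),
    fun d b c h hg h3 => ?_⟩
  by_contra! hd
  obtain ⟨ξ, hξ, τ, hτ, hn, hK⟩ := hT (levelCount d b c) d (by omega) (by
    rw [h.sum_levelCount, one_mul])
  have hτd : (D + 8 + τ) * (M τ + M₁) < d := by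
    have := Finset.single_le_sum (f := fun τ => (D + 8 + τ) * (M τ + M₁)) (fun _ _ => Nat.zero_le _)
      (Finset.mem_range.2 (by omega : τ < T + 1))
    omega
  have hξk : ξ < √k := by
    by_contra! hcon
    have := Nat.mul_le_mul_left τ (h.levelCount_le_one hcon)
    omega
  obtain ⟨P, A, B, q, hv⟩ := h.exists_level (gapSet_nonneg hξ)
  rw [hv.levelCount_eq (gapSet_nonneg hξ)] at hn
  rw [hv.sum_levelCount_lt h] at hK
  have := hv.hPA; have := hv.hAB; have := hv.hBq; have := hv.hqd
  have htail := hv.tail_le h (hv.one_le_P h hk hξk)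
  have hle : ∀ {S : Finset ℝ}, S ⊆ spec k d b c → S.card ≤ d + 1 := fun hS =>
    (Finset.card_le_card hS).trans (card_triSpecF h.coupling).le
  have hD8 : 8 * (B - A) + D * (B - A) ≤ d := by
    refine le_trans ?_ hK
    calc 8 * (B - A) + D * (B - A) = (D + 8) * 1 * (B - A) := by ring
      _ ≤ _ := Nat.mul_le_mul_right _ (Nat.mul_le_mul_left _ (by omega))
  have hMτ : τ * (M τ + M₁) < d := lt_of_le_of_lt (Nat.mul_le_mul_right _ (by omega)) hτd
  have hMn : M τ + M₁ < (A - P) + (q - B) := lt_of_mul_lt_mul_left (hMτ.trans_le hn) (Nat.zero_le _)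
  by_cases hPd : d ≤ (D + 8) * P
  · have e1 : M τ + M₁ < P := by
      refine lt_of_mul_lt_mul_left (lt_of_lt_of_le ?_ hPd) (Nat.zero_le (D + 8))
      exact lt_of_le_of_lt (Nat.mul_le_mul_right _ (by omega)) hτd
    have e2 : J τ * (B - A) ≤ P := by
      refine le_of_mul_le_mul_left (le_trans ?_ (hK.trans hPd)) (by omega : 0 < D + 8)
      rw [← mul_assoc]
      exact Nat.mul_le_mul_right _ (Nat.mul_le_mul_left _ (by omega))
    have e3 := hα τ d b c h hg ξ hξ P A B q hv (by omega) e2 (by omega)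
    have e4 := e3.trans_le (hle (Finset.filter_subset _ _))
    rw [mul_assoc] at e4
    omega
  · rw [not_le, add_mul] at hPd
    by_cases hα' : M₁ ≤ P ∧ J₁ * (B - A) ≤ P
    · have e3 := hα₁ d b c h hg ξ hξ P A B q hv hα'.1 hα'.2 (by omega)
      have e4 := e3.trans_le (hle (Finset.filter_subset _ _))
      omega
    · by_cases hK₀ : K₀ + 1 ≤ B - A
      · have e1 : P ≤ (M₁ + J₁) * (B - A) := by
          have : M₁ * 1 ≤ M₁ * (B - A) := Nat.mul_le_mul_left _ (by omega)
          rw [add_mul]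
          omega
        have := hmid d b c h hg ξ hξ hξk P A B q hv (by omega) e1 (by omega)
        omega
      · have : J₁ * (B - A) ≤ J₁ * K₀ := Nat.mul_le_mul_left _ (by omega)
        have := hbal d b c h hg h3 ξ hξ hξk P A B q hv (by omega) (by omega)
        omega

namespace DRG

variable (Γ : DRG)

theorem exists_adj_dist {x y : Γ.X} {n : ℕ} (h : Γ.G.dist x y = n + 1) :
    ∃ z, Γ.G.Adj y z ∧ Γ.G.dist x z = n := by
  obtain ⟨p, hp⟩ := Γ.conn.exists_walk_length_eq_dist y x
  rw [SimpleGraph.dist_comm, h] at hp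
  cases p with
  | nil => simp at hp
  | cons hadj p =>
    rename_i z
    refine ⟨z, hadj, ?_⟩
    have h1 : Γ.G.dist z x ≤ n := by
      refine (SimpleGraph.dist_le p).trans ?_
      simpa using hp.le
    have h2 : Γ.G.dist x y ≤ Γ.G.dist x z + Γ.G.dist z y := Γ.conn.dist_triangle
    rw [SimpleGraph.dist_comm] at h1
    rw [SimpleGraph.dist_comm (u := z), SimpleGraph.dist_eq_one_iff_adj.2 hadj] at h2
    omega

theorem exists_dist_between {x y : Γ.X} {i j : ℕ} (h : Γ.G.dist x y = i + j) :
    ∃ z, Γ.G.dist x z = i ∧ Γ.G.dist z y = j := by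
  induction j generalizing y with
  | zero => exact ⟨y, h, SimpleGraph.dist_self⟩
  | succ j ih =>
    obtain ⟨w, hw, hxw⟩ := Γ.exists_adj_dist (n := i + j) h
    obtain ⟨z, h1, h2⟩ := ih hxw
    refine ⟨z, h1, ?_⟩
    have h3 : Γ.G.dist z y ≤ Γ.G.dist z w + Γ.G.dist w y := Γ.conn.dist_triangle
    have h4 : Γ.G.dist x y ≤ Γ.G.dist x z + Γ.G.dist z y := Γ.conn.dist_triangle
    rw [SimpleGraph.dist_comm (u := w), SimpleGraph.dist_eq_one_iff_adj.2 hw] at h3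
    omega

theorem exists_dist_eq {i : ℕ} (hi : i ≤ Γ.d) : ∃ x y : Γ.X, Γ.G.dist x y = i := by
  obtain ⟨x, y, h⟩ := Γ.dist_eq
  obtain ⟨z, hz, -⟩ := Γ.exists_dist_between (x := x) (y := y) (i := i) (j := Γ.d - i) (by omega)
  exact ⟨x, z, hz⟩

variable {Γ} in
theorem dist_adj {x y z : Γ.X} (h : Γ.G.Adj y z) :
    Γ.G.dist x z ≤ Γ.G.dist x y + 1 ∧ Γ.G.dist x y ≤ Γ.G.dist x z + 1 := by
  have h1 : Γ.G.dist x z ≤ Γ.G.dist x y + Γ.G.dist y z := Γ.conn.dist_triangle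
  have h2 : Γ.G.dist x y ≤ Γ.G.dist x z + Γ.G.dist z y := Γ.conn.dist_triangle
  rw [SimpleGraph.dist_comm (u := z)] at h2
  rw [SimpleGraph.dist_eq_one_iff_adj.2 h] at h1 h2
  exact ⟨h1, h2⟩

theorem ncard_neighbors (y : Γ.X) : {z : Γ.X | Γ.G.Adj y z}.ncard = Γ.b 0 := by
  rw [← Γ.count_b 0 (Nat.zero_le _) y y SimpleGraph.dist_self]
  congr 1
  ext z
  simp only [Set.mem_ofPred_eq, zero_add]
  exact ⟨fun h => ⟨h, SimpleGraph.dist_eq_one_iff_adj.2 h⟩, fun h => h.1⟩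

theorem iArray : IArray (Γ.b 0) Γ.d Γ.b Γ.c where
  b_zero := rfl
  b_last := Γ.bd
  c_zero := Γ.c0
  b_pos i hi := by
    obtain ⟨x, y, h⟩ := Γ.exists_dist_eq (i := i + 1) hi
    obtain ⟨z, h1, h2⟩ := Γ.exists_adj_dist h
    rw [← Γ.count_b i hi.le x z h2]
    exact (Set.ncard_pos (Set.toFinite _)).2 ⟨y, h1.symm, h⟩
  c_pos i h1 hi := by
    obtain ⟨i, rfl⟩ := Nat.exists_eq_add_of_le' h1
    obtain ⟨x, y, h⟩ := Γ.exists_dist_eq hi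
    obtain ⟨z, h1, h2⟩ := Γ.exists_adj_dist h
    rw [← Γ.count_c _ hi x y h]
    exact (Set.ncard_pos (Set.toFinite _)).2 ⟨z, h1, h2⟩
  b_anti i j hij hj := by
    obtain ⟨x, y, h⟩ := Γ.exists_dist_eq hj
    obtain ⟨x', h1, h2⟩ := Γ.exists_dist_between (i := j - i) (j := i) (by omega : Γ.G.dist x y = _)
    rw [← Γ.count_b j hj x y h, ← Γ.count_b i (hij.trans hj) x' y h2]
    refine Set.ncard_le_ncard fun z ⟨hz1, hz2⟩ => ⟨hz1, ?_⟩
    have h3 : Γ.G.dist x z ≤ Γ.G.dist x x' + Γ.G.dist x' z := Γ.conn.dist_triangle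
    have h4 := dist_adj (x := x') hz1
    omega
  c_mono i j hij hj := by
    rcases i.eq_zero_or_pos with rfl | hi
    · rw [Γ.c0]; exact Nat.zero_le _
    obtain ⟨x, y, h⟩ := Γ.exists_dist_eq hj
    obtain ⟨x', h1, h2⟩ := Γ.exists_dist_between (i := j - i) (j := i) (by omega : Γ.G.dist x y = _)
    rw [← Γ.count_c j hj x y h, ← Γ.count_c i (hij.trans hj) x' y h2]
    refine Set.ncard_le_ncard fun z ⟨hz1, hz2⟩ => ⟨hz1, ?_⟩
    have h3 : Γ.G.dist x z ≤ Γ.G.dist x x' + Γ.G.dist x' z := Γ.conn.dist_triangle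
    have h4 := dist_adj (x := x) hz1
    omega
  add_le i hi := by
    obtain ⟨x, y, h⟩ := Γ.exists_dist_eq hi
    rw [← Γ.ncard_neighbors y, ← Γ.count_c i hi x y h, ← Γ.count_b i hi x y h,
      ← Set.ncard_union_eq]
    · exact Set.ncard_le_ncard fun z hz => hz.elim And.left And.left
    · exact Set.disjoint_left.2 fun z h1 h2 => by
        have := h1.2; have := h2.2; omega
  c_le_b i j hij := by
    rcases j.eq_zero_or_pos with rfl | hj
    · rw [Γ.c0]; exact Nat.zero_le _
    obtain ⟨x, w, h⟩ := Γ.exists_dist_eq hij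
    obtain ⟨y, h1, h2⟩ := Γ.exists_dist_between h
    rw [SimpleGraph.dist_comm] at h2
    rw [← Γ.count_c j (by omega) w y h2, ← Γ.count_b i (by omega) x y h1]
    refine Set.ncard_le_ncard fun z ⟨hz1, hz2⟩ => ⟨hz1, ?_⟩
    have h3 : Γ.G.dist x w ≤ Γ.G.dist x z + Γ.G.dist z w := Γ.conn.dist_triangle
    rw [SimpleGraph.dist_comm (u := z)] at h3
    have h4 := dist_adj (x := x) hz1
    omega

/-- The sum of a radial function over the neighbors of a vertex. -/
theorem sum_neighbors {R : Type*} [CommRing R] (f : ℕ → R) (x y : Γ.X) :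
    ∑ z, (if Γ.G.Adj y z then f (Γ.G.dist x z) else 0) =
      Γ.b 0 * f (Γ.G.dist x y) +
      Γ.c (Γ.G.dist x y) * (f (Γ.G.dist x y - 1) - f (Γ.G.dist x y)) +
      Γ.b (Γ.G.dist x y) * (f (Γ.G.dist x y + 1) - f (Γ.G.dist x y)) := by
  have hcard : ∀ (p : Γ.X → Prop) [DecidablePred p] (t : R),
      ∑ z, (if p z then t else 0) = ({z | p z}.ncard : R) * t := fun p _ t => by
    rw [← Finset.sum_filter, Finset.sum_const, nsmul_eq_mul,
      Set.ncard_eq_toFinset_card', Set.toFinset_ofPred]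
  have hi := Γ.dist_le x y
  generalize hij : Γ.G.dist x y = i at hi ⊢
  rw [← Γ.ncard_neighbors y, ← Γ.count_c i hi x y hij, ← Γ.count_b i hi x y hij,
    ← hcard, ← hcard, ← hcard, ← Finset.sum_add_distrib, ← Finset.sum_add_distrib]
  refine Finset.sum_congr rfl fun z _ => ?_
  by_cases hz : Γ.G.Adj y z
  · have h1 := dist_adj (x := x) hz
    rw [hij] at h1
    simp only [hz, if_true, true_and]
    by_cases e1 : Γ.G.dist x z = i + 1
    · simp [e1, show i + 1 ≠ i - 1 by omega]
    · by_cases e2 : Γ.G.dist x z = i - 1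
      · simp [e2, show i - 1 ≠ i + 1 by omega]
      · simp [show Γ.G.dist x z = i by omega, show i ≠ i - 1 by omega]
  · simp [hz]

end DRG

/-- The standard sequence of an intersection array, as polynomials in the eigenvalue. -/
noncomputable def cosPoly (k : ℕ) (b c : ℕ → ℕ) : ℕ → Polynomial ℚ
  | 0 => 1
  | 1 => 1 + Polynomial.C ((b 0 : ℚ)⁻¹) * (Polynomial.X - (k : Polynomial ℚ))
  | (i + 2) => cosPoly k b c (i + 1) + Polynomial.C ((b (i + 1) : ℚ)⁻¹) *
      ((Polynomial.X - (k : Polynomial ℚ)) * cosPoly k b c (i + 1) -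
        (c (i + 1) : Polynomial ℚ) * (cosPoly k b c i - cosPoly k b c (i + 1)))

/-- The number of vertices at distance `i` from a given vertex. -/
def sphereCard (b c : ℕ → ℕ) : ℕ → ℚ
  | 0 => 1
  | (i + 1) => sphereCard b c i * b i / c (i + 1)

/-- The value of the standard sequence. -/
noncomputable def cosSeq (k : ℕ) (b c : ℕ → ℕ) (θ : ℝ) (i : ℕ) : ℝ :=
  Polynomial.aeval θ (cosPoly k b c i)

theorem cosSeq_zero (k : ℕ) (b c : ℕ → ℕ) (θ : ℝ) : cosSeq k b c θ 0 = 1 := by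
  simp [cosSeq, cosPoly]

namespace IArray

variable {k d : ℕ} {b c : ℕ → ℕ}

theorem cosSeq_rec (h : IArray k d b c) (θ : ℝ) {i : ℕ} (hi : i < d) :
    k * cosSeq k b c θ i + c i * (cosSeq k b c θ (i - 1) - cosSeq k b c θ i) +
      b i * (cosSeq k b c θ (i + 1) - cosSeq k b c θ i) = θ * cosSeq k b c θ i := by
  have hb : (b i : ℝ) ≠ 0 := by exact_mod_cast (Nat.pos_iff_ne_zero.1 (h.b_pos i hi))
  rcases i with _ | i
  · simp only [cosSeq, cosPoly, h.c_zero]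
    simp
    field_simp
    ring
  · simp only [cosSeq, cosPoly, Nat.add_sub_cancel]
    simp
    field_simp
    ring

theorem cosSeq_eq_ratio (h : IArray k d b c) (θ : ℝ) {i : ℕ} (hi : i ≤ d) :
    cosSeq k b c θ i = stdSeq k b c θ i / stdSeq k b c k i := by
  induction i using Nat.strong_induction_on with
  | _ i ih =>
    rcases i with _ | i
    · simp [cosSeq, cosPoly, stdSeq, triSeq]
    · have e1 := h.cosSeq_rec θ (i := i) hi
      have e2 := h.ratio_rec θ (i := i) hi
      rw [← ih i (by omega) (by omega), ← ih (i - 1) (by omega) (by omega)] at e2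
      have hb : (b i : ℝ) ≠ 0 := by exact_mod_cast (Nat.pos_iff_ne_zero.1 (h.b_pos i hi))
      refine mul_left_cancel₀ hb ?_
      linear_combination e1 + e2

theorem sphereCard_eq (h : IArray k d b c) {i : ℕ} (hi : i ≤ d) :
    (sphereCard b c i : ℝ) = stdSeq k b c k i ^ 2 := by
  induction i with
  | zero => simp [sphereCard, stdSeq, triSeq]
  | succ i ih =>
    have hc : (c (i + 1) : ℝ) ≠ 0 := by
      exact_mod_cast (Nat.pos_iff_ne_zero.1 (h.c_pos (i + 1) (by omega) hi))
    have := h.mul_sq_stdSeq_valency (i := i) hi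
    rw [sphereCard]
    push_cast
    rw [ih (by omega)]
    field_simp
    linarith

theorem sig_eq_sum (h : IArray k d b c) (θ : ℝ) :
    sig k d b c θ = ∑ i ∈ Finset.range (d + 1), sphereCard b c i * cosSeq k b c θ i ^ 2 := by
  refine Finset.sum_congr rfl fun i hi => ?_
  have hi : i ≤ d := Nat.lt_succ_iff.1 (Finset.mem_range.1 hi)
  have := (h.stdSeq_valency_pos hi).ne'
  rw [h.sphereCard_eq hi, h.cosSeq_eq_ratio θ hi]
  field_simp

theorem mem_spec_iff (h : IArray k d b c) (hd : 1 ≤ d) (θ : ℝ) :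
    θ ∈ spec k d b c ↔ (k - θ) * cosSeq k b c θ d +
      c d * (cosSeq k b c θ (d - 1) - cosSeq k b c θ d) = 0 := by
  rw [spec, mem_triSpecF h.coupling]
  obtain ⟨d, rfl⟩ := Nat.exists_eq_add_of_le' hd
  have s0 := h.stdSeq_valency_pos (i := d) (by omega)
  have s1 := h.stdSeq_valency_pos (i := d + 1) le_rfl
  have e := (h.coupSeq_mul_stdSeq_valency (i := d) (by omega)).2
  have f0 : stdSeq k b c θ d = cosSeq k b c θ d * stdSeq k b c k d := by
    rw [h.cosSeq_eq_ratio θ (by omega)]; field_simp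
  have f1 : stdSeq k b c θ (d + 1) = cosSeq k b c θ (d + 1) * stdSeq k b c k (d + 1) := by
    rw [h.cosSeq_eq_ratio θ le_rfl]; field_simp
  change (θ - diagSeq k b c (d + 1)) * stdSeq k b c θ (d + 1) =
    coupSeq b c (d + 1) * stdSeq k b c θ d ↔ _
  rw [f0, f1, diagSeq, h.b_last, Nat.add_sub_cancel]
  constructor
  · intro hh
    refine mul_left_cancel₀ s1.ne' ?_
    push_cast at hh ⊢
    linear_combination -hh - cosSeq k b c θ d * e
  · intro hh
    push_cast at hh ⊢
    linear_combination (-stdSeq k b c k (d + 1)) * hh - cosSeq k b c θ d * e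

theorem cosSeq_rec_of_mem (h : IArray k d b c) (hd : 1 ≤ d) {θ : ℝ} (hθ : θ ∈ spec k d b c)
    {i : ℕ} (hi : i ≤ d) :
    k * cosSeq k b c θ i + c i * (cosSeq k b c θ (i - 1) - cosSeq k b c θ i) +
      b i * (cosSeq k b c θ (i + 1) - cosSeq k b c θ i) = θ * cosSeq k b c θ i := by
  rcases hi.lt_or_eq with hi | rfl
  · exact h.cosSeq_rec θ hi
  · have := (h.mem_spec_iff hd θ).1 hθ
    rw [h.b_last]
    push_cast
    linarith

theorem cosSeq_valency (h : IArray k d b c) {i : ℕ} (hi : i ≤ d) : cosSeq k b c k i = 1 := by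
  rw [h.cosSeq_eq_ratio _ hi, div_self (h.stdSeq_valency_pos hi).ne']

theorem valency_mem_spec (h : IArray k d b c) (hd : 1 ≤ d) : (k : ℝ) ∈ spec k d b c := by
  rw [h.mem_spec_iff hd, h.cosSeq_valency le_rfl, h.cosSeq_valency (by omega)]
  ring

/-- The total number of vertices grows at most like a geometric sum. -/
theorem sig_valency_le (h : IArray k d b c) :
    sig k d b c k ≤ ∑ i ∈ Finset.range (d + 1), (k : ℝ) ^ i := by
  have : ∀ i ≤ d, stdSeq k b c k i ^ 2 ≤ (k : ℝ) ^ i := fun i => by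
    induction i with
    | zero => simp [stdSeq, triSeq]
    | succ i ih =>
      intro hi
      have e1 := h.mul_sq_stdSeq_valency (i := i) hi
      have e2 : (1 : ℝ) ≤ c (i + 1) := by exact_mod_cast h.c_pos (i + 1) (by omega) hi
      have e3 : (b i : ℝ) ≤ k := by exact_mod_cast h.b_le (by omega)
      calc stdSeq k b c k (i + 1) ^ 2 ≤ c (i + 1) * stdSeq k b c k (i + 1) ^ 2 :=
            le_mul_of_one_le_left (sq_nonneg _) e2
        _ = b i * stdSeq k b c k i ^ 2 := e1
        _ ≤ k * (k : ℝ) ^ i := mul_le_mul e3 (ih (by omega)) (sq_nonneg _) (Nat.cast_nonneg _)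
        _ = _ := by ring
  exact Finset.sum_le_sum fun i hi => this i (Nat.lt_succ_iff.1 (Finset.mem_range.1 hi))

end IArray

theorem Matrix.trace_eq_mul_rank {n : Type*} [Fintype n] [DecidableEq n] {M : Matrix n n ℝ} {s : ℝ}
    (hs : s ≠ 0) (h : M * M = s • M) : M.trace = s * M.rank := by
  have h1 : IsIdempotentElem (s⁻¹ • Matrix.toLin' M) := by
    rw [IsIdempotentElem, Module.End.mul_eq_comp, LinearMap.smul_comp, LinearMap.comp_smul,
      ← Matrix.toLin'_mul, h, map_smul, smul_smul s⁻¹ s, inv_mul_cancel₀ hs, one_smul]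
  have h2 := (LinearMap.IsIdempotentElem.isProj_range _ h1).trace
  rw [map_smul, Matrix.trace_toLin'_eq, LinearMap.range_smul _ _ (inv_ne_zero hs),
    smul_eq_mul] at h2
  rw [← mul_inv_cancel_left₀ hs M.trace, h2]
  rfl

namespace DRG

variable (Γ : DRG)

/-- The real `i`-th distance matrix. -/
noncomputable def distMat (i : ℕ) : Matrix Γ.X Γ.X ℝ :=
  Matrix.of fun x y => if Γ.G.dist x y = i then 1 else 0

/-- The radial matrix given by the standard sequence. -/
noncomputable def cosMat (θ : ℝ) : Matrix Γ.X Γ.X ℝ :=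
  Matrix.of fun x y => cosSeq (Γ.b 0) Γ.b Γ.c θ (Γ.G.dist x y)

theorem cosMat_apply (θ : ℝ) (x y : Γ.X) :
    Γ.cosMat θ x y = cosSeq (Γ.b 0) Γ.b Γ.c θ (Γ.G.dist x y) := rfl

theorem adjMatrix_mul_apply (f : ℕ → ℝ) (x y : Γ.X) :
    (Γ.G.adjMatrix ℝ * Matrix.of fun x y => f (Γ.G.dist x y)) y x =
      Γ.b 0 * f (Γ.G.dist x y) +
      Γ.c (Γ.G.dist x y) * (f (Γ.G.dist x y - 1) - f (Γ.G.dist x y)) +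
      Γ.b (Γ.G.dist x y) * (f (Γ.G.dist x y + 1) - f (Γ.G.dist x y)) := by
  rw [← Γ.sum_neighbors, Matrix.mul_apply]
  refine Finset.sum_congr rfl fun z _ => ?_
  rw [SimpleGraph.adjMatrix_apply, Matrix.of_apply, SimpleGraph.dist_comm]
  split_ifs <;> simp

theorem adjMatrix_mul_cosMat (hd : 1 ≤ Γ.d) {θ : ℝ} (hθ : θ ∈ spec (Γ.b 0) Γ.d Γ.b Γ.c) :
    Γ.G.adjMatrix ℝ * Γ.cosMat θ = θ • Γ.cosMat θ := by
  ext y x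
  rw [cosMat, Γ.adjMatrix_mul_apply, Γ.iArray.cosSeq_rec_of_mem hd hθ (Γ.dist_le x y),
    Matrix.smul_apply, Matrix.of_apply, SimpleGraph.dist_comm, smul_eq_mul]

theorem smul_distMat_succ (i : ℕ) :
    (Γ.c (i + 1) : ℝ) • Γ.distMat (i + 1) = Γ.G.adjMatrix ℝ * Γ.distMat i -
      ((Γ.b 0 : ℝ) - Γ.b i - Γ.c i) • Γ.distMat i -
      (if i = 0 then 0 else (Γ.b (i - 1) : ℝ)) • Γ.distMat (i - 1) := by
  ext y x
  have h1 := Γ.adjMatrix_mul_apply (fun j => if j = i then (1 : ℝ) else 0) x y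
  rw [Matrix.sub_apply, Matrix.sub_apply, distMat, distMat, h1]
  simp only [Matrix.smul_apply, distMat, Matrix.of_apply, smul_eq_mul,
    SimpleGraph.dist_comm (u := y)]
  generalize Γ.G.dist x y = j
  rcases j with _ | j
  · rw [Γ.c0]
    rcases i with _ | _ | i
    · simp [Γ.c0]
    · simp
    · simp
  · rcases i with _ | i
    · rcases j with _ | j
      · simp
      · simp
    · by_cases e1 : j = i + 1
      · subst e1; simp [show i + 1 + 1 ≠ i by omega]
      · by_cases e2 : j = i
        · subst e2; simp
          ring
        · by_cases e3 : j + 1 = i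
          · subst e3; simp [show j ≠ j + 1 + 1 by omega]
          · simp [e1, e2, e3]

theorem distMat_zero : Γ.distMat 0 = 1 := by
  ext x y
  simp [distMat, Γ.conn.dist_eq_zero_iff, Matrix.one_apply]

theorem distMat_mul_cosMat (hd : 1 ≤ Γ.d) {θ : ℝ} (hθ : θ ∈ spec (Γ.b 0) Γ.d Γ.b Γ.c) {i : ℕ}
    (hi : i ≤ Γ.d) : Γ.distMat i * Γ.cosMat θ =
      (sphereCard Γ.b Γ.c i * cosSeq (Γ.b 0) Γ.b Γ.c θ i : ℝ) • Γ.cosMat θ := by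
  induction i using Nat.strong_induction_on with
  | _ i ih =>
    rcases i with _ | i
    · simp [distMat_zero, sphereCard, cosSeq_zero]
    · have hc : (Γ.c (i + 1) : ℝ) ≠ 0 := by
        exact_mod_cast (Nat.pos_iff_ne_zero.1 (Γ.iArray.c_pos (i + 1) (by omega) hi))
      refine smul_right_injective _ hc ?_
      change (Γ.c (i + 1) : ℝ) • (Γ.distMat (i + 1) * Γ.cosMat θ) = (Γ.c (i + 1) : ℝ) • _
      rw [← Matrix.smul_mul, Γ.smul_distMat_succ, Matrix.sub_mul, Matrix.sub_mul, Matrix.mul_assoc,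
        Matrix.smul_mul, Matrix.smul_mul, ih i (by omega) (by omega),
        ih (i - 1) (by omega) (by omega), Matrix.mul_smul, Γ.adjMatrix_mul_cosMat hd hθ,
        smul_smul, smul_smul, smul_smul, smul_smul, ← sub_smul, ← sub_smul]
      congr 1
      have e1 := Γ.iArray.cosSeq_rec θ (i := i) hi
      have e2 : (if i = 0 then 0 else (Γ.b (i - 1) : ℝ)) * sphereCard Γ.b Γ.c (i - 1) =
          Γ.c i * sphereCard Γ.b Γ.c i := by
        rcases i with _ | i
        · simp [Γ.c0]
        · have hc : (Γ.c (i + 1) : ℝ) ≠ 0 := by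
            exact_mod_cast (Nat.pos_iff_ne_zero.1 (Γ.iArray.c_pos (i + 1) (by omega) (by omega)))
          simp [sphereCard]
          field_simp
      have e3 : (Γ.c (i + 1) : ℝ) * sphereCard Γ.b Γ.c (i + 1) = Γ.b i * sphereCard Γ.b Γ.c i := by
        simp [sphereCard]
        field_simp
      linear_combination (-sphereCard Γ.b Γ.c i : ℝ) * e1 -
        cosSeq (Γ.b 0) Γ.b Γ.c θ (i - 1) * e2 - cosSeq (Γ.b 0) Γ.b Γ.c θ (i + 1) * e3

theorem cosMat_eq_sum (θ : ℝ) : Γ.cosMat θ =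
    ∑ i ∈ Finset.range (Γ.d + 1), cosSeq (Γ.b 0) Γ.b Γ.c θ i • Γ.distMat i := by
  ext x y
  rw [Matrix.sum_apply]
  simp only [Matrix.smul_apply, distMat, Matrix.of_apply, smul_eq_mul, mul_ite, mul_one, mul_zero]
  rw [Finset.sum_ite_eq, if_pos (Finset.mem_range.2 (Nat.lt_succ_of_le (Γ.dist_le x y)))]
  rfl

theorem cosMat_mul_self (hd : 1 ≤ Γ.d) {θ : ℝ} (hθ : θ ∈ spec (Γ.b 0) Γ.d Γ.b Γ.c) :
    Γ.cosMat θ * Γ.cosMat θ = sig (Γ.b 0) Γ.d Γ.b Γ.c θ • Γ.cosMat θ := by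
  conv_lhs => rw [Γ.cosMat_eq_sum θ, Matrix.sum_mul, ← Γ.cosMat_eq_sum θ]
  rw [Γ.iArray.sig_eq_sum, Finset.sum_smul]
  refine Finset.sum_congr rfl fun i hi => ?_
  rw [Matrix.smul_mul, Γ.distMat_mul_cosMat hd hθ (Nat.lt_succ_iff.1 (Finset.mem_range.1 hi)),
    smul_smul]
  congr 1
  ring

theorem one_le_sig (θ : ℝ) : 1 ≤ sig (Γ.b 0) Γ.d Γ.b Γ.c θ := by
  have := Finset.single_le_sum (f := fun i => stdSeq (Γ.b 0) Γ.b Γ.c θ i ^ 2)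
    (fun _ _ => sq_nonneg _) (Finset.mem_range.2 (Nat.succ_pos Γ.d))
  simpa [stdSeq, triSeq, sig] using this

theorem card_eq_mul_rank (hd : 1 ≤ Γ.d) {θ : ℝ} (hθ : θ ∈ spec (Γ.b 0) Γ.d Γ.b Γ.c) :
    (Fintype.card Γ.X : ℝ) = sig (Γ.b 0) Γ.d Γ.b Γ.c θ * (Γ.cosMat θ).rank := by
  rw [← Matrix.trace_eq_mul_rank (zero_lt_one.trans_le (Γ.one_le_sig θ)).ne'
    (Γ.cosMat_mul_self hd hθ)]
  simp [Matrix.trace, cosMat, cosSeq_zero]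

theorem sig_valency (hd : 1 ≤ Γ.d) : sig (Γ.b 0) Γ.d Γ.b Γ.c (Γ.b 0) = Fintype.card Γ.X := by
  obtain ⟨x, -⟩ := Γ.dist_eq
  have h1 := congrFun (congrFun (Γ.cosMat_mul_self hd (Γ.iArray.valency_mem_spec hd)) x) x
  simp only [Matrix.mul_apply, Matrix.smul_apply, cosMat_apply,
    Γ.iArray.cosSeq_valency (Γ.dist_le _ _)] at h1
  simpa using h1.symm

end DRG

theorem IArray.eq_of_aeval_minpoly {k d : ℕ} {b c : ℕ → ℕ} (h : IArray k d b c) (hd : 1 ≤ d)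
    {θ θ' : ℝ} (hi : IsIntegral ℤ θ) (hθ : θ ∈ spec k d b c)
    (hθ' : Polynomial.aeval θ' (minpoly ℤ θ) = 0) {s : ℚ} (hs : sig k d b c θ = s) :
    θ' ∈ spec k d b c ∧ sig k d b c θ' = s := by
  have key : ∀ p : Polynomial ℚ, Polynomial.aeval θ p = 0 → Polynomial.aeval θ' p = 0 := by
    intro p hp
    obtain ⟨q, rfl⟩ := minpoly.dvd ℚ θ hp
    rw [map_mul, minpoly.isIntegrallyClosed_eq_field_fractions' ℚ hi,
      Polynomial.aeval_map_algebraMap, hθ', zero_mul]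
  constructor
  · rw [h.mem_spec_iff hd] at hθ ⊢
    have := key (((k : Polynomial ℚ) - Polynomial.X) * cosPoly k b c d +
      (c d : Polynomial ℚ) * (cosPoly k b c (d - 1) - cosPoly k b c d)) (by
        simpa [cosSeq] using hθ)
    simpa [cosSeq] using this
  · rw [h.sig_eq_sum] at hs ⊢
    have := key (∑ i ∈ Finset.range (d + 1), Polynomial.C (sphereCard b c i) *
      cosPoly k b c i ^ 2 - Polynomial.C s) (by
        simpa [cosSeq, sub_eq_zero] using hs)
    simpa [cosSeq, sub_eq_zero] using this

namespace DRG

variable (Γ : DRG)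

theorem abs_le_valency (hd : 1 ≤ Γ.d) {θ : ℝ} (hθ : θ ∈ spec (Γ.b 0) Γ.d Γ.b Γ.c) :
    |θ| ≤ Γ.b 0 := by
  obtain ⟨x, -⟩ := Γ.dist_eq
  obtain ⟨y, -, hy⟩ := Finset.exists_max_image Finset.univ (fun y => |Γ.cosMat θ y x|)
    ⟨x, Finset.mem_univ x⟩
  have h1 : 0 < |Γ.cosMat θ y x| := lt_of_lt_of_le (by simp [cosMat_apply, cosSeq_zero])
    (hy x (Finset.mem_univ x))
  have h2 := congrFun (congrFun (Γ.adjMatrix_mul_cosMat hd hθ) y) x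
  rw [Matrix.mul_apply, Matrix.smul_apply, smul_eq_mul] at h2
  refine le_of_mul_le_mul_right ?_ h1
  rw [← abs_mul, ← h2]
  refine (Finset.abs_sum_le_sum_abs _ _).trans ?_
  have h3 := Γ.sum_neighbors (fun _ => |Γ.cosMat θ y x|) x y
  simp only [sub_self, mul_zero, add_zero] at h3
  rw [← h3]
  refine Finset.sum_le_sum fun z _ => ?_
  rw [SimpleGraph.adjMatrix_apply]
  split_ifs
  · rw [one_mul]; exact hy z (Finset.mem_univ z)
  · simp

theorem map_charpoly_adjMatrix {R : Type*} [CommRing R] :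
    (Γ.G.adjMatrix ℤ).charpoly.map (Int.castRingHom R) = (Γ.G.adjMatrix R).charpoly := by
  rw [← Matrix.charpoly_map]
  congr 1
  ext x y
  simp [SimpleGraph.adjMatrix_apply]

theorem aeval_charpoly_adjMatrix (hd : 1 ≤ Γ.d) {θ : ℝ} (hθ : θ ∈ spec (Γ.b 0) Γ.d Γ.b Γ.c) :
    Polynomial.aeval θ (Γ.G.adjMatrix ℤ).charpoly = 0 := by
  obtain ⟨x, -⟩ := Γ.dist_eq
  rw [← Polynomial.aeval_map_algebraMap ℝ]
  change Polynomial.aeval θ ((Γ.G.adjMatrix ℤ).charpoly.map (Int.castRingHom ℝ)) = 0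
  rw [Γ.map_charpoly_adjMatrix, Polynomial.coe_aeval_eq_eval, Matrix.eval_charpoly,
    ← Matrix.exists_mulVec_eq_zero_iff]
  refine ⟨fun y => Γ.cosMat θ y x, fun h => ?_, ?_⟩
  · have := congrFun h x
    simp [cosMat_apply, cosSeq_zero] at this
  · ext y
    have := congrFun (congrFun (Γ.adjMatrix_mul_cosMat hd hθ) y) x
    rw [Matrix.mul_apply, Matrix.smul_apply, smul_eq_mul] at this
    rw [Matrix.sub_mulVec, Pi.sub_apply, Matrix.scalar_apply, Matrix.mulVec_diagonal,
      Pi.zero_apply, sub_eq_zero]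
    exact this.symm

theorem exists_real_root {z : ℂ} (hz : Polynomial.aeval z (Γ.G.adjMatrix ℤ).charpoly = 0) :
    ∃ t : ℝ, (t : ℂ) = z := by
  have hA : (Γ.G.adjMatrix ℝ).IsHermitian := by
    rw [Matrix.IsHermitian, Matrix.conjTranspose_eq_transpose_of_trivial,
      SimpleGraph.transpose_adjMatrix]
  have h1 := hA.charpoly_eq
  rw [← Γ.map_charpoly_adjMatrix] at h1
  have h2 : Polynomial.aeval z ((Γ.G.adjMatrix ℤ).charpoly.map (algebraMap ℤ ℝ)) = 0 := by
    rw [Polynomial.aeval_map_algebraMap]; exact hz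
  change Polynomial.aeval z ((Γ.G.adjMatrix ℤ).charpoly.map (Int.castRingHom ℝ)) = 0 at h2
  rw [h1, map_prod, Finset.prod_eq_zero_iff] at h2
  obtain ⟨i, -, hi⟩ := h2
  refine ⟨hA.eigenvalues i, ?_⟩
  simp [sub_eq_zero] at hi
  exact hi.symm

theorem galoisClosed (hd : 1 ≤ Γ.d) : GaloisClosed (Γ.b 0) Γ.d Γ.b Γ.c where
  abs_le θ hθ := Γ.abs_le_valency hd hθ
  integral θ hθ := ⟨_, Matrix.charpoly_monic _, Γ.aeval_charpoly_adjMatrix hd hθ⟩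
  conj θ hθ z hz := by
    have hi : IsIntegral ℤ θ := ⟨_, Matrix.charpoly_monic _, Γ.aeval_charpoly_adjMatrix hd hθ⟩
    obtain ⟨q, hq⟩ := minpoly.isIntegrallyClosed_dvd hi (Γ.aeval_charpoly_adjMatrix hd hθ)
    obtain ⟨t, rfl⟩ := Γ.exists_real_root (z := z) (by rw [hq, map_mul, hz, zero_mul])
    have ht : Polynomial.aeval t (minpoly ℤ θ) = 0 := by
      refine Complex.ofReal_injective ?_
      rw [Complex.ofReal_zero, ← hz]
      exact (Polynomial.aeval_algebraMap_apply ℂ t _).symm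
    have hr : ((Γ.cosMat θ).rank : ℝ) ≠ 0 := by
      intro h
      have := Γ.card_eq_mul_rank hd hθ
      obtain ⟨x, -⟩ := Γ.dist_eq
      rw [h, mul_zero, Nat.cast_eq_zero, Fintype.card_eq_zero_iff] at this
      exact this.elim x
    have hs : sig (Γ.b 0) Γ.d Γ.b Γ.c θ =
        ((Fintype.card Γ.X / (Γ.cosMat θ).rank : ℚ) : ℝ) := by
      rw [Rat.cast_div, Rat.cast_natCast, Rat.cast_natCast, eq_div_iff hr,
        Γ.card_eq_mul_rank hd hθ]
    obtain ⟨h1, h2⟩ := Γ.iArray.eq_of_aeval_minpoly hd hi hθ ht hs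
    exact ⟨t, h1, rfl, by rw [h2, hs]⟩

end DRG

namespace DRG

variable (Γ : DRG)

theorem det_cosMat_eq_zero {θ : ℝ} (h : (Γ.cosMat θ).rank ≤ 2) (x : Fin 3 → Γ.X) :
    ((Γ.cosMat θ).submatrix x x).det = 0 := by
  by_contra hdet
  have h1 := Matrix.rank_of_isUnit _ ((Matrix.isUnit_iff_isUnit_det _).2 (isUnit_iff_ne_zero.2 hdet))
  have h2 := Matrix.rank_submatrix_le (Γ.cosMat θ) x x
  rw [h1, Fintype.card_fin] at h2
  omega

theorem exists_three_neighbors (h : 3 ≤ Γ.b 0) (x : Γ.X) :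
    ∃ y₁ y₂ y₃ : Γ.X, Γ.G.Adj x y₁ ∧ Γ.G.Adj x y₂ ∧ Γ.G.Adj x y₃ ∧ y₁ ≠ y₂ ∧ y₁ ≠ y₃ ∧ y₂ ≠ y₃ := by
  rw [← Γ.ncard_neighbors x, Nat.succ_le_iff, Set.two_lt_ncard] at h
  obtain ⟨y₁, h1, y₂, h2, y₃, h3, h12, h13, h23⟩ := h
  exact ⟨y₁, y₂, y₃, h1, h2, h3, h12, h13, h23⟩

/-- Eigenvalues close to the valency have multiplicity at least three. -/
theorem three_le_rank (hk : 3 ≤ Γ.b 0) (hd : 2 ≤ Γ.d) {θ : ℝ} (h1 : (Γ.b 0 : ℝ) - 1 < θ)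
    (h2 : θ < Γ.b 0) : 3 ≤ (Γ.cosMat θ).rank := by
  by_contra hr
  have hdet := Γ.det_cosMat_eq_zero (θ := θ) (by omega)
  have hk' : (3 : ℝ) ≤ Γ.b 0 := by exact_mod_cast hk
  set u := cosSeq (Γ.b 0) Γ.b Γ.c θ with hu
  have u0 : u 0 = 1 := cosSeq_zero _ _ _ _
  have e0 := Γ.iArray.cosSeq_rec θ (i := 0) (by omega)
  have e1 := Γ.iArray.cosSeq_rec θ (i := 1) (by omega)
  rw [← hu, u0, Γ.c0] at e0
  simp only [Nat.sub_self, ← hu, u0] at e1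
  have hu1 : Γ.b 0 * u 1 = θ := by
    push_cast at e0
    linear_combination e0
  have u1pos : 1 / 2 < u 1 := by
    by_contra! hcon
    have := mul_le_mul_of_nonneg_left hcon (by linarith : (0 : ℝ) ≤ Γ.b 0)
    linarith
  have u1lt : u 1 < 1 := by
    by_contra! hcon
    have := mul_le_mul_of_nonneg_left hcon (by linarith : (0 : ℝ) ≤ Γ.b 0)
    linarith
  have u2lt : u 2 < 1 := by
    by_contra! hcon
    have hb : (0 : ℝ) ≤ Γ.b 1 := Nat.cast_nonneg _
    have hc : (0 : ℝ) ≤ Γ.c 1 := Nat.cast_nonneg _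
    have f1 : 0 ≤ Γ.b 1 * (u (1 + 1) - u 1) := mul_nonneg hb (by norm_num; linarith)
    have f2 : 0 ≤ Γ.c 1 * (1 - u 1) := mul_nonneg hc (by linarith)
    have f3 : 0 < (Γ.b 0 - θ) * u 1 := mul_pos (by linarith) (by linarith)
    linarith
  have hM : ∀ x y, Γ.cosMat θ x y = u (Γ.G.dist x y) := fun _ _ => rfl
  have hself : ∀ x, Γ.cosMat θ x x = 1 := fun x => by rw [hM, SimpleGraph.dist_self, u0]
  have hadj : ∀ x y, Γ.G.Adj x y → Γ.cosMat θ x y = u 1 := fun x y h => by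
    rw [hM, SimpleGraph.dist_eq_one_iff_adj.2 h]
  have hsymm : ∀ x y, Γ.cosMat θ x y = Γ.cosMat θ y x := fun x y => by
    rw [hM, hM, SimpleGraph.dist_comm]
  have hpair : ∀ x y z, Γ.G.Adj x y → Γ.G.Adj x z → y ≠ z →
      Γ.cosMat θ y z < 1 ∧ Γ.cosMat θ y z = 2 * u 1 ^ 2 - 1 := by
    intro x y z hy hz hyz
    have hlt : Γ.cosMat θ y z < 1 := by
      have f1 := dist_adj (x := y) hz
      rw [SimpleGraph.dist_eq_one_iff_adj.2 hy.symm] at f1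
      have f2 := Γ.conn.pos_dist_of_ne hyz
      rw [hM]
      rcases (by omega : Γ.G.dist y z = 1 ∨ Γ.G.dist y z = 2) with f | f <;> rw [f]
      · exact u1lt
      · exact u2lt
    refine ⟨hlt, ?_⟩
    have f := hdet ![x, y, z]
    rw [Matrix.det_fin_three] at f
    simp [hself, hadj _ _ hy, hadj _ _ hz, hadj _ _ hy.symm, hadj _ _ hz.symm, hsymm z y] at f
    have f' : (1 - Γ.cosMat θ y z) * (1 + Γ.cosMat θ y z - 2 * u 1 ^ 2) = 0 := by
      linear_combination f
    rcases mul_eq_zero.1 f' with f' | f' <;> linarith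
  obtain ⟨x, -⟩ := Γ.dist_eq
  obtain ⟨y₁, y₂, y₃, hy₁, hy₂, hy₃, h12, h13, h23⟩ := Γ.exists_three_neighbors hk x
  obtain ⟨g1, g12⟩ := hpair x y₁ y₂ hy₁ hy₂ h12
  have g13 := (hpair x y₁ y₃ hy₁ hy₃ h13).2
  have g23 := (hpair x y₂ y₃ hy₂ hy₃ h23).2
  rw [g12] at g1
  have f := hdet ![y₁, y₂, y₃]
  rw [Matrix.det_fin_three] at f
  simp [hself, hsymm y₂ y₁, hsymm y₃ y₁, hsymm y₃ y₂, g12, g13, g23] at f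
  have f' : (1 - (2 * u 1 ^ 2 - 1)) ^ 2 * (1 + 2 * (2 * u 1 ^ 2 - 1)) = 0 := by
    linear_combination f
  have p1 : 0 < (1 - (2 * u 1 ^ 2 - 1)) ^ 2 := pow_pos (by linarith) 2
  have p2 : 0 < 1 + 2 * (2 * u 1 ^ 2 - 1) := by nlinarith
  exact (mul_pos p1 p2).ne' f'

theorem three_mul_sig_le (hk : 3 ≤ Γ.b 0) (hd : 2 ≤ Γ.d) {θ : ℝ}
    (hθ : θ ∈ spec (Γ.b 0) Γ.d Γ.b Γ.c) (h1 : (Γ.b 0 : ℝ) - 1 < θ) (h2 : θ < Γ.b 0) :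
    3 * sig (Γ.b 0) Γ.d Γ.b Γ.c θ ≤ sig (Γ.b 0) Γ.d Γ.b Γ.c (Γ.b 0) := by
  rw [Γ.sig_valency (by omega), Γ.card_eq_mul_rank (by omega) hθ, mul_comm]
  exact mul_le_mul_of_nonneg_left (by exact_mod_cast Γ.three_le_rank hk hd h1 h2)
    (zero_le_one.trans (Γ.one_le_sig θ))

end DRG

/-- The Bannai–Ito conjecture (Bang–Dubickas–Koolen–Moulton): for each `k ≥ 3` there
are only finitely many distance-regular graphs of valency `k`; equivalently, there is
a bound `N` on their number of vertices. -/
theorem stmt7 (k : ℕ) (hk : 3 ≤ k) :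
    ∃ N : ℕ, ∀ Γ : DRG, Γ.b 0 = k → Fintype.card Γ.X ≤ N := by
  obtain ⟨D, hD⟩ := exists_diam_le (k := k) (by omega) zero_lt_one
  refine ⟨∑ i ∈ Finset.range (D + 2), k ^ i, ?_⟩
  rintro Γ rfl
  have hd1 : 1 ≤ Γ.d := Γ.iArray.one_le_d (by omega)
  have hdD : Γ.d ≤ D + 1 := by
    rcases hd1.eq_or_lt with h | h
    · omega
    · exact (hD _ _ _ Γ.iArray (Γ.galoisClosed hd1)
        fun θ hθ h1 h2 => Γ.three_mul_sig_le hk h hθ h1 h2).trans (Nat.le_succ D)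
  have h1 := Γ.iArray.sig_valency_le
  rw [Γ.sig_valency hd1] at h1
  have h2 : Fintype.card Γ.X ≤ ∑ i ∈ Finset.range (Γ.d + 1), Γ.b 0 ^ i := by exact_mod_cast h1
  exact h2.trans (Finset.sum_le_sum_of_subset (Finset.range_subset_range.2 (by omega)))
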